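/- Let H be a unicyclic graph and G = H_T obtained by attaching unions of complete graphs at vertices in T ⊆ V(H). Then for all r ≥ 1, reg(S/I(G)^{(r)}) ≤ 2r + reg(S/I(G)) − 2. -/

import Mathlib

open MvPolynomial

noncomputable section

namespace EdgeIdealReg

open scoped Classical

/-- The edge ideal of a simple graph, in the polynomial ring with variables the vertices. -/
def edgeIdeal (K : Type) [Field K] {V : Type} (G : SimpleGraph V) :
    Ideal (MvPolynomial V K) :=
  Ideal.span { p | ∃ u v : V, G.Adj u v ∧ p = X u * X v }

/-- The edge ideal of the induced subgraph on a set `s` of vertices, viewed inside the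
polynomial ring of the ambient graph (extra variables do not change the regularity). -/
def edgeIdealOn (K : Type) [Field K] {V : Type} (G : SimpleGraph V) (s : Set V) :
    Ideal (MvPolynomial V K) :=
  Ideal.span { p | ∃ u v : V, G.Adj u v ∧ u ∈ s ∧ v ∈ s ∧ p = X u * X v }

/-- The `r`-th symbolic power of an ideal: the intersection over all minimal primes `p` of `I`
of the contraction of `I^r` localized at `p`; concretely,
`f ∈ I^{(r)}` iff for every minimal prime `p` of `I` there is `s ∉ p` with `s * f ∈ I ^ r`. -/
def symbolicPower {R : Type} [CommRing R] (I : Ideal R) (r : ℕ) : Ideal R where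
  carrier := { f | ∀ p ∈ I.minimalPrimes, ∃ s, s ∉ p ∧ s * f ∈ I ^ r }
  zero_mem' := by
    intro p hp
    exact ⟨1, (Ideal.ne_top_iff_one p).mp hp.1.1.ne_top, by simp⟩
  add_mem' := by
    intro a b ha hb p hp
    obtain ⟨s, hs, hsa⟩ := ha p hp
    obtain ⟨t, ht, htb⟩ := hb p hp
    refine ⟨s * t, fun h => ?_, ?_⟩
    · rcases hp.1.1.mem_or_mem h with h' | h'
      · exact hs h'
      · exact ht h'
    · have : s * t * (a + b) = t * (s * a) + s * (t * b) := by ring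
      rw [this]
      exact Ideal.add_mem _ (Ideal.mul_mem_left _ _ hsa) (Ideal.mul_mem_left _ _ htb)
  smul_mem' := by
    intro c f hf p hp
    obtain ⟨s, hs, hsf⟩ := hf p hp
    refine ⟨s, hs, ?_⟩
    have : s * (c • f) = c * (s * f) := by
      simp only [smul_eq_mul]; ring
    rw [this]
    exact Ideal.mul_mem_left _ _ hsf

/-- Symbolic power with an integer exponent, with the convention `I^{(k)} = S` for `k ≤ 0`. -/
def symbolicPowerZ {R : Type} [CommRing R] (I : Ideal R) (k : ℤ) : Ideal R :=
  if k ≤ 0 then ⊤ else symbolicPower I k.toNat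

/-- A graded free resolution of `S/I` over the polynomial ring `S = K[x_v]`:
`⋯ → F_{i+1} → F_i → ⋯ → F_0 = S → S/I → 0`, where `F_i` is a graded free module with
basis elements of degrees `deg i k`, the differentials are given by matrices of homogeneous
polynomials of the appropriate degrees, the image of `F_1 → F_0 = S` is `I`, and the
complex is exact in positive homological degrees. -/
structure GradedFreeResolution {K : Type} [Field K] {σ : Type}
    (I : Ideal (MvPolynomial σ K)) where
  rank : ℕ → ℕ
  deg : (i : ℕ) → Fin (rank i) → ℕ
  rank_zero : rank 0 = 1
  deg_zero : ∀ k, deg 0 k = 0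
  mat : (i : ℕ) → Matrix (Fin (rank i)) (Fin (rank (i + 1))) (MvPolynomial σ K)
  homog : ∀ i k j, mat i k j = 0 ∨
    ∃ e, deg (i + 1) j = deg i k + e ∧ (mat i k j).IsHomogeneous e
  range_zero : ∀ f : MvPolynomial σ K,
    f ∈ I ↔ (fun _ => f) ∈ LinearMap.range (Matrix.mulVecLin (mat 0))
  isExact : ∀ i, LinearMap.ker (Matrix.mulVecLin (mat i)) =
    LinearMap.range (Matrix.mulVecLin (mat (i + 1)))

/-- The Castelnuovo–Mumford regularity of the quotient `S/I` for a homogeneous ideal `I` of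
the polynomial ring: the least `d` such that some graded free resolution of `S/I` has all its
`i`-th syzygies generated in degrees `≤ d + i` (the minimal free resolution realizes the
infimum).  By convention `reg (S/S) = ⊥ = -∞`. -/

def regQuot {K : Type} [Field K] {σ : Type} (I : Ideal (MvPolynomial σ K)) : WithBot ℤ :=
  if I = ⊤ then ⊥
  else ((sInf { d : ℤ | ∃ F : GradedFreeResolution I,
      ∀ i (k : Fin (F.rank i)), (F.deg i k : ℤ) ≤ d + i } : ℤ) : WithBot ℤ)

/-- A set of edges of `G` that forms a matching: pairwise disjoint edges. -/
def IsMatchingSet {V : Type} (G : SimpleGraph V) (M : Finset (Sym2 V)) : Prop :=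
  (M : Set (Sym2 V)) ⊆ G.edgeSet ∧
    (M : Set (Sym2 V)).Pairwise fun e f => ∀ v, v ∈ e → v ∉ f

/-- An induced matching: a matching such that no two of its edges are joined by an edge
of `G`, i.e. it is the edge set of an induced subgraph. -/
def IsInducedMatchingSet {V : Type} (G : SimpleGraph V) (M : Finset (Sym2 V)) : Prop :=
  IsMatchingSet G M ∧
    (M : Set (Sym2 V)).Pairwise fun e f => ∀ u v, u ∈ e → v ∈ f → ¬G.Adj u v

/-- The matching number `mat(G)`. -/
def matchingNumber {V : Type} (G : SimpleGraph V) : ℕ :=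
  sSup { n | ∃ M, IsMatchingSet G M ∧ M.card = n }

/-- The induced matching number `ν(G)`. -/
def inducedMatchingNumber {V : Type} (G : SimpleGraph V) : ℕ :=
  sSup { n | ∃ M, IsInducedMatchingSet G M ∧ M.card = n }

/-- `G` has an induced cycle of length `n`. -/
def HasInducedCycle {V : Type} (G : SimpleGraph V) (n : ℕ) : Prop :=
  ∃ f : ZMod n → V, Function.Injective f ∧
    ∀ i j : ZMod n, G.Adj (f i) (f j) ↔ (j = i + 1 ∨ i = j + 1)

/-- A graph is chordal if every induced cycle has length `3`. -/
def Chordal {V : Type} (G : SimpleGraph V) : Prop :=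
  ∀ n, 4 ≤ n → ¬HasInducedCycle G n

/-- A graph is weakly chordal if every induced cycle in `G` and in `Gᶜ` has length at most 4. -/
def WeaklyChordal {V : Type} (G : SimpleGraph V) : Prop :=
  (∀ n, 5 ≤ n → ¬HasInducedCycle G n) ∧ ∀ n, 5 ≤ n → ¬HasInducedCycle Gᶜ n

/-- The co-chordal cover number `cochord(G)`: the least `n` such that `n` co-chordal
subgraphs of `G` cover all the edges of `G`. -/
def cochordNumber {V : Type} (G : SimpleGraph V) : ℕ :=
  sInf { n | ∃ H : Fin n → SimpleGraph V,
    (∀ i, H i ≤ G ∧ Chordal (H i)ᶜ) ∧ ∀ e ∈ G.edgeSet, ∃ i, e ∈ (H i).edgeSet }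

/-- A graph is unicyclic if it contains exactly one cycle. -/
def Unicyclic {V : Type} (G : SimpleGraph V) : Prop :=
  ∃ (v : V) (c : G.Walk v v), c.IsCycle ∧
    ∀ (w : V) (c' : G.Walk w w), c'.IsCycle → { e | e ∈ c'.edges } = { e | e ∈ c.edges }

/-- Data exhibiting `G` as the graph `H_T` obtained from the induced subgraph on `Hset`
by attaching, at each vertex of `T ⊆ Hset`, a union of complete graphs having that vertex as
their only common vertex: a family of cliques `C i` of `G`, each meeting `Hset` exactly in
its attachment vertex `a i ∈ T`, two distinct cliques meeting in at most the common
attachment vertex, together covering all vertices outside `Hset`, and all edges of `G`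
lying either inside `Hset` or inside one of the cliques. -/
structure CliqueAttachment {V : Type} (G : SimpleGraph V) (Hset T : Set V) where
  ι : Type
  C : ι → Finset V
  a : ι → V
  a_mem_T : ∀ i, a i ∈ T
  T_sub : T ⊆ Hset
  inter_H : ∀ i, (C i : Set V) ∩ Hset = {a i}
  a_mem_C : ∀ i, a i ∈ C i
  clique : ∀ i, G.IsClique (C i)
  pairwise_inter : ∀ i j, i ≠ j → (C i : Set V) ∩ (C j : Set V) ⊆ ({a i} : Set V)
  cover : Hset ∪ (⋃ i, (C i : Set V)) = Set.univ
  edges_sub : ∀ u v, G.Adj u v → (u ∈ Hset ∧ v ∈ Hset) ∨ ∃ i, u ∈ C i ∧ v ∈ C i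

end EdgeIdealReg

namespace ER

open scoped Classical

variable {V K : Type} [Field K]

/-- sign -/
def sgn (K : Type) [Field K] {V : Type} (v : V) (τ : Finset V) : K :=
  (-1) ^ (τ.filter (fun u => WellOrderingRel u v)).card

theorem sgn_sq (v : V) (τ : Finset V) : sgn K v τ * sgn K v τ = 1 := by
  unfold sgn
  rw [← pow_add, ← two_mul, pow_mul]; simp

theorem sgn_insert (v u : V) (τ : Finset V) (h : u ∉ τ) :
    sgn K v (insert u τ) = (if WellOrderingRel u v then -1 else 1) * sgn K v τ := by
  unfold sgn
  rw [Finset.filter_insert]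
  split_ifs with h1
  · rw [Finset.card_insert_of_notMem (by simp [h]), pow_succ]; ring
  · simp

theorem sgn_anti (u v : V) (τ : Finset V) (huv : u ≠ v) (hu : u ∉ τ) (hv : v ∉ τ) :
    sgn K u τ * sgn K v (insert u τ) = - (sgn K v τ * sgn K u (insert v τ)) := by
  rw [sgn_insert v u τ hu, sgn_insert u v τ hv]
  rcases trichotomous_of WellOrderingRel u v with h | h | h
  · have : ¬ WellOrderingRel v u := fun h' => asymm h h'
    simp [h, this]; ring
  · exact absurd h huv
  · have : ¬ WellOrderingRel u v := fun h' => asymm h h'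
    simp [h, this]; ring

def bd (U : Finset V) (c : Finset V → K) (τ : Finset V) : K :=
  ∑ v ∈ U \ τ, sgn K v τ * c (insert v τ)

theorem bd_bd (U : Finset V) (c : Finset V → K) : bd U (bd U c) = 0 := by
  funext τ
  unfold bd
  simp_rw [Finset.mul_sum]
  rw [Finset.sum_sigma']
  refine Finset.sum_involution (fun x _ => ⟨x.2, x.1⟩) ?_ ?_ ?_ ?_
  · rintro ⟨v, w⟩ h
    simp only [Finset.mem_sigma, Finset.mem_sdiff, Finset.mem_insert, not_or] at h
    obtain ⟨⟨_, h1⟩, _, h2, h3⟩ := h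
    have := sgn_anti (K := K) v w τ (Ne.symm h2) h1 h3
    simp only
    rw [← mul_assoc, ← mul_assoc, this, Finset.insert_comm]; ring
  · rintro ⟨v, w⟩ h _
    simp only [Finset.mem_sigma, Finset.mem_sdiff, Finset.mem_insert, not_or] at h
    intro h'
    exact h.2.2.1 (by simpa using congrArg Sigma.fst h')
  · rintro ⟨v, w⟩ h
    simp only [Finset.mem_sigma, Finset.mem_sdiff, Finset.mem_insert, not_or] at h ⊢
    tauto
  · rintro ⟨v, w⟩ h; rfl

theorem bd_add (U : Finset V) (c c' : Finset V → K) : bd U (c + c') = bd U c + bd U c' := by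
  funext τ; simp [bd, mul_add, Finset.sum_add_distrib]

theorem bd_sub (U : Finset V) (c c' : Finset V → K) : bd U (c - c') = bd U c - bd U c' := by
  funext τ; simp [bd, mul_sub, Finset.sum_sub_distrib]

theorem bd_neg (U : Finset V) (c : Finset V → K) : bd U (-c) = - bd U c := by
  funext τ; simp [bd]

theorem bd_zero (U : Finset V) : bd U (0 : Finset V → K) = 0 := by
  funext τ; simp [bd]

theorem bd_mono {U U' : Finset V} (h : U' ⊆ U) (c : Finset V → K)
    (hc : ∀ σ, c σ ≠ 0 → σ ⊆ U') : bd U c = bd U' c := by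
  funext τ
  unfold bd
  symm
  apply Finset.sum_subset (Finset.sdiff_subset_sdiff h le_rfl)
  intro v hv hv'
  have : c (insert v τ) = 0 := by
    by_contra h'
    have := hc _ h' (Finset.mem_insert_self v τ)
    simp only [Finset.mem_sdiff] at hv hv'
    tauto
  simp [this]

def op (v : V) (c : Finset V → K) (σ : Finset V) : K :=
  if v ∈ σ then sgn K v (σ.erase v) * c (σ.erase v) else 0

theorem bd_op (U : Finset V) (v : V) (hv : v ∈ U) (c : Finset V → K) :
    bd U (op v c) = c - op v (bd U c) := by
  funext τ
  by_cases h : v ∈ τ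
  · obtain ⟨ρ, hρ, rfl⟩ : ∃ ρ, v ∉ ρ ∧ insert v ρ = τ := ⟨τ.erase v, by simp, by simp [h]⟩
    simp only [Pi.sub_apply, op, h, if_true]
    rw [Finset.erase_insert hρ]
    unfold bd
    have h1 : U \ ρ = insert v (U \ insert v ρ) := by
      ext x; simp only [Finset.mem_sdiff, Finset.mem_insert]
      by_cases hx : x = v
      · subst hx; simp [hv, hρ]
      · simp [hx]
    rw [h1, Finset.sum_insert (by simp), mul_add, ← mul_assoc, sgn_sq, one_mul, sub_add_eq_sub_sub,
      sub_self, zero_sub, Finset.mul_sum, ← Finset.sum_neg_distrib]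
    apply Finset.sum_congr rfl
    intro w hw
    simp only [Finset.mem_sdiff, Finset.mem_insert, not_or] at hw
    have h2 : (insert w (insert v ρ)).erase v = insert w ρ := by
      rw [Finset.insert_comm, Finset.erase_insert]
      simp [hρ, Ne.symm hw.2.1]
    rw [op, if_pos (by simp), h2]
    have := sgn_anti (K := K) v w ρ (Ne.symm hw.2.1) hρ hw.2.2
    have e1 := sgn_sq (K := K) v ρ
    have e2 := sgn_sq (K := K) v (insert w ρ)
    have : sgn K w (insert v ρ) * sgn K v (insert w ρ) = - (sgn K v ρ * sgn K w ρ) := by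
      linear_combination (sgn K v ρ * sgn K v (insert w ρ)) * this
        - (sgn K v ρ * sgn K w ρ) * e2 - (sgn K w (insert v ρ) * sgn K v (insert w ρ)) * e1
    rw [← mul_assoc, this]; ring
  · simp only [Pi.sub_apply, op, h, if_false, sub_zero]
    unfold bd
    rw [Finset.sum_eq_single v]
    · rw [op, if_pos (Finset.mem_insert_self _ _)]
      rw [Finset.erase_insert h, ← mul_assoc, sgn_sq, one_mul]
    · intro w hw hwv
      rw [op, if_neg]; · simp
      simp [h, Ne.symm hwv]
    · intro h'; simp [hv, h] at h'

def ind (σ : Finset V) : V →₀ ℕ := Finsupp.indicator σ (fun _ _ => 1)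

theorem ind_apply (σ : Finset V) (v : V) : ind σ v = if v ∈ σ then 1 else 0 := by
  simp [ind, Finsupp.indicator_apply]

theorem ind_le {σ : Finset V} {a : V →₀ ℕ} (h : σ ⊆ a.support) : ind σ ≤ a := by
  intro v
  rw [ind_apply]
  split_ifs with hv
  · have := h hv
    simp at this; omega
  · simp

theorem ind_le_iff {σ : Finset V} {a : V →₀ ℕ} : ind σ ≤ a ↔ σ ⊆ a.support := by
  refine ⟨fun h v hv => ?_, ind_le⟩
  have := h v
  rw [ind_apply, if_pos hv] at this
  simp; omega

theorem degree_ind (σ : Finset V) : (ind σ).degree = σ.card := by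
  have : (ind σ).support = σ := by ext v; simp [ind_apply]
  rw [Finsupp.degree_apply, this]
  simp [ind_apply]

def Up (Q : (V →₀ ℕ) → Prop) : Prop := ∀ m m', m ≤ m' → Q m → Q m'

def Adm (Q : (V →₀ ℕ) → Prop) (a : V →₀ ℕ) (i : ℕ) (c : Finset V → K) : Prop :=
  ∀ σ, c σ ≠ 0 → σ ⊆ a.support ∧ σ.card = i ∧ Q (a - ind σ)

def R (K : Type) [Field K] {V : Type} (Q : (V →₀ ℕ) → Prop) (d : ℤ) : Prop :=
  ∀ (a : V →₀ ℕ) (i : ℕ), d + i < (a.degree : ℤ) → ∀ c : Finset V → K, Adm Q a i c →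
    bd a.support c = 0 → ∃ b : Finset V → K, Adm Q a (i + 1) b ∧ bd a.support b = c

theorem Adm.zero (Q : (V →₀ ℕ) → Prop) (a : V →₀ ℕ) (i : ℕ) : Adm Q a i (0 : Finset V → K) := by
  intro σ h; simp at h

theorem Adm.add {Q : (V →₀ ℕ) → Prop} {a : V →₀ ℕ} {i : ℕ} {c c' : Finset V → K}
    (h : Adm Q a i c) (h' : Adm Q a i c') : Adm Q a i (c + c') := by
  intro σ hσ
  by_cases h1 : c σ = 0
  · apply h' σ; intro h2; apply hσ; simp [h1, h2]
  · exact h σ h1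

theorem Adm.neg {Q : (V →₀ ℕ) → Prop} {a : V →₀ ℕ} {i : ℕ} {c : Finset V → K}
    (h : Adm Q a i c) : Adm Q a i (-c) := by
  intro σ hσ
  exact h σ (by simpa using hσ)

theorem Adm.sub {Q : (V →₀ ℕ) → Prop} {a : V →₀ ℕ} {i : ℕ} {c c' : Finset V → K}
    (h : Adm Q a i c) (h' : Adm Q a i c') : Adm Q a i (c - c') := by
  rw [sub_eq_add_neg]; exact h.add h'.neg

theorem Adm.imp {Q Q' : (V →₀ ℕ) → Prop} {a : V →₀ ℕ} {i : ℕ} {c : Finset V → K}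
    (h : Adm Q a i c) (hQ : ∀ m, Q m → Q' m) : Adm Q' a i c := by
  intro σ hσ
  obtain ⟨h1, h2, h3⟩ := h σ hσ
  exact ⟨h1, h2, hQ _ h3⟩

theorem ind_insert_sub (a : V →₀ ℕ) (v : V) (τ : Finset V) :
    a - ind (insert v τ) ≤ a - ind τ := by
  apply tsub_le_tsub_left
  intro u
  simp only [ind_apply, Finset.mem_insert]
  split_ifs <;> simp_all

theorem Adm.bd {Q : (V →₀ ℕ) → Prop} (hQ : Up Q) {a : V →₀ ℕ} {i : ℕ} {c : Finset V → K}
    (h : Adm Q a (i + 1) c) : Adm Q a i (bd a.support c) := by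
  intro τ hτ
  obtain ⟨v, hv, h1⟩ := Finset.exists_ne_zero_of_sum_ne_zero hτ
  obtain ⟨h2, h3, h4⟩ := h (insert v τ) (right_ne_zero_of_mul h1)
  rw [Finset.mem_sdiff] at hv
  rw [Finset.card_insert_of_notMem hv.2] at h3
  exact ⟨(Finset.subset_insert _ _).trans h2, by omega, hQ _ _ (ind_insert_sub _ _ _) h4⟩

theorem Adm.bd_zero {Q : (V →₀ ℕ) → Prop} {a : V →₀ ℕ} {c : Finset V → K}
    (h : Adm Q a 0 c) (U : Finset V) : ER.bd U c = 0 := by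
  funext τ
  apply Finset.sum_eq_zero
  intro v _
  have : c (insert v τ) = 0 := by
    by_contra h'
    have := (h _ h').2.1
    simp at this
  simp [this]

theorem R.mono {Q : (V →₀ ℕ) → Prop} {d d' : ℤ} (h : R K Q d) (hd : d ≤ d') : R K Q d' :=
  fun a i hi => h a i (by omega)

/-- truncation -/
theorem R.trunc {H Q : (V →₀ ℕ) → Prop} {d : ℤ} (h : R K H d) (h1 : ∀ m, H m → Q m)
    (h2 : ∀ m : V →₀ ℕ, d < (m.degree : ℤ) → Q m → H m) : R K Q d := by
  intro a i hi c hc hbd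
  obtain ⟨b, hb, hb'⟩ := h a i hi c (by
    intro σ hσ
    obtain ⟨e1, e2, e3⟩ := hc σ hσ
    refine ⟨e1, e2, h2 _ ?_ e3⟩
    have := congrArg Finsupp.degree (tsub_add_cancel_of_le (ind_le e1))
    rw [map_add, degree_ind, e2] at this
    omega) hbd
  exact ⟨b, hb.imp h1, hb'⟩

theorem R.congr {H Q : (V →₀ ℕ) → Prop} {d : ℤ} (h : R K H d) (h1 : ∀ m, H m ↔ Q m) : R K Q d :=
  h.trunc (fun m => (h1 m).1) (fun m _ => (h1 m).2)

theorem R.master {A B : (V →₀ ℕ) → Prop} {d : ℤ} (hA : Up A) (hB : Up B) (h1 : R K A d)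
    (h2 : R K B d) (h3 : R K (fun m => A m ∧ B m) (d + 1)) : R K (fun m => A m ∨ B m) d := by
  intro a i hi c hc hbd
  set a' : Finset V → K := fun σ => if A (a - ind σ) then c σ else 0 with ha'
  have hAa : Adm A a i a' := by
    intro σ hσ
    simp only [ha'] at hσ
    split_ifs at hσ with h
    · exact ⟨(hc σ hσ).1, (hc σ hσ).2.1, h⟩
    · simp at hσ
  have hBb : Adm B a i (c - a') := by
    intro σ hσ
    simp only [ha', Pi.sub_apply] at hσ
    split_ifs at hσ with h
    · simp at hσ
    · simp only [sub_zero] at hσ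
      exact ⟨(hc σ hσ).1, (hc σ hσ).2.1, (hc σ hσ).2.2.resolve_left h⟩
  obtain ⟨y, hy, hy'⟩ : ∃ y : Finset V → K, Adm (fun m => A m ∧ B m) a i y ∧
      bd a.support y = bd a.support a' := by
    cases i with
    | zero => exact ⟨0, Adm.zero _ _ _, by rw [bd_zero, hAa.bd_zero]⟩
    | succ i =>
      refine h3 a i (by push_cast at hi; omega) _ ?_ (bd_bd _ _)
      intro σ hσ
      have e1 := hAa.bd hA σ hσ
      have e2 := hBb.bd hB σ (by rw [bd_sub, hbd]; simpa using hσ)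
      exact ⟨e1.1, e1.2.1, e1.2.2, e2.2.2⟩
  obtain ⟨b1, hb1, hb1'⟩ := h1 a i hi (a' - y) (hAa.sub (hy.imp fun _ h => h.1))
    (by rw [bd_sub, hy', sub_self])
  obtain ⟨b2, hb2, hb2'⟩ := h2 a i hi (c - a' + y) (hBb.add (hy.imp fun _ h => h.2))
    (by rw [bd_add, bd_sub, hy', hbd]; simp)
  refine ⟨b1 + b2, (hb1.imp fun _ => Or.inl).add (hb2.imp fun _ => Or.inr), ?_⟩
  rw [bd_add, hb1', hb2']; abel

theorem R.true {d : ℤ} (hd : 0 ≤ d) : R K (fun _ : V →₀ ℕ => True) d := by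
  intro a i hi c hc hbd
  have : a ≠ 0 := by rintro rfl; simp at hi; omega
  obtain ⟨v, hv⟩ := Finsupp.support_nonempty_iff.2 this
  refine ⟨op v c, ?_, ?_⟩
  · intro σ hσ
    unfold op at hσ
    split_ifs at hσ with h
    · obtain ⟨h1, h2, -⟩ := hc _ (right_ne_zero_of_mul hσ)
      refine ⟨?_, ?_, trivial⟩
      · intro u hu
        by_cases huv : u = v
        · subst huv; exact hv
        · exact h1 (by simp [huv, hu])
      · rw [Finset.card_erase_of_mem h] at h2
        have := Finset.card_pos.2 ⟨v, h⟩
        omega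
    · simp at hσ
  · rw [bd_op _ _ hv, hbd]
    funext τ; simp [op]

theorem R.false (d : ℤ) : R K (fun _ : V →₀ ℕ => False) d := by
  intro a i hi c hc hbd
  refine ⟨0, Adm.zero _ _ _, ?_⟩
  rw [bd_zero]; funext σ
  by_contra h
  exact (hc σ (Ne.symm h)).2.2

theorem R.shift {J : (V →₀ ℕ) → Prop} {d : ℤ} (h : R K J d) (x : V) :
    R K (fun m => 0 < m x ∧ J (m - Finsupp.single x 1)) (d + 1) := by
  intro a i hi c hc hbd
  by_cases hax : a x = 0
  · refine ⟨0, Adm.zero _ _ _, ?_⟩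
    rw [ER.bd_zero]; funext σ
    by_contra h'
    have := (hc σ (Ne.symm h')).2.2.1
    simp [hax] at this
  set a' := a - Finsupp.single x 1 with ha'
  have hs : a'.support ⊆ a.support := by
    intro v hv
    simp [ha'] at hv ⊢
    omega
  have hle : Finsupp.single x 1 ≤ a := by
    rw [Finsupp.single_le_iff]; omega
  have hdeg : a'.degree + 1 = a.degree := by
    have := congrArg Finsupp.degree (tsub_add_cancel_of_le hle)
    rw [map_add] at this
    simpa using this
  have key : ∀ (σ : Finset V), (σ ⊆ a.support ∧ 0 < (a - ind σ) x) ↔ σ ⊆ a'.support := by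
    intro σ
    constructor
    · rintro ⟨h1, h2⟩ v hv
      have h3 := h1 hv
      simp only [Finsupp.mem_support_iff, ha', Finsupp.coe_tsub, Pi.sub_apply, ind_apply] at h2 h3 ⊢
      by_cases hvx : x = v
      · subst hvx; simp [hv] at h2 ⊢; omega
      · simp [Finsupp.single_apply, hvx]; exact h3
    · intro h1
      refine ⟨h1.trans hs, ?_⟩
      simp only [Finsupp.coe_tsub, Pi.sub_apply, ind_apply]
      split_ifs with h2
      · have := h1 h2
        simp [ha'] at this; omega
      · omega
  have hsub : ∀ σ : Finset V, a - ind σ - Finsupp.single x 1 = a' - ind σ := by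
    intro σ; rw [ha', tsub_right_comm]
  have hc' : Adm J a' i c := by
    intro σ hσ
    obtain ⟨h1, h2, h3, h4⟩ := hc σ hσ
    exact ⟨(key σ).1 ⟨h1, h3⟩, h2, by rw [← hsub]; exact h4⟩
  obtain ⟨b, hb, hb'⟩ := h a' i (by omega) c hc'
    (by rw [← bd_mono hs c (fun σ hσ => (hc' σ hσ).1)]; exact hbd)
  refine ⟨b, ?_, ?_⟩
  · intro σ hσ
    obtain ⟨h1, h2, h3⟩ := hb σ hσ
    have := (key σ).2 h1
    exact ⟨this.1, h2, this.2, by rw [hsub]; exact h3⟩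
  · rw [bd_mono hs b (fun σ hσ => (hb σ hσ).1)]; exact hb'

/-- Ask rule. -/
theorem R.ask {I : (V →₀ ℕ) → Prop} {D : ℤ} (hI : Up I) (x : V)
    (h1 : R K (fun m => I (m + Finsupp.single x 1)) (D - 1))
    (h0 : R K (fun m => I (m.erase x)) D) : R K I D := by
  have hup0 : Up (fun m : V →₀ ℕ => I (m.erase x)) := by
    intro m m' hm h
    refine hI _ _ ?_ h
    intro v
    by_cases hv : v = x
    · subst hv; simp
    · simpa [Finsupp.erase_ne hv] using hm v
  have her : ∀ m : V →₀ ℕ, m.erase x ≤ m := by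
    intro m v
    by_cases hv : v = x
    · subst hv; simp
    · simp [Finsupp.erase_ne hv]
  have hadd : ∀ m : V →₀ ℕ, 0 < m x → m - Finsupp.single x 1 + Finsupp.single x 1 = m := by
    intro m hm
    exact tsub_add_cancel_of_le (by rw [Finsupp.single_le_iff]; omega)
  have hers : ∀ m : V →₀ ℕ, (m - Finsupp.single x 1).erase x = m.erase x := by
    intro m; ext v
    by_cases hv : v = x
    · subst hv; simp
    · simp [Finsupp.erase_ne hv, Ne.symm hv]
  have hS := h1.shift x
  rw [sub_add_cancel] at hS
  have hS0 := h0.shift x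
  refine R.congr (R.master hup0 ?_ h0 hS (hS0.congr ?_)) ?_
  · rintro m m' hm ⟨h2, h3⟩
    refine ⟨lt_of_lt_of_le h2 (hm x), hI _ _ ?_ h3⟩
    gcongr
  · intro m
    simp only [hers]
    constructor
    · rintro ⟨h2, h3⟩
      exact ⟨h3, h2, by rw [hadd m h2]; exact hI _ _ (her m) h3⟩
    · rintro ⟨h2, h3, -⟩; exact ⟨h3, h2⟩
  · intro m
    constructor
    · rintro (h2 | ⟨h2, h3⟩)
      · exact hI _ _ (her m) h2
      · rwa [hadd m h2] at h3
    · intro h2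
      by_cases hm : m x = 0
      · left
        have : m.erase x = m := by
          ext v
          by_cases hv : v = x
          · subst hv; simp [hm]
          · simp [Finsupp.erase_ne hv]
        rw [this]; exact h2
      · right; exact ⟨by omega, by rw [hadd m (by omega)]; exact h2⟩

/-- Q form -/
def QR (K : Type) [Field K] {V : Type} (I : (V →₀ ℕ) → Prop) (D : ℤ) : Prop :=
  (∀ m, I m) ∨ R K I D

theorem QR.mono {I : (V →₀ ℕ) → Prop} {d d' : ℤ} (h : QR K I d) (hd : d ≤ d') : QR K I d' :=
  h.imp id (fun h => h.mono hd)

theorem QR.congr {I I' : (V →₀ ℕ) → Prop} {d : ℤ} (h : QR K I d) (hI : ∀ m, I m ↔ I' m) :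
    QR K I' d :=
  h.imp (fun h m => (hI m).1 (h m)) (fun h => h.congr hI)

theorem QR.ask {I : (V →₀ ℕ) → Prop} {D : ℤ} (hI : Up I) (x : V) (hD : ¬ I 0 → 1 ≤ D)
    (h1 : QR K (fun m => I (m + Finsupp.single x 1)) (D - 1))
    (h0 : QR K (fun m => I (m.erase x)) D) : QR K I D := by
  by_cases hz : I 0
  · exact Or.inl fun m => hI _ _ (zero_le) hz
  right
  rcases h0 with h0 | h0
  · exact absurd (by simpa using h0 0) hz
  rcases h1 with h1 | h1
  · exact R.ask hI x ((R.true (by have := hD hz; omega)).congr (by simpa using h1)) h0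
  · exact R.ask hI x h1 h0

end ER

namespace ER

open scoped Classical

variable {V K : Type} [Field K] {G : SimpleGraph V}

def Cov (G : SimpleGraph V) (X p : Finset V) : Prop :=
  ∀ u ∈ X, ∀ v ∈ X, G.Adj u v → u ∈ p ∨ v ∈ p

def J (G : SimpleGraph V) (X : Finset V) (s : ℕ) (w : V →₀ ℕ) : Prop :=
  ∀ p : Finset V, Cov G X p → s ≤ ∑ v ∈ X ∩ p, w v

theorem J_up (X : Finset V) (s : ℕ) : Up (J G X s) := by
  intro m m' hm h p hp
  exact (h p hp).trans (Finset.sum_le_sum fun v _ => hm v)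

def QJ (K : Type) [Field K] {V : Type} (G : SimpleGraph V) (X : Finset V) (s : ℕ) (T : Finset V)
    (D : ℤ) : Prop := QR K (fun m => J G X s (ind T + m)) D

theorem ind_insert {x : V} {T : Finset V} (hx : x ∉ T) :
    ind (insert x T) = ind T + Finsupp.single x 1 := by
  ext v
  simp only [ind_apply, Finsupp.add_apply, Finsupp.single_apply, Finset.mem_insert]
  by_cases h : v = x
  · subst h; simp [hx]
  · simp [h, Ne.symm h]

theorem J_erase {X T : Finset V} {s : ℕ} {x : V} (hxT : x ∉ T) (m : V →₀ ℕ) :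
    J G X s (ind T + m.erase x) ↔ J G (X.erase x) s (ind T + m) := by
  have hv : ∀ p : Finset V, ∑ v ∈ (X.erase x) ∩ p, (ind T + m) v =
      ∑ v ∈ (X.erase x) ∩ p, (ind T + m.erase x) v := by
    intro p
    apply Finset.sum_congr rfl
    intro v hv
    simp only [Finset.mem_inter, Finset.mem_erase] at hv
    simp [Finsupp.erase_ne hv.1.1]
  constructor
  · intro h p hp
    have := h (insert x p) (by
      intro u hu v hv huv
      by_cases h1 : u = x
      · subst h1; simp
      by_cases h2 : v = x
      · subst h2; simp
      have := hp u (by simp [h1, hu]) v (by simp [h2, hv]) huv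
      simp only [Finset.mem_insert]; tauto)
    rw [hv]
    refine this.trans (le_of_eq ?_)
    symm
    apply Finset.sum_subset
    · intro u; simp only [Finset.mem_inter, Finset.mem_erase, Finset.mem_insert]; tauto
    · intro u hu hu'
      have : u = x := by
        simp only [Finset.mem_inter, Finset.mem_erase, Finset.mem_insert] at hu hu'; tauto
      subst this
      simp [ind_apply, hxT]
  · intro h p hp
    have := h p (fun u hu v hv => hp u (Finset.mem_of_mem_erase hu) v (Finset.mem_of_mem_erase hv))
    rw [hv] at this
    refine this.trans (Finset.sum_le_sum_of_subset ?_)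
    intro u; simp only [Finset.mem_inter, Finset.mem_erase]; tauto

theorem QJ.ask {X T : Finset V} {s : ℕ} {D : ℤ} {x : V} (hx : x ∉ T)
    (hD : ¬ J G X s (ind T) → 1 ≤ D)
    (h1 : QJ K G X s (insert x T) (D - 1)) (h0 : QJ K G (X.erase x) s T D) : QJ K G X s T D := by
  refine QR.ask ?_ x (by simpa using hD) (h1.congr ?_) (h0.congr ?_)
  · intro m m' h
    exact J_up X s _ _ (by gcongr)
  · intro m; rw [ind_insert hx, add_assoc, add_comm m]
  · intro m; exact (J_erase hx m).symm

def NB (G : SimpleGraph V) (X : Finset V) (v : V) : Finset V := X.filter (fun u => u = v ∨ G.Adj v u)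

def Simp (G : SimpleGraph V) (X : Finset V) (v : V) : Prop :=
  ∀ a ∈ NB G X v, ∀ b ∈ NB G X v, a ≠ b → G.Adj a b

theorem mem_NB {X : Finset V} {u v : V} : u ∈ NB G X v ↔ u ∈ X ∧ (u = v ∨ G.Adj v u) := by
  simp [NB]

theorem NB_sub {X : Finset V} {v : V} : NB G X v ⊆ X := Finset.filter_subset _ _

theorem self_mem_NB {X : Finset V} {v : V} (hv : v ∈ X) : v ∈ NB G X v := by simp [mem_NB, hv]

theorem Simp.mono {X Y : Finset V} {v : V} (h : Simp G X v) (hY : Y ⊆ X) : Simp G Y v := by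
  intro a ha b hb
  rw [mem_NB] at ha hb
  exact h a (mem_NB.2 ⟨hY ha.1, ha.2⟩) b (mem_NB.2 ⟨hY hb.1, hb.2⟩)

theorem sum_ind_add {Y T : Finset V} (m : V →₀ ℕ) :
    ∑ v ∈ Y, (ind T + m) v = (Y ∩ T).card + ∑ v ∈ Y, m v := by
  simp [Finset.sum_add_distrib, ind_apply, Finset.filter_mem_eq_inter]

theorem clique_cov {X C p : Finset V} (hp : Cov G X p) (hC : C ⊆ X)
    (hcl : ∀ a ∈ C, ∀ b ∈ C, a ≠ b → G.Adj a b) : (C \ p).card ≤ 1 := by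
  rw [Finset.card_le_one]
  intro a ha b hb
  by_contra hab
  rw [Finset.mem_sdiff] at ha hb
  rcases hp a (hC ha.1) b (hC hb.1) (hcl a ha.1 b hb.1 hab) with h | h
  · exact ha.2 h
  · exact hb.2 h

theorem peel {X T : Finset V} {s : ℕ} {v : V} (hv : v ∈ X) (hs : Simp G X v)
    (hT : NB G X v ⊆ T) (m : V →₀ ℕ) :
    J G X s (ind T + m) ↔ J G X (s - ((NB G X v).card - 1)) (ind (T \ NB G X v) + m) := by
  set C := NB G X v with hC
  have hCX : C ⊆ X := NB_sub
  have hsum : ∀ p : Finset V, ∑ u ∈ X ∩ p, (ind T + m) u =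
      (C ∩ p).card + ∑ u ∈ X ∩ p, (ind (T \ C) + m) u := by
    intro p
    rw [sum_ind_add, sum_ind_add, ← add_assoc]
    congr 1
    rw [← Finset.card_union_of_disjoint]
    · congr 1
      ext u
      simp only [Finset.mem_inter, Finset.mem_union, Finset.mem_sdiff]
      constructor
      · rintro ⟨⟨h1, h2⟩, h3⟩; by_cases h : u ∈ C <;> simp_all
      · rintro (⟨h1, h2⟩ | ⟨⟨h1, h2⟩, h3, h4⟩)
        · exact ⟨⟨hCX h1, h2⟩, hT h1⟩
        · exact ⟨⟨h1, h2⟩, h3⟩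
    · rw [Finset.disjoint_left]; intro u; simp; tauto
  have hcard : ∀ p : Finset V, (C ∩ p).card + (C \ p).card = C.card :=
    fun p => Finset.card_inter_add_card_sdiff C p
  have hCpos : 0 < C.card := Finset.card_pos.2 ⟨v, self_mem_NB hv⟩
  constructor
  · intro h p hp
    have hq : Cov G X (p.erase v ∪ (if C ⊆ p then ∅ else p)) := by
      split_ifs with hCp
      · intro a ha b hb hab
        have hab' := hp a ha b hb hab
        simp only [Finset.union_empty, Finset.mem_erase]
        by_cases h1 : a = v
        · subst h1
          right
          exact ⟨hab.ne', hCp (mem_NB.2 ⟨hb, Or.inr hab⟩)⟩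
        by_cases h2 : b = v
        · subst h2
          left
          exact ⟨hab.ne, hCp (mem_NB.2 ⟨ha, Or.inr hab.symm⟩)⟩
        tauto
      · intro a ha b hb hab
        have hab' := hp a ha b hb hab
        simp only [Finset.mem_union]; tauto
    have := h _ hq
    rw [hsum] at this
    have hle : ∑ u ∈ X ∩ (p.erase v ∪ (if C ⊆ p then ∅ else p)), (ind (T \ C) + m) u ≤
        ∑ u ∈ X ∩ p, (ind (T \ C) + m) u := by
      apply Finset.sum_le_sum_of_subset
      intro u; split_ifs <;> simp only [Finset.mem_inter, Finset.mem_union, Finset.mem_erase] <;>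
        simp <;> tauto
    have hc : (C ∩ (p.erase v ∪ (if C ⊆ p then ∅ else p))).card ≤ C.card - 1 := by
      split_ifs with hCp
      · have : C ∩ (p.erase v ∪ ∅) ⊆ C.erase v := by
          intro u; simp; tauto
        have := Finset.card_le_card this
        rwa [Finset.card_erase_of_mem (self_mem_NB hv)] at this
      · have : C ∩ (p.erase v ∪ p) ⊂ C := by
          refine ⟨Finset.inter_subset_left, fun h' => hCp ?_⟩
          intro u hu
          have := h' hu
          simp at this; tauto
        have := Finset.card_lt_card this
        omega
    omega
  · intro h p hp
    have := h p hp
    rw [hsum]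
    have h1 := clique_cov hp hCX hs
    have h2 := hcard p
    omega

theorem isolated {X T : Finset V} {s : ℕ} {v : V} (hs : NB G X v ⊆ {v}) (m : V →₀ ℕ) :
    J G X s (ind T + m) ↔ J G (X.erase v) s (ind (T.erase v) + m) := by
  have hval : ∀ p : Finset V, ∑ u ∈ X.erase v ∩ p, (ind (T.erase v) + m) u =
     ∑ u ∈ X.erase v ∩ p, (ind T + m) u := by
    intro p
    apply Finset.sum_congr rfl
    intro u hu
    simp only [Finset.mem_inter, Finset.mem_erase] at hu
    simp [ind_apply, hu.1.1]
  constructor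
  · intro h p hp
    have := h (p.erase v) (by
      intro a ha b hb hab
      have h1 : a ≠ v := by
        rintro rfl
        exact hab.ne' (by simpa using hs (mem_NB.2 ⟨hb, Or.inr hab⟩))
      have h2 : b ≠ v := by
        rintro rfl
        exact hab.ne (by simpa using hs (mem_NB.2 ⟨ha, Or.inr hab.symm⟩))
      have := hp a (by simp [h1, ha]) b (by simp [h2, hb]) hab
      simp [h1, h2]; exact this)
    rw [hval]
    refine this.trans (le_of_eq (Finset.sum_congr ?_ fun _ _ => rfl))
    ext u; simp only [Finset.mem_inter, Finset.mem_erase]; tauto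
  · intro h p hp
    have := h p (fun a ha b hb => hp a (Finset.mem_of_mem_erase ha) b (Finset.mem_of_mem_erase hb))
    rw [hval] at this
    refine this.trans (Finset.sum_le_sum_of_subset ?_)
    intro u; simp

/-- configurations -/
def rm (G : SimpleGraph V) (X : Finset V) (u : V) : Finset V := X.filter (fun x => x ≠ u ∧ ¬ G.Adj u x)

theorem mem_rm {X : Finset V} {u x : V} : x ∈ rm G X u ↔ x ∈ X ∧ x ≠ u ∧ ¬ G.Adj u x := by simp [rm]

def rmC (G : SimpleGraph V) (X Cy : Finset V) : Finset V :=
  X.filter (fun x => x ∉ Cy ∧ ∀ u ∈ Cy, ¬ G.Adj u x)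

theorem mem_rmC {X Cy : Finset V} {x : V} :
    x ∈ rmC G X Cy ↔ x ∈ X ∧ x ∉ Cy ∧ ∀ u ∈ Cy, ¬ G.Adj u x := by simp [rmC]

theorem rm_mono {X Y : Finset V} (h : X ⊆ Y) (u : V) : rm G X u ⊆ rm G Y u :=
  Finset.filter_subset_filter _ h

theorem rmC_mono {X Y : Finset V} (h : X ⊆ Y) (Cy : Finset V) : rmC G X Cy ⊆ rmC G Y Cy :=
  Finset.filter_subset_filter _ h

inductive Cfg (G : SimpleGraph V) (Cy : Finset V) (A : Finset V) : Finset V → ℕ → Prop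
  | nil (X : Finset V) : Cfg G Cy A X 0
  | pt (X : Finset V) (u : V) (w : ℕ) : u ∈ X → u ∈ A → Cfg G Cy A (rm G X u) w → Cfg G Cy A X (w + 1)
  | ed (X : Finset V) (u v : V) (w : ℕ) : u ∈ X → v ∈ X → G.Adj u v →
      Cfg G Cy A (rm G (rm G X u) v) w → Cfg G Cy A X (w + 1)
  | cy (X : Finset V) (w : ℕ) : Cy ⊆ X → Cfg G Cy A (rmC G X Cy) w →
      Cfg G Cy A X (w + (Cy.card + 1) / 3)

theorem Cfg.mono {Cy A A' X Y : Finset V} {w : ℕ} (h : Cfg G Cy A X w) (hY : X ⊆ Y)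
    (hA : ∀ u ∈ X, u ∈ A → u ∈ A') : Cfg G Cy A' Y w := by
  induction h generalizing Y with
  | nil X => exact Cfg.nil _
  | pt X u w h1 h2 _ ih =>
    exact Cfg.pt _ u _ (hY h1) (hA u h1 h2) (ih (rm_mono hY u) fun x hx => hA x (mem_rm.1 hx).1)
  | ed X u v w h1 h2 h3 _ ih =>
    exact Cfg.ed _ u v _ (hY h1) (hY h2) h3 (ih (rm_mono (rm_mono hY u) v)
      fun x hx => hA x (mem_rm.1 (mem_rm.1 hx).1).1)
  | cy X w h1 _ ih =>
    exact Cfg.cy _ _ (h1.trans hY) (ih (rmC_mono hY _) fun x hx => hA x (mem_rmC.1 hx).1)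

theorem Cfg.points {Cy A X P : Finset V} (hA : P ⊆ A) (hX : P ⊆ X)
    (hP : ∀ a ∈ P, ∀ b ∈ P, ¬ G.Adj a b) : Cfg G Cy A X P.card := by
  induction P using Finset.induction_on generalizing X with
  | empty => exact Cfg.nil _
  | insert u P hu ih =>
    rw [Finset.card_insert_of_notMem hu]
    refine Cfg.pt _ u _ (hX (by simp)) (hA (by simp)) (ih ?_ ?_ ?_)
    · exact fun x hx => hA (by simp [hx])
    · intro x hx
      rw [mem_rm]
      exact ⟨hX (by simp [hx]), by rintro rfl; exact hu hx, hP u (by simp) x (by simp [hx])⟩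
    · exact fun a ha b hb => hP a (by simp [ha]) b (by simp [hb])

def Bd (G : SimpleGraph V) (Cy X A : Finset V) (B : ℤ) : Prop := ∀ w, Cfg G Cy A X w → (w : ℤ) ≤ B

theorem Bd.mono {Cy A A' X Y : Finset V} {B : ℤ} (h : Bd G Cy Y A' B) (hY : X ⊆ Y)
    (hA : ∀ u ∈ X, u ∈ A → u ∈ A') : Bd G Cy X A B := fun w hw => h w (hw.mono hY hA)

theorem not_J {X T : Finset V} {s : ℕ} (hT : T ⊆ X) (h : ¬ J G X s (ind T)) :
    ∃ p, Cov G X p ∧ (T ∩ p).card < s ∧ (∀ a ∈ T \ p, ∀ b ∈ T \ p, ¬ G.Adj a b) ∧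
      T.card = (T ∩ p).card + (T \ p).card := by
  unfold J at h
  push Not at h
  obtain ⟨p, hp, hs⟩ := h
  refine ⟨p, hp, ?_, ?_, (Finset.card_inter_add_card_sdiff T p).symm⟩
  · have := sum_ind_add (Y := X ∩ p) (T := T) 0
    simp only [add_zero, Finsupp.coe_zero, Pi.zero_apply, Finset.sum_const_zero] at this
    rw [this] at hs
    have e : T ∩ p = X ∩ p ∩ T := by
      ext u; simp only [Finset.mem_inter]; constructor
      · rintro ⟨h1, h2⟩; exact ⟨⟨hT h1, h2⟩, h1⟩
      · tauto
    rw [e]; exact hs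
  · intro a ha b hb hab
    rw [Finset.mem_sdiff] at ha hb
    rcases hp a (hT ha.1) b (hT hb.1) hab with h | h
    · exact ha.2 h
    · exact hb.2 h

theorem QJ.mono {X T : Finset V} {s : ℕ} {D D' : ℤ} (h : QJ K G X s T D) (hD : D ≤ D') :
    QJ K G X s T D' := QR.mono h hD

def IH (K : Type) [Field K] {V : Type} (G : SimpleGraph V) (Cy X0 : Finset V) (s : ℕ) (X : Finset V) : Prop :=
  ∀ (s' : ℕ) (X' A : Finset V) (B : ℤ), X' ⊆ X0 → A ⊆ X' → (s' < s ∨ (s' = s ∧ X' ⊂ X)) →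
    Bd G Cy X' A B → QJ K G X' s' A (2 * s' - 1 + B - A.card)

theorem clear {Cy X0 Xt : Finset V} {s : ℕ} (hs1 : 1 ≤ s) (ih : IH K G Cy X0 s Xt) (hXt : Xt ⊆ X0)
    {B : ℤ} {v : V} : ∀ (k : ℕ) (X T : Finset V), X ⊆ Xt → (NB G X v \ T).card = k → v ∈ X → v ∈ T →
      T ⊆ X → Simp G X v → Bd G Cy X (T \ NB G X v) B →
      (T ∩ NB G X v = {v} → Bd G Cy (X \ NB G X v) (T \ NB G X v) (B - 1)) →
      QJ K G X s T (2 * s - 1 + B - T.card) := by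
  intro k
  induction k with
  | zero =>
    intro X T hX hk hvX hvT hTX hs hB hB'
    have hNT : NB G X v ⊆ T := by
      rw [Finset.card_eq_zero, Finset.sdiff_eq_empty_iff_subset] at hk; exact hk
    by_cases h1 : NB G X v = {v}
    · have hX1 : X \ NB G X v = X.erase v := by rw [h1]; ext; simp; tauto
      have hT1 : T \ NB G X v = T.erase v := by rw [h1]; ext; simp; tauto
      have := hB' (by rw [Finset.inter_eq_right.2 hNT, h1])
      rw [hX1, hT1] at this
      have hsub : X.erase v ⊂ Xt :=
        Finset.ssubset_of_ssubset_of_subset (Finset.erase_ssubset hvX) hX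
      have := ih s (X.erase v) (T.erase v) (B - 1) (hsub.subset.trans hXt)
        (Finset.erase_subset_erase _ hTX) (Or.inr ⟨rfl, hsub⟩) this
      refine QJ.mono (QR.congr this ?_) ?_
      · intro m; exact (isolated h1.le m).symm
      · rw [Finset.card_erase_of_mem hvT]
        have := Finset.card_pos.2 ⟨v, hvT⟩
        omega
    · have hc : 2 ≤ (NB G X v).card := by
        by_contra hc
        apply h1
        have : (NB G X v).card = 1 := by
          have := Finset.card_pos.2 ⟨v, self_mem_NB (G := G) hvX⟩
          omega
        obtain ⟨w, hw⟩ := Finset.card_eq_one.1 this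
        have := self_mem_NB (G := G) hvX
        rw [hw] at this ⊢
        simp at this; rw [this]
      by_cases hsz : s - ((NB G X v).card - 1) = 0
      · left
        intro m
        rw [peel hvX hs hNT, hsz]
        intro p _; exact Nat.zero_le _
      have := ih (s - ((NB G X v).card - 1)) X (T \ NB G X v) B (hX.trans hXt)
        (Finset.sdiff_subset.trans hTX) (Or.inl (by omega)) hB
      refine QJ.mono (QR.congr this ?_) ?_
      · intro m; exact (peel hvX hs hNT m).symm
      · have := Finset.card_sdiff_add_card_eq_card hNT
        omega
  | succ k ihk =>
    intro X T hX hk hvX hvT hTX hs hB hB'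
    obtain ⟨w, hw⟩ : (NB G X v \ T).Nonempty := by
      rw [← Finset.card_pos]; omega
    have hw' := hw
    rw [Finset.mem_sdiff] at hw
    have hwv : w ≠ v := by rintro rfl; exact hw.2 hvT
    have hNB : NB G (X.erase w) v = (NB G X v).erase w := by
      ext u; simp only [mem_NB, Finset.mem_erase]; tauto
    have hTw : T \ (NB G X v).erase w = T \ NB G X v := by
      ext u; simp only [Finset.mem_sdiff, Finset.mem_erase]
      constructor
      · rintro ⟨h1, h2⟩; refine ⟨h1, fun h3 => h2 ⟨?_, h3⟩⟩; rintro rfl; exact hw.2 h1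
      · tauto
    apply QJ.ask hw.2
    · intro hJ
      obtain ⟨p, hp, hps, hind, hcard⟩ := not_J hTX hJ
      have hcl : ((T ∩ NB G X v) \ p).card ≤ 1 :=
        clique_cov hp (Finset.inter_subset_right.trans NB_sub) (fun a ha b hb =>
          hs a (Finset.mem_inter.1 ha).2 b (Finset.mem_inter.1 hb).2)
      have hsplit : (T \ p).card ≤ ((T ∩ NB G X v) \ p).card + ((T \ NB G X v) \ p).card := by
        rw [← Finset.card_union_of_disjoint]
        · apply Finset.card_le_card
          intro u; simp only [Finset.mem_sdiff, Finset.mem_union, Finset.mem_inter]; tauto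
        · rw [Finset.disjoint_left]; intro u; simp only [Finset.mem_sdiff, Finset.mem_inter]; tauto
      have hpt : ∀ (Y : Finset V), T \ NB G X v ⊆ Y → Cfg G Cy (T \ NB G X v) Y
          ((T \ NB G X v) \ p).card := by
        intro Y hY
        refine Cfg.points Finset.sdiff_subset (Finset.sdiff_subset.trans hY) ?_
        intro a ha b hb
        simp only [Finset.mem_sdiff] at ha hb
        exact hind a (by simp; tauto) b (by simp; tauto)
      by_cases h1 : T ∩ NB G X v = {v}
      · have := hB' h1 _ (hpt (X \ NB G X v) (Finset.sdiff_subset_sdiff hTX le_rfl))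
        omega
      · have h2 := hB _ (hpt X (Finset.sdiff_subset.trans hTX))
        have h3 : 2 ≤ (T ∩ NB G X v).card := by
          by_contra h3
          apply h1
          have hvm : v ∈ T ∩ NB G X v := by simp [hvT, self_mem_NB hvX]
          have : (T ∩ NB G X v).card = 1 := by
            have := Finset.card_pos.2 ⟨v, hvm⟩
            omega
          obtain ⟨w, hw⟩ := Finset.card_eq_one.1 this
          rw [hw] at hvm ⊢
          simp at hvm; rw [hvm]
        have h4 := Finset.card_inter_add_card_sdiff (T ∩ NB G X v) p
        have h5 : ((T ∩ NB G X v) ∩ p).card ≤ (T ∩ p).card := by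
          apply Finset.card_le_card
          intro u; simp only [Finset.mem_inter]; tauto
        omega
    · have hTi : insert w T \ NB G X v = T \ NB G X v := by
        rw [Finset.insert_sdiff_of_mem _ hw.1]
      have := ihk X (insert w T) hX ?_ hvX (by simp [hvT]) ?_ hs (by rw [hTi]; exact hB) ?_
      · refine this.mono ?_
        rw [Finset.card_insert_of_notMem hw.2]; push_cast; omega
      · have : NB G X v \ insert w T = (NB G X v \ T).erase w := by
          ext u; simp only [Finset.mem_sdiff, Finset.mem_insert, Finset.mem_erase]; tauto
        rw [this, Finset.card_erase_of_mem hw', hk]; rfl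
      · intro u hu
        rcases Finset.mem_insert.1 hu with rfl | hu
        · exact NB_sub hw.1
        · exact hTX hu
      · intro h
        exfalso
        have : w ∈ insert w T ∩ NB G X v := by simp [hw.1]
        rw [h] at this
        exact hwv (by simpa using this)
    · refine ihk (X.erase w) T ((Finset.erase_subset _ _).trans hX) ?_ (by simp [hwv.symm, hvX]) hvT ?_
        (hs.mono (Finset.erase_subset _ _)) ?_ ?_
      · rw [hNB]
        have : (NB G X v).erase w \ T = (NB G X v \ T).erase w := by
          ext u; simp only [Finset.mem_sdiff, Finset.mem_erase]; tauto
        rw [this, Finset.card_erase_of_mem hw', hk]; rfl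
      · intro u hu
        rw [Finset.mem_erase]
        refine ⟨?_, hTX hu⟩
        rintro rfl; exact hw.2 hu
      · rw [hNB, hTw]; exact hB.mono (Finset.erase_subset _ _) (fun _ _ h => h)
      · rw [hNB, hTw]
        intro h
        refine (hB' ?_).mono ?_ (fun _ _ h => h)
        · rw [← h]; ext u; simp only [Finset.mem_inter, Finset.mem_erase]
          constructor
          · rintro ⟨h1, h2⟩; refine ⟨h1, ?_, h2⟩; rintro rfl; exact hw.2 h1
          · tauto
        · intro u; simp only [Finset.mem_sdiff, Finset.mem_erase]; tauto

end ER

namespace ER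

open scoped Classical

variable {V K : Type} [Field K] {G : SimpleGraph V}

theorem Cfg.replace {Cy A Y : Finset V} {w : ℕ} {u l : V} (hul : G.Adj u l)
    (h : Cfg G Cy (insert u A) Y w) (hl : l ∉ Y) (hn : ∀ x ∈ Y, G.Adj l x → x = u) :
    Cfg G Cy A (insert l Y) w := by
  induction h with
  | nil X => exact Cfg.nil _
  | pt X z w h1 h2 h3 ih =>
    by_cases hz : z = u
    · subst hz
      refine Cfg.ed _ z l _ (by simp [h1]) (by simp) hul (h3.mono ?_ ?_)
      · intro x hx
        rw [mem_rm] at hx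
        simp only [mem_rm, Finset.mem_insert]
        refine ⟨⟨Or.inr hx.1, hx.2⟩, ?_, ?_⟩
        · rintro rfl; exact hl hx.1
        · intro h; exact hx.2.1 (hn x hx.1 h)
      · intro x hx hxA
        rw [mem_rm] at hx
        simpa [hx.2.1] using hxA
    · have hlz : ¬ G.Adj z l := fun h => hz (hn z h1 h.symm)
      have hlz' : l ≠ z := by rintro rfl; exact hl h1
      refine Cfg.pt _ z _ (by simp [h1]) (by simpa [hz] using h2)
        ((ih ?_ ?_).mono ?_ (fun _ _ h => h))
      · intro h; exact hl (mem_rm.1 h).1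
      · intro x hx; exact hn x (mem_rm.1 hx).1
      · intro x hx
        simp only [mem_rm, Finset.mem_insert] at hx ⊢
        rcases hx with rfl | hx
        · exact ⟨Or.inl rfl, hlz', hlz⟩
        · exact ⟨Or.inr hx.1, hx.2⟩
  | ed X a b w h1 h2 h3 h4 ih =>
    refine Cfg.ed _ a b _ (by simp [h1]) (by simp [h2]) h3 ?_
    by_cases hu : u = a ∨ u = b
    · refine h4.mono (rm_mono (rm_mono (Finset.subset_insert _ _) _) _) ?_
      intro x hx hxA
      simp only [mem_rm] at hx
      rcases Finset.mem_insert.1 hxA with rfl | h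
      · exfalso; rcases hu with rfl | rfl
        · exact hx.1.2.1 rfl
        · exact hx.2.1 rfl
      · exact h
    · push Not at hu
      refine (ih ?_ ?_).mono ?_ (fun _ _ h => h)
      · intro h; simp only [mem_rm] at h; exact hl h.1.1
      · intro x hx; simp only [mem_rm] at hx; exact hn x hx.1.1
      · intro x hx
        simp only [mem_rm, Finset.mem_insert] at hx ⊢
        rcases hx with rfl | hx
        · refine ⟨⟨Or.inl rfl, ?_, ?_⟩, ?_, ?_⟩
          · rintro rfl; exact hl h1
          · intro h; exact hu.1 (hn a h1 h.symm).symm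
          · rintro rfl; exact hl h2
          · intro h; exact hu.2 (hn b h2 h.symm).symm
        · exact ⟨⟨Or.inr hx.1.1, hx.1.2⟩, hx.2⟩
  | cy X w h1 h2 ih =>
    refine Cfg.cy _ _ (h1.trans (Finset.subset_insert _ _)) ?_
    by_cases hu : u ∈ Cy
    · refine h2.mono (rmC_mono (Finset.subset_insert _ _) _) ?_
      intro x hx hxA
      simp only [mem_rmC] at hx
      rcases Finset.mem_insert.1 hxA with rfl | h
      · exact absurd hu hx.2.1
      · exact h
    · refine (ih ?_ ?_).mono ?_ (fun _ _ h => h)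
      · intro h; simp only [mem_rmC] at h; exact hl h.1
      · intro x hx; simp only [mem_rmC] at hx; exact hn x hx.1
      · intro x hx
        simp only [mem_rmC, Finset.mem_insert] at hx ⊢
        rcases hx with rfl | hx
        · refine ⟨Or.inl rfl, fun h => hl (h1 h), ?_⟩
          intro z hz h
          exact hu ((hn z (h1 hz) h.symm) ▸ hz)
        · exact ⟨Or.inr hx.1, hx.2⟩

/-- side condition for A -/
theorem sideA {Cy X Y A : Finset V} {s : ℕ} {B : ℤ} (hAX : A ⊆ X) (hXY : X ⊆ Y)
    (hB : Bd G Cy Y A B) (hJ : ¬ J G X s (ind A)) : (1:ℤ) ≤ 2 * s - 1 + B - A.card := by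
  obtain ⟨p, hp, hps, hind, hcard⟩ := not_J hAX hJ
  have := hB _ (Cfg.points (P := A \ p) Finset.sdiff_subset
    ((Finset.sdiff_subset.trans hAX).trans hXY) hind)
  omega

theorem sideE {Cy X Y A : Finset V} {s : ℕ} {B : ℤ} {y l : V} (hAX : insert y A ⊆ X) (hXY : X ⊆ Y)
    (hlY : l ∈ Y) (hly : G.Adj l y) (hl : Simp G Y l)
    (hB : Bd G Cy Y A B) (hJ : ¬ J G X s (ind (insert y A))) :
    (1:ℤ) ≤ 2 * s - 1 + B - (insert y A).card := by
  obtain ⟨p, hp, hps, hind, hcard⟩ := not_J hAX hJ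
  have key : (((insert y A) \ p).card : ℤ) ≤ B := by
    by_cases hy : y ∈ p
    · refine hB _ (Cfg.points (P := (insert y A) \ p) ?_
        ((Finset.sdiff_subset.trans hAX).trans hXY) hind)
      intro x hx
      simp only [Finset.mem_sdiff, Finset.mem_insert] at hx
      rcases hx with ⟨rfl | h, h2⟩
      · exact absurd hy h2
      · exact h
    · have hyP : y ∈ insert y A \ p := by simp [hy]
      rw [← Finset.card_erase_add_one hyP]
      refine hB _ (Cfg.ed _ y l _ (hXY (hAX (by simp))) hlY hly.symm ?_)
      refine Cfg.points (P := ((insert y A) \ p).erase y) ?_ ?_ ?_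
      · intro x; simp; tauto
      · intro x hx
        have hx' := Finset.mem_of_mem_erase hx
        have hxy := Finset.ne_of_mem_erase hx
        have h1 := hind y hyP x hx'
        have hxY : x ∈ Y := hXY (hAX (Finset.mem_sdiff.1 hx').1)
        simp only [mem_rm]
        refine ⟨⟨hxY, hxy, h1⟩, ?_, ?_⟩
        · rintro rfl; exact h1 hly.symm
        · intro h
          exact h1 (hl y (mem_NB.2 ⟨hXY (hAX (by simp)), Or.inr hly⟩) x (mem_NB.2 ⟨hxY, Or.inr h⟩)
            hxy.symm)
      · intro a ha b hb
        exact hind a (Finset.mem_of_mem_erase ha) b (Finset.mem_of_mem_erase hb)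
  omega

theorem clearA {Cy X0 X : Finset V} {s : ℕ} (hs1 : 1 ≤ s) (ih : IH K G Cy X0 s X) (hX0 : X ⊆ X0)
    {A : Finset V} {B : ℤ} {v : V} (hvA : v ∈ A) (hA : A ⊆ X) (hs : Simp G X v)
    (hB : Bd G Cy X A B) : QJ K G X s A (2 * s - 1 + B - A.card) := by
  refine clear hs1 ih hX0 _ X A subset_rfl rfl (hA hvA) hvA hA hs
    (hB.mono subset_rfl fun x _ h => (Finset.mem_sdiff.1 h).1) ?_
  intro _ w hw
  have := hB _ (Cfg.pt X v w (hA hvA) hvA (hw.mono ?_ fun x _ h => (Finset.mem_sdiff.1 h).1))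
  · push_cast at this; omega
  · intro x; simp only [Finset.mem_sdiff, mem_NB, mem_rm]; tauto

theorem clearE {Cy X0 Xt : Finset V} {s : ℕ} (hs1 : 1 ≤ s) (ih : IH K G Cy X0 s Xt) (hXt : Xt ⊆ X0)
    {A X : Finset V} {B : ℤ} {y l : V} (hX : X ⊆ Xt) (hA : insert y A ⊆ X) (hl : l ∈ X) (hlA : l ∉ insert y A)
    (hly : G.Adj l y) (hs : Simp G X l)
    (hB : Bd G Cy Xt A B) : QJ K G X s (insert l (insert y A))
      (2 * s - 1 + B - (insert y A).card - 1) := by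
  have hyN : y ∈ NB G X l := mem_NB.2 ⟨hA (by simp), Or.inr hly⟩
  refine QJ.mono (clear (B := B) hs1 ih hXt _ X (insert l (insert y A)) hX rfl hl (by simp) ?_ hs ?_ ?_) ?_
  · intro x hx
    rcases Finset.mem_insert.1 hx with rfl | h
    · exact hl
    · exact hA h
  · refine hB.mono hX ?_
    intro x hx h
    simp only [Finset.mem_sdiff, Finset.mem_insert] at h
    rcases h with ⟨rfl | rfl | h, h2⟩
    · exact absurd (self_mem_NB hl) h2
    · exact absurd hyN h2
    · exact h
  · intro h
    exfalso
    have : y ∈ insert l (insert y A) ∩ NB G X l := by simp [hyN]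
    rw [h] at this
    exact hly.ne' (by simpa using this)
  · rw [Finset.card_insert_of_notMem hlA]; push_cast; omega

theorem stage2 {Cy X0 Xt : Finset V} {s : ℕ} (hs1 : 1 ≤ s) (ih : IH K G Cy X0 s Xt) (hXt : Xt ⊆ X0)
    {A : Finset V} {B : ℤ} {y l : V} (hB : Bd G Cy Xt A B) (hAL : ∀ v ∈ A, ¬ Simp G Xt v)
    (hlX : l ∈ Xt) (hly : G.Adj l y) (hl : Simp G Xt l) (hyX : y ∈ Xt)
    (hy : Simp G (Xt.filter (fun v => ¬ (Simp G Xt v ∧ G.Adj v y))) y) :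
    ∀ (k : ℕ) (X : Finset V), X ⊆ Xt → insert y A ⊆ X →
      (X.filter (fun v => Simp G Xt v ∧ G.Adj v y)).card = k →
      QJ K G X s (insert y A) (2 * s - 1 + B - (insert y A).card) := by
  intro k
  induction k with
  | zero =>
    intro X hX hA hk
    have hX' : X ⊆ Xt.filter (fun v => ¬ (Simp G Xt v ∧ G.Adj v y)) := by
      intro x hx
      rw [Finset.mem_filter]
      refine ⟨hX hx, fun h => ?_⟩
      rw [Finset.card_eq_zero] at hk
      have : x ∈ X.filter (fun v => Simp G Xt v ∧ G.Adj v y) := by simp [hx, h]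
      rw [hk] at this; simp at this
    have hyX' : y ∈ X := hA (by simp)
    have hTA : ∀ x, x ∈ insert y A \ NB G X y → x ∈ A := by
      intro x h
      simp only [Finset.mem_sdiff, Finset.mem_insert] at h
      rcases h with ⟨rfl | h, h2⟩
      · exact absurd (self_mem_NB hyX') h2
      · exact h
    refine clear hs1 ih hXt _ X (insert y A) hX rfl hyX' (by simp) hA (hy.mono hX') ?_ ?_
    · exact hB.mono hX fun x _ h => hTA x h
    · intro _ w hw
      have := hB _ (Cfg.ed Xt y l w hyX hlX hly.symm (hw.mono ?_ fun x _ h => hTA x h))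
      · push_cast at this; omega
      · intro x hx
        simp only [Finset.mem_sdiff, mem_NB, not_and, not_or] at hx
        simp only [mem_rm]
        have h2 := hx.2 hx.1
        refine ⟨⟨hX hx.1, h2.1, h2.2⟩, ?_, ?_⟩
        · rintro rfl; exact h2.2 hly.symm
        · intro h
          exact h2.2 (hl y (mem_NB.2 ⟨hyX, Or.inr hly⟩) x (mem_NB.2 ⟨hX hx.1, Or.inr h⟩)
            (Ne.symm h2.1))
  | succ k ihk =>
    intro X hX hA hk
    obtain ⟨l', hl'⟩ : (X.filter (fun v => Simp G Xt v ∧ G.Adj v y)).Nonempty := by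
      rw [← Finset.card_pos]; omega
    have hl'' := hl'
    rw [Finset.mem_filter] at hl'
    have hlA : l' ∉ insert y A := by
      rw [Finset.mem_insert]
      rintro (rfl | h)
      · exact hl'.2.2.ne rfl
      · exact hAL _ h hl'.2.1
    refine QJ.ask hlA (sideE hA hX hlX hly hl hB) ?_ ?_
    · exact clearE hs1 ih hXt hX hA hl'.1 hlA hl'.2.2 (hl'.2.1.mono hX) hB
    · refine ihk (X.erase l') ((Finset.erase_subset _ _).trans hX) ?_ ?_
      · intro x hx
        rw [Finset.mem_erase]
        refine ⟨?_, hA hx⟩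
        rintro rfl; exact hlA hx
      · rw [Finset.filter_erase, Finset.card_erase_of_mem hl'', hk]; rfl

def Cls (G : SimpleGraph V) (Cy X0 : Finset V) : Prop :=
  (∀ Y ⊆ X0, Y.Nonempty → (∀ v ∈ Y, ¬ Simp G Y v) → Y = Cy) ∧
  (∀ v ∈ X0, v ∉ Cy → ∀ a ∈ Cy, ∀ b ∈ Cy, G.Adj v a → G.Adj v b → a = b)

theorem main_step {Cy X0 X : Finset V} {s : ℕ} (hs1 : 1 ≤ s) (hcls : Cls G Cy X0)
    (ih : IH K G Cy X0 s X) (hX : X ⊆ X0)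
    (hcy : ∀ (A : Finset V) (B : ℤ), X = Cy → Cy.Nonempty → (∀ v ∈ Cy, ¬ Simp G Cy v) → A ⊆ Cy →
      Bd G Cy Cy A B → QJ K G Cy s A (2 * s - 1 + B - A.card))
    {A : Finset V} {B : ℤ} (hA : A ⊆ X) (hB : Bd G Cy X A B) :
    QJ K G X s A (2 * s - 1 + B - A.card) := by
  rcases X.eq_empty_or_nonempty with rfl | hne
  · right
    refine (R.false _).congr ?_
    intro m
    refine ⟨False.elim, fun h => ?_⟩
    have := h ∅ (fun u hu => by simp at hu)
    simp at this; omega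
  by_cases hAL : ∃ v ∈ A, Simp G X v
  · obtain ⟨v, hv, hs⟩ := hAL
    exact clearA hs1 ih hX hv hA hs hB
  push Not at hAL
  by_cases hiso : ∃ v ∈ X, NB G X v ⊆ {v}
  · obtain ⟨v, hv, hs⟩ := hiso
    have hvA : v ∉ A := by
      intro h
      apply hAL v h
      intro a ha b hb hab
      have h1 := hs ha; have h2 := hs hb
      simp at h1 h2; exact absurd (h1.trans h2.symm) hab
    refine QR.congr (ih s (X.erase v) A B ((Finset.erase_subset _ _).trans hX) ?_
      (Or.inr ⟨rfl, Finset.erase_ssubset hv⟩) (hB.mono (Finset.erase_subset _ _) fun _ _ h => h)) ?_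
    · intro x hx; rw [Finset.mem_erase]; exact ⟨by rintro rfl; exact hvA hx, hA hx⟩
    · intro m
      have := isolated (T := A) (s := s) hs m
      rw [Finset.erase_eq_of_notMem hvA] at this
      exact this.symm
  push Not at hiso
  have askA : ∀ y ∈ X, (y ∉ A → QJ K G X s (insert y A) (2 * s - 1 + B - (insert y A).card)) → y ∉ A →
      QJ K G X s A (2 * s - 1 + B - A.card) := by
    intro y hy h1 hyA
    refine QJ.ask hyA (sideA hA subset_rfl hB) ((h1 hyA).mono ?_) ?_
    · rw [Finset.card_insert_of_notMem hyA]; push_cast; omega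
    · refine ih s (X.erase y) A B ((Finset.erase_subset _ _).trans hX) ?_
        (Or.inr ⟨rfl, Finset.erase_ssubset hy⟩) (hB.mono (Finset.erase_subset _ _) fun _ _ h => h)
      intro x hx; rw [Finset.mem_erase]; exact ⟨by rintro rfl; exact hyA hx, hA hx⟩
  have good : ∀ y ∈ X, ∀ l ∈ X, G.Adj l y → Simp G X l →
      Simp G (X.filter (fun v => ¬ (Simp G X v ∧ G.Adj v y))) y →
      QJ K G X s A (2 * s - 1 + B - A.card) := by
    intro y hy l hl hly hls hys
    have h2 : QJ K G X s (insert y A) (2 * s - 1 + B - (insert y A).card) :=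
      stage2 hs1 ih hX hB hAL hl hly hls hy hys _ X subset_rfl (Finset.insert_subset hy hA) rfl
    by_cases hyA : y ∈ A
    · rwa [Finset.insert_eq_of_mem hyA] at h2
    · exact askA y hy (fun _ => h2) hyA
  by_cases hedge : ∃ l ∈ X, ∃ y ∈ X, Simp G X l ∧ Simp G X y ∧ G.Adj l y
  · obtain ⟨l, hl, y, hy, h1, h2, h3⟩ := hedge
    exact good y hy l hl h3 h1 (h2.mono (Finset.filter_subset _ _))
  push Not at hedge
  set Y := X.filter (fun v => ¬ Simp G X v) with hY
  by_cases hYs : ∃ y ∈ Y, Simp G Y y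
  · obtain ⟨y, hyY, hys⟩ := hYs
    have hyX := (Finset.mem_filter.1 hyY).1
    have hyn := (Finset.mem_filter.1 hyY).2
    obtain ⟨l, hl, hls, hly⟩ : ∃ l ∈ X, Simp G X l ∧ G.Adj l y := by
      by_contra hno
      push Not at hno
      apply hyn
      have hmem : ∀ a ∈ NB G X y, a ∈ NB G Y y := by
        intro a ha
        rw [mem_NB] at ha ⊢
        refine ⟨?_, ha.2⟩
        rcases ha.2 with rfl | h
        · exact hyY
        · rw [hY, Finset.mem_filter]
          exact ⟨ha.1, fun hs => hno a ha.1 hs h.symm⟩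
      exact fun a ha b hb => hys a (hmem a ha) b (hmem b hb)
    refine good y hyX l hl hly hls ?_
    have hmem : ∀ a ∈ NB G (X.filter (fun v => ¬ (Simp G X v ∧ G.Adj v y))) y, a ∈ NB G Y y := by
      intro a ha
      rw [mem_NB, Finset.mem_filter] at ha
      rw [mem_NB]
      refine ⟨?_, ha.2⟩
      rcases ha.2 with rfl | h
      · exact hyY
      · rw [hY, Finset.mem_filter]
        exact ⟨ha.1.1, fun hs => ha.1.2 ⟨hs, h.symm⟩⟩
    exact fun a ha b hb => hys a (hmem a ha) b (hmem b hb)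
  push Not at hYs
  have hYX : Y ⊆ X := Finset.filter_subset _ _
  have nbr : ∀ l ∈ X, ∃ u ∈ X, G.Adj l u := by
    intro l hl
    have := hiso l hl
    rw [Finset.not_subset] at this
    obtain ⟨u, hu, hul⟩ := this
    rw [mem_NB] at hu
    simp at hul
    exact ⟨u, hu.1, hu.2.resolve_left hul⟩
  have nbrY : ∀ l ∈ X, Simp G X l → ∀ u ∈ X, G.Adj l u → u ∈ Y := by
    intro l hl hls u hu hlu
    rw [hY, Finset.mem_filter]
    exact ⟨hu, fun h => hedge l hl u hu hls h hlu⟩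
  have hYne : Y.Nonempty := by
    obtain ⟨x, hx⟩ := hne
    by_cases hs : Simp G X x
    · obtain ⟨u, hu, hxu⟩ := nbr x hx
      exact ⟨u, nbrY x hx hs u hu hxu⟩
    · exact ⟨x, by simp [hY, hx, hs]⟩
  have hYC : Y = Cy := hcls.1 Y (hYX.trans hX) hYne hYs
  by_cases hL : ∃ l ∈ X, Simp G X l
  · obtain ⟨l, hl, hls⟩ := hL
    obtain ⟨u, hu, hlu⟩ := nbr l hl
    have hlY : l ∉ Y := by simp [hY, hls]
    have huY := nbrY l hl hls u hu hlu
    have honly : ∀ x ∈ X, G.Adj l x → x = u := by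
      intro x hx hlx
      exact hcls.2 l (hX hl) (hYC ▸ hlY) x (hYC ▸ nbrY l hl hls x hx hlx) u (hYC ▸ huY) hlx hlu
    have hlA : l ∉ insert u A := by
      rw [Finset.mem_insert]
      rintro (rfl | h)
      · exact hlu.ne rfl
      · exact hAL _ h hls
    have hinsX : insert u A ⊆ X := Finset.insert_subset hu hA
    have h2 : QJ K G X s (insert u A) (2 * s - 1 + B - (insert u A).card) := by
      refine QJ.ask hlA (sideE hinsX subset_rfl hl hlu hls hB) ?_ ?_
      · exact clearE hs1 ih hX subset_rfl hinsX hl hlA hlu hls hB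
      · refine ih s (X.erase l) (insert u A) B ((Finset.erase_subset _ _).trans hX) ?_
          (Or.inr ⟨rfl, Finset.erase_ssubset hl⟩) ?_
        · intro x hx
          rw [Finset.mem_erase]
          exact ⟨by rintro rfl; exact hlA hx, hinsX hx⟩
        · intro w hw
          have := hw.replace hlu.symm (by simp) (fun x hx => honly x (Finset.mem_of_mem_erase hx))
          rw [Finset.insert_erase hl] at this
          exact hB w this
    by_cases huA : u ∈ A
    · rwa [Finset.insert_eq_of_mem huA] at h2
    · exact askA u hu (fun _ => h2) huA
  · push Not at hL
    have hXY : X = Cy := by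
      rw [← hYC, hY]; symm; rw [Finset.filter_eq_self]; exact hL
    subst hXY
    exact hcy A B rfl hne hL hA hB

theorem main {Cy X0 : Finset V} (hcls : Cls G Cy X0)
    (hcy : ∀ (s : ℕ) (A : Finset V) (B : ℤ), 1 ≤ s → IH K G Cy X0 s Cy → Cy ⊆ X0 → Cy.Nonempty →
      (∀ v ∈ Cy, ¬ Simp G Cy v) → A ⊆ Cy →
      Bd G Cy Cy A B → QJ K G Cy s A (2 * s - 1 + B - A.card)) :
    ∀ (s : ℕ) (n : ℕ) (X A : Finset V) (B : ℤ), X.card = n → X ⊆ X0 → A ⊆ X → Bd G Cy X A B →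
      QJ K G X s A (2 * s - 1 + B - A.card) := by
  intro s
  induction s using Nat.strong_induction_on with
  | _ s ihs =>
    intro n
    induction n using Nat.strong_induction_on with
    | _ n ihn =>
      intro X A B hn hX hA hB
      rcases Nat.eq_zero_or_pos s with rfl | hs
      · left; intro m p _; exact Nat.zero_le _
      have ih : IH K G Cy X0 s X := by
        intro s' X' A' B' hX' hA' hlt hB'
        rcases hlt with h | ⟨rfl, h⟩
        · exact ihs s' h _ X' A' B' rfl hX' hA' hB'
        · exact ihn _ (hn ▸ Finset.card_lt_card h) X' A' B' rfl hX' hA' hB'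
      refine main_step hs hcls ih hX ?_ hA hB
      rintro A B rfl h1 h2 h3 h4
      exact hcy s A B hs ih hX h1 h2 h3 h4

end ER

namespace ER

open scoped Classical

variable {V K : Type} [Field K]

def Sat (z : V) : List V → ℤ → ℤ → ℤ → ℤ → (V →₀ ℕ) → Prop
  | [], p0, _, _, q1, w => p0 ≤ 0 ∧ q1 ≤ w z
  | a :: L, p0, q0, p1, q1, w =>
    Sat z L (q0 - w a) (max p0 (q0 - w a)) (q1 - w a) (max p1 (q1 - w a)) w

theorem Sat.mono {z : V} : ∀ {L : List V} {p0 q0 p1 q1 p0' q0' p1' q1' : ℤ} {w w' : V →₀ ℕ},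
    Sat z L p0 q0 p1 q1 w → p0' ≤ p0 → q0' ≤ q0 → p1' ≤ p1 → q1' ≤ q1 → w ≤ w' →
    Sat z L p0' q0' p1' q1' w'
  | [], _, _, _, _, _, _, _, _, w, w', h, h1, _, _, h4, hw => by
    have := hw z
    simp only [Sat] at h ⊢; omega
  | a :: L, _, _, _, _, _, _, _, _, w, w', h, h1, h2, h3, h4, hw => by
    have := hw a
    exact Sat.mono (L := L) h (by omega) (by omega) (by omega) (by omega) hw

theorem Sat.top {z : V} : ∀ (L : List V) {p0 q0 p1 q1 : ℤ} {w : V →₀ ℕ},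
    p0 ≤ 0 → q0 ≤ 0 → p1 ≤ 0 → q1 ≤ 0 → Sat z L p0 q0 p1 q1 w
  | [], _, _, _, _, w, h1, _, _, h4 => by simp only [Sat]; omega
  | a :: L, _, _, _, _, w, h1, h2, h3, h4 => by
    exact Sat.top L (by omega) (by omega) (by omega) (by omega)

theorem Sat.congr {z : V} : ∀ {L : List V} {p0 q0 p1 q1 : ℤ} {w w' : V →₀ ℕ},
    (∀ v ∈ L, w v = w' v) → w z = w' z → (Sat z L p0 q0 p1 q1 w ↔ Sat z L p0 q0 p1 q1 w')
  | [], _, _, _, _, w, w', _, h => by simp only [Sat]; rw [h]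
  | a :: L, _, _, _, _, w, w', h1, h => by
    simp only [Sat]; rw [h1 a (by simp)]
    exact Sat.congr (fun v hv => h1 v (by simp [hv])) h

theorem Sat.ones {z : V} {w : V →₀ ℕ} (hz : w z = 1) (L : List V) : ∀ {p0 q0 p1 q1 : ℤ}, (∀ v ∈ L, w v = 1) →
    2 * p0 ≤ L.length + 1 → 2 * q0 ≤ L.length + 2 → 2 * p1 ≤ L.length + 2 → 2 * q1 ≤ L.length + 3 →
    Sat z L p0 q0 p1 q1 w := by
  induction L with
  | nil =>
    intro p0 q0 p1 q1 _ h1 _ _ h4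
    simp only [Sat, hz]; simp at h1 h4; omega
  | cons a L ih =>
    intro p0 q0 p1 q1 hL h1 h2 h3 h4
    rw [List.length_cons] at h1 h2 h3 h4
    have := hL a (by simp)
    simp only [Sat]
    rw [this]
    push_cast at h1 h2 h3 h4
    apply ih (fun v hv => hL v (by simp [hv])) <;> push_cast <;> omega

def QS (K : Type) [Field K] {V : Type} (z : V) (L : List V) (p0 q0 p1 q1 : ℤ) (T : Finset V) (D : ℤ) :
    Prop := QR K (fun m => Sat z L p0 q0 p1 q1 (ind T + m)) D

theorem QS.mono {z : V} {L : List V} {p0 q0 p1 q1 : ℤ} {T : Finset V} {D D' : ℤ}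
    (h : QS K z L p0 q0 p1 q1 T D) (hD : D ≤ D') : QS K z L p0 q0 p1 q1 T D' := QR.mono h hD

theorem Sat_up {z : V} {L : List V} {p0 q0 p1 q1 : ℤ} {c : V →₀ ℕ} :
    Up (fun m => Sat z L p0 q0 p1 q1 (c + m)) := by
  intro m m' h hm
  exact hm.mono le_rfl le_rfl le_rfl le_rfl (by gcongr)

theorem QS.ask {z : V} {L : List V} {p0 q0 p1 q1 : ℤ} {T : Finset V} {D : ℤ} {x : V} (hx : x ∉ T)
    (hD : ¬ Sat z L p0 q0 p1 q1 (ind T) → 1 ≤ D) (h1 : QS K z L p0 q0 p1 q1 (insert x T) (D - 1))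
    (h0 : QR K (fun m => Sat z L p0 q0 p1 q1 (ind T + m.erase x)) D) : QS K z L p0 q0 p1 q1 T D := by
  refine QR.ask Sat_up x (by simpa using hD) (h1.congr ?_) h0
  intro m; rw [ind_insert hx, add_assoc, add_comm m]

theorem Sat.freezeHead {z a : V} {L : List V} {p0 q0 p1 q1 : ℤ} {T : Finset V} (haT : a ∉ T)
    (haL : a ∉ L) (haz : a ≠ z) (m : V →₀ ℕ) :
    Sat z L q0 (max p0 q0) q1 (max p1 q1) (ind T + m) ↔
      Sat z (a :: L) p0 q0 p1 q1 (ind T + m.erase a) := by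
  simp only [Sat]
  have : (ind T + m.erase a) a = 0 := by simp [ind_apply, haT]
  rw [this]
  simp only [Nat.cast_zero, sub_zero]
  apply Sat.congr
  · intro v hv
    have : v ≠ a := by rintro rfl; exact haL hv
    simp [Finsupp.erase_ne this]
  · simp [Finsupp.erase_ne haz.symm]

theorem Sat.freezeSecond {z a b : V} {L : List V} {p0 q0 p1 q1 : ℤ} {T : Finset V} (hbT : b ∉ T)
    (hab : a ≠ b) (hbL : b ∉ L) (hbz : b ≠ z) (m : V →₀ ℕ)
    (h0 : q0 - (ind T a : ℕ) ≤ p0) (h1 : q1 - (ind T a : ℕ) ≤ p1) :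
    Sat z L p0 p0 p1 p1 (ind T + m) ↔
      Sat z (a :: b :: L) p0 q0 p1 q1 (ind T + m.erase b) := by
  simp only [Sat]
  have e1 : (ind T + m.erase b) b = 0 := by simp [ind_apply, hbT]
  have e2 : (ind T + m.erase b) a = ind T a + m a := by simp [Finsupp.erase_ne hab]
  rw [e1, e2]
  have e3 : max p0 (q0 - ((ind T a + m a : ℕ) : ℤ)) = p0 := by push_cast; omega
  have e4 : max p1 (q1 - ((ind T a + m a : ℕ) : ℤ)) = p1 := by push_cast; omega
  rw [e3, e4]
  simp only [Nat.cast_zero, sub_zero]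
  have e5 : max (q0 - ((ind T a + m a : ℕ) : ℤ)) p0 = p0 := by push_cast; omega
  have e6 : max (q1 - ((ind T a + m a : ℕ) : ℤ)) p1 = p1 := by push_cast; omega
  rw [e5, e6]
  apply Sat.congr
  · intro v hv
    have : v ≠ b := by rintro rfl; exact hbL hv
    simp [Finsupp.erase_ne this]
  · simp [Finsupp.erase_ne hbz.symm]

theorem Sat.subHead {z a : V} {L : List V} {p0 q0 p1 q1 : ℤ} {T : Finset V} (haT : a ∉ T)
    (haL : a ∉ L) (haz : a ≠ z) (m : V →₀ ℕ) :
    Sat z (a :: L) p0 (q0 - 1) p1 (q1 - 1) (ind T + m) ↔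
      Sat z (a :: L) p0 q0 p1 q1 (ind (insert a T) + m) := by
  simp only [Sat]
  have e1 : (ind T + m) a = m a := by simp [ind_apply, haT]
  have e2 : (ind (insert a T) + m) a = 1 + m a := by simp [ind_apply]
  rw [e1, e2]
  push_cast
  rw [← sub_sub, ← sub_sub]
  apply Sat.congr
  · intro v hv
    have : v ≠ a := by rintro rfl; exact haL hv
    simp [ind_apply, this]
  · simp [ind_apply, haz.symm]

theorem Sat.peel {z a b : V} {L : List V} {p0 q0 p1 q1 : ℤ} {T : Finset V} (haT : a ∉ T) (hbT : b ∉ T)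
    (hab : a ≠ b) (haL : a ∉ L) (hbL : b ∉ L) (haz : a ≠ z) (hbz : b ≠ z) (m : V →₀ ℕ)
    (h0 : q0 ≤ p0) (h1 : q1 ≤ p1) :
    Sat z (a :: b :: L) (p0 - 1) (q0 - 1) (p1 - 1) (q1 - 1) (ind T + m) ↔
      Sat z (a :: b :: L) p0 q0 p1 q1 (ind (insert a (insert b T)) + m) := by
  simp only [Sat]
  have e1 : (ind T + m) a = m a := by simp [ind_apply, haT]
  have e2 : (ind (insert a (insert b T)) + m) a = 1 + m a := by simp [ind_apply]
  have e3 : (ind T + m) b = m b := by simp [ind_apply, hbT]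
  have e4 : (ind (insert a (insert b T)) + m) b = 1 + m b := by simp [ind_apply]
  rw [e1, e2, e3, e4]
  have c1 : max (p0 - 1) (q0 - 1 - (m a : ℤ)) = p0 - 1 := by omega
  have c2 : max (p1 - 1) (q1 - 1 - (m a : ℤ)) = p1 - 1 := by omega
  have c3 : max p0 (q0 - ((1 + m a : ℕ) : ℤ)) = p0 := by push_cast; omega
  have c4 : max p1 (q1 - ((1 + m a : ℕ) : ℤ)) = p1 := by push_cast; omega
  rw [c1, c2, c3, c4]
  have d1 : p0 - 1 - (m b : ℤ) = p0 - ((1 + m b : ℕ) : ℤ) := by push_cast; ring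
  have d2 : p1 - 1 - (m b : ℤ) = p1 - ((1 + m b : ℕ) : ℤ) := by push_cast; ring
  have d3 : q0 - 1 - (m a : ℤ) = q0 - ((1 + m a : ℕ) : ℤ) := by push_cast; ring
  have d4 : q1 - 1 - (m a : ℤ) = q1 - ((1 + m a : ℕ) : ℤ) := by push_cast; ring
  rw [d1, d2, d3, d4]
  apply Sat.congr
  · intro v hv
    have h1 : v ≠ a := by rintro rfl; exact haL hv
    have h2 : v ≠ b := by rintro rfl; exact hbL hv
    simp [ind_apply, h1, h2]
  · simp [ind_apply, haz.symm, hbz.symm]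

theorem QR_false {Q : (V →₀ ℕ) → Prop} (h : ∀ m, ¬ Q m) (D : ℤ) : QR K Q D :=
  Or.inr ((R.false D).congr fun m => ⟨False.elim, h m⟩)

theorem base2 {a z : V} (haz : a ≠ z) : ∀ (k α β : ℕ) (D : ℤ), α + β = k → (k : ℤ) ≤ D →
    QR K (fun m => α ≤ m a ∧ β ≤ m z) D := by
  intro k
  induction k with
  | zero =>
    intro α β D h _
    left; intro m; constructor <;> omega
  | succ k ih =>
    intro α β D h hD
    have hup : Up (fun m : V →₀ ℕ => α ≤ m a ∧ β ≤ m z) := by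
      intro m m' hm h
      have := hm a; have := hm z
      obtain ⟨h1, h2⟩ := h; exact ⟨by omega, by omega⟩
    rcases Nat.eq_zero_or_pos α with h0 | h0
    · refine QR.ask hup z (by intro; push_cast at hD; omega) ((ih α (β - 1) (D - 1) (by omega)
        (by push_cast at hD; omega)).congr ?_) (QR_false ?_ _)
      · intro m; simp [Finsupp.single_apply, haz, haz.symm]
      · intro m; simp [h0]; try omega
    · refine QR.ask hup a (by intro; push_cast at hD; omega) ((ih (α - 1) β (D - 1) (by omega)
        (by push_cast at hD; omega)).congr ?_) (QR_false ?_ _)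
      · intro m; simp [Finsupp.single_apply, haz, haz.symm]
      · intro m; simp [h0]; try omega

theorem QS.base {a z : V} (haz : a ≠ z) {p0 q0 p1 q1 : ℤ} {T : Finset V} {D : ℤ}
    (h1 : q1 ≤ max q0 (ind T a : ℕ) + max p1 (ind T z : ℕ))
    (hD : ¬ (q0 ≤ (ind T a : ℕ) ∧ p1 ≤ (ind T z : ℕ)) →
      max (q0 - (ind T a : ℕ)) 0 + max (p1 - (ind T z : ℕ)) 0 ≤ D) :
    QS K z [a] p0 q0 p1 q1 T D := by
  have key : ∀ m : V →₀ ℕ, Sat z [a] p0 q0 p1 q1 (ind T + m) ↔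
      ((q0 - (ind T a : ℕ)).toNat ≤ m a ∧ (p1 - (ind T z : ℕ)).toNat ≤ m z) := by
    intro m
    simp only [Sat, Finsupp.add_apply]
    push_cast
    omega
  by_cases h : (q0 ≤ (ind T a : ℕ) ∧ p1 ≤ (ind T z : ℕ))
  · left
    intro m
    rw [key]; omega
  · refine QR.congr (base2 haz _ (q0 - (ind T a : ℕ)).toNat (p1 - (ind T z : ℕ)).toNat D rfl ?_)
      fun m => (key m).symm
    have := hD h
    push_cast; omega

def TZ (z : V) (L : List V) : Finset V := insert z L.toFinset

def TT (z : V) : List V → Finset V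
  | [] => ∅
  | _ :: L => TZ z L

theorem TZ_cons {z a : V} {L : List V} : TZ z (a :: L) = insert a (TZ z L) := by
  simp [TZ, Finset.insert_comm]

theorem mem_TZ {z x : V} {L : List V} : x ∈ TZ z L ↔ x = z ∨ x ∈ L := by simp [TZ]

theorem ind_TZ_of {z : V} {L : List V} : (∀ v ∈ L, ind (TZ z L) v = 1) ∧ ind (TZ z L) z = 1 := by
  constructor
  · intro v hv; simp [ind_apply, mem_TZ, hv]
  · simp [ind_apply, mem_TZ]

/-- side condition, form 01 -/
theorem side01 {z a : V} {L : List V} {p0 q0 p1 q1 : ℤ} (ha : a ∉ TZ z L)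
    (h : ¬ Sat z (a :: L) p0 q0 p1 q1 (ind (TZ z L))) :
    (L.length : ℤ) + 2 ≤ 2 * q0 ∨ (L.length : ℤ) + 3 ≤ 2 * p0 ∨ (L.length : ℤ) + 3 ≤ 2 * q1 ∨
      (L.length : ℤ) + 4 ≤ 2 * p1 := by
  by_contra hc
  apply h
  simp only [Sat]
  have : ind (TZ z L) a = 0 := by simp [ind_apply, ha]
  rw [this]
  refine Sat.ones ind_TZ_of.2 _ ind_TZ_of.1 ?_ ?_ ?_ ?_ <;> push_cast <;> omega

theorem side00 {z a b : V} {L : List V} {p0 q0 p1 q1 : ℤ} (ha : a ∉ TZ z L) (hb : b ∉ TZ z L)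
    (h : ¬ Sat z (a :: b :: L) p0 q0 p1 q1 (ind (TZ z L))) :
    (L.length : ℤ) + 2 ≤ 2 * p0 ∨ (L.length : ℤ) + 2 ≤ 2 * q0 ∨ (L.length : ℤ) + 3 ≤ 2 * p1 ∨
      (L.length : ℤ) + 3 ≤ 2 * q1 := by
  by_contra hc
  apply h
  simp only [Sat]
  have e1 : ind (TZ z L) a = 0 := by simp [ind_apply, ha]
  have e2 : ind (TZ z L) b = 0 := by simp [ind_apply, hb]
  rw [e1, e2]
  refine Sat.ones ind_TZ_of.2 _ ind_TZ_of.1 ?_ ?_ ?_ ?_ <;> push_cast <;> omega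

theorem side10 {z a b : V} {L : List V} {p0 q0 p1 q1 : ℤ} (haz : a ≠ z) (haL : a ∉ L)
    (hab : a ≠ b) (hb : b ∉ TZ z L)
    (h : ¬ Sat z (a :: b :: L) p0 q0 p1 q1 (ind (insert a (TZ z L)))) :
    (L.length : ℤ) + 2 ≤ 2 * p0 ∨ (L.length : ℤ) + 2 ≤ 2 * (q0 - 1) ∨ (L.length : ℤ) + 3 ≤ 2 * p1 ∨
      (L.length : ℤ) + 3 ≤ 2 * (q1 - 1) := by
  by_contra hc
  apply h
  simp only [Sat]
  have e1 : ind (insert a (TZ z L)) a = 1 := by simp [ind_apply]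
  have e2 : ind (insert a (TZ z L)) b = 0 := by simp [ind_apply, hb, hab.symm]
  rw [e1, e2]
  have h1 : ∀ v ∈ L, ind (insert a (TZ z L)) v = 1 := by
    intro v hv; simp [ind_apply, mem_TZ, hv]
  have h2 : ind (insert a (TZ z L)) z = 1 := by simp [ind_apply, mem_TZ]
  refine Sat.ones h2 _ h1 ?_ ?_ ?_ ?_ <;> push_cast <;> omega

end ER

namespace ER

open scoped Classical

variable {V K : Type} [Field K]

/-- all ones -/
def FA (K : Type) [Field K] {V : Type} (z : V) (L : List V) (p0 q0 p1 q1 v : ℤ) : Prop :=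
  QS K z L p0 q0 p1 q1 (TZ z L) (v - (L.length + 1))

def F01 (K : Type) [Field K] {V : Type} (z a : V) (L : List V) (p0 q0 p1 q1 v : ℤ) : Prop :=
  QS K z (a :: L) p0 q0 p1 q1 (TZ z L) (v - (L.length + 1))

def F00 (K : Type) [Field K] {V : Type} (z a b : V) (L : List V) (p0 q0 p1 q1 v : ℤ) : Prop :=
  QS K z (a :: b :: L) p0 q0 p1 q1 (TZ z L) (v - (L.length + 1))

def ND (z : V) (L : List V) : Prop := L.Nodup ∧ z ∉ L

theorem ND.tail {z a : V} {L : List V} (h : ND z (a :: L)) : ND z L :=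
  ⟨(List.nodup_cons.1 h.1).2, fun h' => h.2 (List.mem_cons_of_mem _ h')⟩

theorem ND.head {z a : V} {L : List V} (h : ND z (a :: L)) : a ∉ L ∧ a ≠ z ∧ a ∉ TZ z L := by
  have h1 := (List.nodup_cons.1 h.1).1
  have h2 : a ≠ z := by rintro rfl; exact h.2 (by simp)
  refine ⟨h1, h2, ?_⟩
  rw [mem_TZ]; tauto

theorem QS.top {z : V} {L : List V} {p0 q0 p1 q1 : ℤ} {T : Finset V} {D : ℤ}
    (h1 : p0 ≤ 0) (h2 : q0 ≤ 0) (h3 : p1 ≤ 0) (h4 : q1 ≤ 0) : QS K z L p0 q0 p1 q1 T D :=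
  Or.inl fun _ => Sat.top L h1 h2 h3 h4

theorem step01 {z a : V} {L : List V} {p0 q0 p1 q1 v : ℤ} (hn : ND z (a :: L))
    (hs : (L.length : ℤ) + 2 ≤ 2 * q0 ∨ (L.length : ℤ) + 3 ≤ 2 * p0 ∨ (L.length : ℤ) + 3 ≤ 2 * q1 ∨
      (L.length : ℤ) + 4 ≤ 2 * p1 → L.length + 2 ≤ v)
    (h0 : FA K z L q0 (max p0 q0) q1 (max p1 q1) v) (h1 : FA K z (a :: L) p0 q0 p1 q1 v) :
    F01 K z a L p0 q0 p1 q1 v := by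
  obtain ⟨e1, e2, e3⟩ := hn.head
  refine QS.ask e3 (fun h => ?_) ?_ ?_
  · have := hs (side01 e3 h); omega
  · rw [← TZ_cons]
    refine QS.mono h1 ?_
    simp only [List.length_cons]; push_cast; omega
  · exact QR.congr h0 fun m => Sat.freezeHead e3 e1 e2 m

theorem stepSub {z a : V} {L : List V} {p0 q0 p1 q1 v : ℤ} (hn : ND z (a :: L))
    (h : F01 K z a L p0 (q0 - 1) p1 (q1 - 1) (v - 1)) : FA K z (a :: L) p0 q0 p1 q1 v := by
  obtain ⟨e1, e2, e3⟩ := hn.head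
  unfold FA
  rw [TZ_cons]
  refine QS.mono (D := v - 1 - (L.length + 1)) (QR.congr h fun m => Sat.subHead e3 e1 e2 m) ?_
  simp only [List.length_cons]; push_cast; omega

theorem stepPeel {z a b : V} {L : List V} {p0 q0 p1 q1 v : ℤ} (hn : ND z (a :: b :: L))
    (h0 : q0 ≤ p0) (h1 : q1 ≤ p1)
    (h : F00 K z a b L (p0 - 1) (q0 - 1) (p1 - 1) (q1 - 1) (v - 2)) :
    FA K z (a :: b :: L) p0 q0 p1 q1 v := by
  obtain ⟨e1, e2, e3⟩ := hn.head
  obtain ⟨f1, f2, f3⟩ := hn.tail.head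
  simp only [List.mem_cons, not_or] at e1
  rw [TZ_cons, Finset.mem_insert, not_or] at e3
  unfold FA
  rw [TZ_cons, TZ_cons]
  refine QS.mono (D := v - 2 - (L.length + 1)) (QR.congr h fun m => Sat.peel e3.2 f3 e1.1 e1.2 f1 e2 f2 m h0 h1) ?_
  simp only [List.length_cons]; push_cast; omega

theorem QS_insert {z a : V} {L : List V} {p0 q0 p1 q1 : ℤ} {T : Finset V} {D : ℤ} (haL : a ∉ L)
    (haz : a ≠ z) (h : QS K z L p0 q0 p1 q1 T D) : QS K z L p0 q0 p1 q1 (insert a T) D := by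
  refine QR.congr h fun m => Sat.congr ?_ ?_
  · intro v hv
    have : v ≠ a := by rintro rfl; exact haL hv
    simp [ind_apply, this]
  · simp [ind_apply, haz.symm]

theorem step00a {z a b : V} {L : List V} {p0 q0 p1 q1 v : ℤ} (hn : ND z (a :: b :: L))
    (hq0 : q0 - 1 ≤ p0) (hq1 : q1 - 1 ≤ p1)
    (hs : (L.length : ℤ) + 2 ≤ 2 * p0 ∨ (L.length : ℤ) + 2 ≤ 2 * q0 ∨ (L.length : ℤ) + 3 ≤ 2 * p1 ∨
      (L.length : ℤ) + 3 ≤ 2 * q1 → L.length + 2 ≤ v)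
    (hs' : (L.length : ℤ) + 2 ≤ 2 * p0 ∨ (L.length : ℤ) + 2 ≤ 2 * (q0 - 1) ∨ (L.length : ℤ) + 3 ≤ 2 * p1 ∨
      (L.length : ℤ) + 3 ≤ 2 * (q1 - 1) → L.length + 3 ≤ v)
    (h0 : F01 K z b L q0 (max p0 q0) q1 (max p1 q1) v)
    (h1 : FA K z (a :: b :: L) p0 q0 p1 q1 v)
    (h2 : FA K z L p0 p0 p1 p1 (v - 1)) : F00 K z a b L p0 q0 p1 q1 v := by
  obtain ⟨e1, e2, e3⟩ := hn.head
  obtain ⟨f1, f2, f3⟩ := hn.tail.head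
  have e4 := e3
  simp only [List.mem_cons, not_or] at e1
  rw [TZ_cons, Finset.mem_insert, not_or] at e3
  refine QS.ask e3.2 (fun h => ?_) ?_ ?_
  · have := hs (side00 e3.2 f3 h); omega
  · refine QS.ask (x := b) (by simp [f3, Ne.symm e1.1]) (fun h => ?_) ?_ ?_
    · have := hs' (side10 e2 e1.2 e1.1 f3 h); omega
    · rw [Finset.insert_comm, ← TZ_cons, ← TZ_cons]
      refine QS.mono h1 ?_
      simp only [List.length_cons]; push_cast; omega
    · have h3 : QS K z L p0 p0 p1 p1 (insert a (TZ z L)) (v - (L.length + 1) - 1) :=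
        QS_insert e1.2 e2 (QS.mono h2 (by omega))
      refine QR.congr h3 fun m => Sat.freezeSecond (by simp [f3, Ne.symm e1.1]) e1.1 f1 f2 m ?_ ?_
      · simp [ind_apply]; omega
      · simp [ind_apply]; omega
  · exact QR.congr h0 fun m => Sat.freezeHead e3.2 (by simp [e1]) e2 m

theorem step00b {z a b : V} {L : List V} {p0 q0 p1 q1 v : ℤ} (hn : ND z (a :: b :: L))
    (hq0 : q0 ≤ p0) (hq1 : q1 ≤ p1)
    (hs : (L.length : ℤ) + 2 ≤ 2 * p0 ∨ (L.length : ℤ) + 2 ≤ 2 * q0 ∨ (L.length : ℤ) + 3 ≤ 2 * p1 ∨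
      (L.length : ℤ) + 3 ≤ 2 * q1 → L.length + 2 ≤ v)
    (h1 : F01 K z a (b :: L) p0 q0 p1 q1 v)
    (h2 : FA K z L p0 p0 p1 p1 v) : F00 K z a b L p0 q0 p1 q1 v := by
  obtain ⟨e1, e2, e3⟩ := hn.head
  obtain ⟨f1, f2, f3⟩ := hn.tail.head
  simp only [List.mem_cons, not_or] at e1
  rw [TZ_cons, Finset.mem_insert, not_or] at e3
  refine QS.ask f3 (fun h => ?_) ?_ ?_
  · have := hs (side00 e3.2 f3 h); omega
  · rw [← TZ_cons]
    refine QS.mono h1 ?_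
    simp only [List.length_cons]; push_cast; omega
  · refine QR.congr h2 fun m => Sat.freezeSecond f3 e1.1 f1 f2 m ?_ ?_
    · simp [ind_apply, e3.2]; omega
    · simp [ind_apply, e3.2]; omega

theorem FA_nil {z : V} {p0 q0 p1 q1 v : ℤ} (h : p0 ≤ 0 → q1 ≤ 1) : FA K z [] p0 q0 p1 q1 v := by
  have e : ind (TZ z []) z = 1 := by simp [ind_apply, TZ]
  by_cases h0 : p0 ≤ 0
  · left; intro m; simp only [Sat, Finsupp.add_apply, e]; push_cast
    have := h h0; omega
  · apply QR_false
    intro m h1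
    exact h0 h1.1

theorem FA.cast {z : V} {L : List V} {p0 q0 p1 q1 v p0' q0' p1' q1' v' : ℤ}
    (h : FA K z L p0 q0 p1 q1 v) (h1 : p0 = p0') (h2 : q0 = q0') (h3 : p1 = p1') (h4 : q1 = q1')
    (h5 : v ≤ v') : FA K z L p0' q0' p1' q1' v' := by
  subst_vars; exact QS.mono h (by omega)

theorem F01.cast {z a : V} {L : List V} {p0 q0 p1 q1 v p0' q0' p1' q1' v' : ℤ}
    (h : F01 K z a L p0 q0 p1 q1 v) (h1 : p0 = p0') (h2 : q0 = q0') (h3 : p1 = p1') (h4 : q1 = q1')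
    (h5 : v = v') : F01 K z a L p0' q0' p1' q1' v' := by subst_vars; exact h

theorem F00.cast {z a b : V} {L : List V} {p0 q0 p1 q1 v p0' q0' p1' q1' v' : ℤ}
    (h : F00 K z a b L p0 q0 p1 q1 v) (h1 : p0 = p0') (h2 : q0 = q0') (h3 : p1 = p1') (h4 : q1 = q1')
    (h5 : v = v') : F00 K z a b L p0' q0' p1' q1' v' := by subst_vars; exact h

theorem clean (z : V) (δ : ℤ) (hδ : 0 ≤ δ) (hδ' : δ ≤ 1) : ∀ (N : ℕ) (τ : ℤ), τ < N → ∀ L, ND z L →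
    FA K z L τ τ (τ + δ) (τ + δ) (2 * τ + δ) := by
  intro N
  induction N with
  | zero =>
    intro τ hτ L _
    push_cast at hτ
    exact QS.top (by omega) (by omega) (by omega) (by omega)
  | succ N ih =>
    intro τ hτ L hn
    push_cast at hτ
    match L, hn with
    | [], _ => exact FA_nil (by omega)
    | [a], hn =>
      have e2 := hn.head.2.1
      have e : ind (TZ z [a]) z = 1 := by simp [ind_apply, TZ]
      have e' : ind (TZ z [a]) a = 1 := by simp [ind_apply, TZ]
      apply QS.base e2 <;> rw [e, e'] <;> push_cast <;> (try simp) <;> omega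
    | a :: b :: L, hn =>
      apply stepPeel hn le_rfl le_rfl
      refine F00.cast (step00b (p0 := τ - 1) (q0 := τ - 1) (p1 := τ - 1 + δ) (q1 := τ - 1 + δ)
        (v := 2 * (τ - 1) + δ) hn le_rfl le_rfl (by omega) ?_ ?_)
        rfl rfl (by ring) (by ring) (by ring)
      · refine step01 hn (by simp only [List.length_cons]; push_cast; omega) ?_ ?_
        · exact (ih (τ - 1) (by omega) _ hn.tail).cast rfl (by simp) rfl (by simp) le_rfl
        · exact ih (τ - 1) (by omega) _ hn
      · exact ih (τ - 1) (by omega) _ hn.tail.tail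

theorem clean' {z : V} {δ τ : ℤ} (hδ : 0 ≤ δ) (hδ' : δ ≤ 1) {L : List V} (hn : ND z L)
    {p0 q0 p1 q1 v : ℤ} (h1 : τ = p0) (h2 : τ = q0) (h3 : τ + δ = p1) (h4 : τ + δ = q1) (h5 : 2 * τ + δ = v) :
    FA K z L p0 q0 p1 q1 v :=
  (clean z δ hδ hδ' (τ.toNat + 1) τ (by push_cast; omega) L hn).cast h1 h2 h3 h4 h5.le

theorem base01 {z a : V} (hn : ND z [a]) {p0 q0 p1 q1 v : ℤ}
    (h1 : q1 ≤ max q0 0 + max p1 1)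
    (h2 : ¬ (q0 ≤ 0 ∧ p1 ≤ 1) → max q0 0 + max (p1 - 1) 0 ≤ v - 1) : F01 K z a [] p0 q0 p1 q1 v := by
  obtain ⟨e1, e2, e3⟩ := hn.head
  have e : ind (TZ z []) z = 1 := by simp [ind_apply, TZ]
  have e' : ind (TZ z []) a = 0 := by simp [ind_apply, e3]
  apply QS.base e2 <;> rw [e, e'] <;> simp <;> omega

theorem base11 {z a : V} (hn : ND z [a]) {p0 q0 p1 q1 v : ℤ}
    (h1 : q1 ≤ max q0 1 + max p1 1)
    (h2 : ¬ (q0 ≤ 1 ∧ p1 ≤ 1) → max (q0 - 1) 0 + max (p1 - 1) 0 ≤ v - 2) : FA K z [a] p0 q0 p1 q1 v := by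
  have e2 := hn.head.2.1
  have e : ind (TZ z [a]) z = 1 := by simp [ind_apply, TZ]
  have e' : ind (TZ z [a]) a = 1 := by simp [ind_apply, TZ]
  apply QS.base e2 <;> rw [e, e'] <;> simp <;> omega

structure Six (K : Type) [Field K] {V : Type} (z : V) (t : ℤ) : Prop where
  Y : ∀ a L, ND z (a :: L) → F01 K z a L (t+1) t (t+1) (t+1) (2*t+3)
  B : ∀ a b L, ND z (a :: b :: L) → F00 K z a b L (t+1) t (t+1) (t+1) (2*t+3)
  F : ∀ a L, ND z (a :: L) → F01 K z a L t (t+1) (t+1) (t+1) (2*t+3)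
  G : ∀ a L, ND z (a :: L) → F01 K z a L t t (t+1) t (2*t+2)
  G' : ∀ a b L, ND z (a :: b :: L) → F00 K z a b L t t (t+1) t (2*t+2)
  F' : ∀ a L, ND z (a :: L) → F01 K z a L t t t (t+1) (2*t+2)

theorem six (z : V) : ∀ (N : ℕ) (t : ℤ), t < N → Six K z t := by
  intro N
  induction N with
  | zero =>
    intro t ht
    push_cast at ht
    constructor <;> intros <;> exact QS.top (by omega) (by omega) (by omega) (by omega)
  | succ N ih =>
    intro t ht
    push_cast at ht
    by_cases ht0 : t < 0
    · constructor <;> intros <;> exact QS.top (by omega) (by omega) (by omega) (by omega)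
    have ih' := ih (t - 1) (by omega)
    have G : ∀ a L, ND z (a :: L) → F01 K z a L t t (t+1) t (2*t+2) := by
      intro a L hn
      match L, hn with
      | [], hn => exact base01 hn (by omega) (by omega)
      | b :: L, hn =>
        refine step01 hn (by simp only [List.length_cons]; push_cast; omega) ?_ ?_
        · apply stepSub hn.tail
          exact (ih'.Y b L hn.tail).cast (by omega) (by omega) (by omega) (by omega) (by omega)
        · apply stepPeel hn (by omega) (by omega)
          exact (ih'.G' a b L hn).cast (by omega) (by omega) (by omega) (by omega) (by omega)
    have F' : ∀ a L, ND z (a :: L) → F01 K z a L t t t (t+1) (2*t+2) := by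
      intro a L hn
      refine step01 hn (by omega) ?_ ?_
      · exact (clean' (τ := t) (δ := 1) (by omega) (by omega) hn.tail rfl rfl rfl rfl rfl).cast
          (by omega) (by omega) (by omega) (by omega) (by omega)
      · apply stepSub hn
        exact (ih'.Y a L hn).cast (by omega) (by omega) (by omega) (by omega) (by omega)
    have F : ∀ a L, ND z (a :: L) → F01 K z a L t (t+1) (t+1) (t+1) (2*t+3) := by
      intro a L hn
      refine step01 hn (by omega) ?_ ?_
      · exact (clean' (τ := t+1) (δ := 0) (by omega) (by omega) hn.tail rfl rfl rfl rfl rfl).cast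
          (by omega) (by omega) (by omega) (by omega) (by omega)
      · apply stepSub hn
        exact (G a L hn).cast (by omega) (by omega) (by omega) (by omega) (by omega)
    refine ⟨?_, ?_, F, G, ?_, F'⟩
    · intro a L hn
      match L, hn with
      | [], hn => exact base01 hn (by omega) (by omega)
      | b :: L, hn =>
        refine step01 hn (by simp only [List.length_cons]; push_cast; omega) ?_ ?_
        · apply stepSub hn.tail
          exact (G b L hn.tail).cast (by omega) (by omega) (by omega) (by omega) (by omega)
        · apply stepPeel hn (by omega) (by omega)
          exact (ih'.B a b L hn).cast (by omega) (by omega) (by omega) (by omega) (by omega)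
    · intro a b L hn
      refine step00a hn (by omega) (by omega) (by omega) (by omega) ?_ ?_ ?_
      · exact (F b L hn.tail).cast (by omega) (by omega) (by omega) (by omega) (by omega)
      · apply stepPeel hn (by omega) (by omega)
        exact (ih'.B a b L hn).cast (by omega) (by omega) (by omega) (by omega) (by omega)
      · exact (clean' (τ := t+1) (δ := 0) (by omega) (by omega) hn.tail.tail rfl rfl rfl rfl rfl).cast
          (by omega) (by omega) (by omega) (by omega) (by omega)
    · intro a b L hn
      refine step00a hn (by omega) (by omega) (by omega) (by omega) ?_ ?_ ?_
      · exact (F' b L hn.tail).cast (by omega) (by omega) (by omega) (by omega) (by omega)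
      · apply stepPeel hn (by omega) (by omega)
        exact (ih'.G' a b L hn).cast (by omega) (by omega) (by omega) (by omega) (by omega)
      · exact (clean' (τ := t) (δ := 1) (by omega) (by omega) hn.tail.tail rfl rfl rfl rfl rfl).cast
          (by omega) (by omega) (by omega) (by omega) (by omega)

/-- The ideal `N` : path cover condition at `s`, all ones. -/
theorem caseN {z : V} {L : List V} (hn : ND z L) (s : ℤ) : FA K z L s s s s (2 * s) :=
  clean' (τ := s) (δ := 0) (by omega) (by omega) hn rfl rfl (by omega) (by omega) (by omega)

/-- The ideal `Y`. -/
theorem caseY {z a : V} {L : List V} (hn : ND z (a :: L)) (s : ℤ) :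
    FA K z (a :: L) s s s (s + 1) (2 * s + 2) := by
  apply stepSub hn
  exact ((six z ((s-1).toNat + 1) (s - 1) (by push_cast; omega)).Y a L hn).cast
    (by omega) (by omega) (by omega) (by omega) (by omega)

end ER

namespace ER

open scoped Classical

variable {V K : Type} [Field K] {G : SimpleGraph V}

def IsP (G : SimpleGraph V) : List V → Prop
  | [] => True
  | a :: L => a ∉ L ∧ (∀ x ∈ L, G.Adj a x ↔ L.head? = some x) ∧ IsP G L

def Run (T A : Finset V) : List V → Prop
  | [] => True
  | a :: L => (a ∈ T → a ∈ A ∨ ∃ b, L.head? = some b ∧ b ∈ T) ∧ Run T A L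

theorem IsP.nodup : ∀ {L : List V}, IsP G L → L.Nodup
  | [], _ => List.nodup_nil
  | _ :: _, h => List.nodup_cons.2 ⟨h.1, IsP.nodup h.2.2⟩

theorem Run.congr {T A T' A' : Finset V} : ∀ {L : List V}, (∀ v ∈ L, v ∈ T ↔ v ∈ T') →
    (∀ v ∈ L, v ∈ A ↔ v ∈ A') → Run T A L → Run T' A' L
  | [], _, _, _ => trivial
  | a :: L, h1, h2, h => by
    refine ⟨?_, Run.congr (fun v hv => h1 v (by simp [hv])) (fun v hv => h2 v (by simp [hv])) h.2⟩
    intro ha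
    rcases h.1 ((h1 a (by simp)).2 ha) with h3 | ⟨b, hb, hbT⟩
    · exact Or.inl ((h2 a (by simp)).1 h3)
    · refine Or.inr ⟨b, hb, (h1 b ?_).1 hbT⟩
      exact List.mem_cons_of_mem _ (List.mem_of_mem_head? hb)

theorem count_list {T A p : Finset V} (hAT : A ⊆ T) : ∀ {L : List V}, IsP G L → Run T A L → Cov G L.toFinset p →
    L.countP (fun v => v ∈ T ∧ v ∉ p) + (if ∃ b, L.head? = some b ∧ b ∈ T ∧ b ∈ p then 1 else 0) ≤
      L.countP (fun v => v ∈ A ∧ v ∉ p) + L.countP (fun v => v ∈ T ∧ v ∈ p)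
  | [], _, _, _ => by simp
  | a :: L, hP, hR, hC => by
    have ih := count_list (p := p) hAT hP.2.2 hR.2 (by
      intro u hu v hv; exact hC u (by simp at hu ⊢; tauto) v (by simp at hv ⊢; tauto))
    simp only [List.countP_cons, List.head?_cons, Option.some.injEq]
    simp only [decide_eq_true_eq, exists_eq_left']
    have hcov : ∀ b, L.head? = some b → a ∉ p → b ∈ p := by
      intro b hb hap
      have hbL : b ∈ L := List.mem_of_mem_head? hb
      exact (hC a (by simp) b (by simp [hbL]) ((hP.2.1 b hbL).2 hb)).resolve_left hap
    generalize L.countP (fun v => v ∈ T ∧ v ∉ p) = c1 at ih ⊢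
    generalize L.countP (fun v => v ∈ A ∧ v ∉ p) = c2 at ih ⊢
    generalize L.countP (fun v => v ∈ T ∧ v ∈ p) = c3 at ih ⊢
    by_cases haT : a ∈ T
    · by_cases hap : a ∈ p
      · simp only [haT, hap]
        simp
        split_ifs at ih <;> omega
      · by_cases haA : a ∈ A
        · simp [haT, hap, haA]
          split_ifs at ih <;> omega
        · obtain ⟨b, hb, hbT⟩ := (hR.1 haT).resolve_left haA
          have hbp : b ∈ p := hcov b hb hap
          rw [if_pos ⟨b, hb, hbT, hbp⟩] at ih
          simp [haT, hap, haA]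
          omega
    · have haA : a ∉ A := fun h => haT (hAT h)
      simp [haT, haA]
      split_ifs at ih <;> omega

theorem card_countP {L : List V} (hL : L.Nodup) {S : Finset V} (hS : S ⊆ L.toFinset) :
    S.card = L.countP (fun v => v ∈ S) := by
  rw [List.countP_eq_length_filter, ← List.toFinset_card_of_nodup (hL.filter _)]
  congr 1
  ext v
  simp
  intro h; simpa using hS h

theorem count_card {T A p : Finset V} (hAT : A ⊆ T) {L : List V} (hP : IsP G L) (hR : Run T A L)
    (hC : Cov G L.toFinset p) (hT : T ⊆ L.toFinset) : (T \ p).card ≤ (A \ p).card + (T ∩ p).card := by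
  have := count_list hAT hP hR hC
  rw [card_countP hP.nodup (S := T \ p) (fun x hx => hT (by simp at hx; exact hx.1)),
    card_countP hP.nodup (S := A \ p) (fun x hx => hT (hAT (by simp at hx; exact hx.1))),
    card_countP hP.nodup (S := T ∩ p) (fun x hx => hT (by simp at hx; exact hx.1))]
  simp only [Finset.mem_sdiff, Finset.mem_inter]
  omega

theorem sideS1 {Cy T A : Finset V} {L : List V} {s : ℕ} {B : ℤ} (hAT : A ⊆ T) (hP : IsP G L)
    (hR : Run T A L) (hT : T ⊆ L.toFinset) (hB : Bd G Cy L.toFinset A B)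
    (hJ : ¬ J G L.toFinset s (ind T)) : (1:ℤ) ≤ 2 * s - 1 + B - T.card := by
  obtain ⟨p, hp, hps, hind, hcard⟩ := not_J hT hJ
  have h1 := count_card hAT hP hR hp hT
  have h2 := hB _ (Cfg.points (P := A \ p) Finset.sdiff_subset
    ((Finset.sdiff_subset.trans hAT).trans hT)
    (fun a ha b hb => hind a (Finset.sdiff_subset_sdiff hAT le_rfl ha) b (Finset.sdiff_subset_sdiff hAT le_rfl hb)))
  omega

theorem sideS2 {Cy X T A : Finset V} {l y : V} {r : List V} {s : ℕ} {B : ℤ} (hAT : A ⊆ T)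
    (hP : IsP G (l :: y :: r)) (hX : X ⊆ (l :: y :: r).toFinset) (hX' : (y :: r).toFinset ⊆ X)
    (hR : Run T A r) (hT : T ⊆ r.toFinset) (hB : Bd G Cy (l :: y :: r).toFinset A B)
    (hJ : ¬ J G X s (ind (insert y T))) : (1:ℤ) ≤ 2 * s - 1 + B - (insert y T).card := by
  have hsub : insert y T ⊆ (y :: r).toFinset := by
    intro x hx
    rw [Finset.mem_insert] at hx
    rcases hx with rfl | hx
    · simp
    · have := hT hx; simp at this; simp [this]
  obtain ⟨p, hp, hps, hind, hcard⟩ := not_J (hsub.trans hX') hJ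
  have hyr : y ∉ r := hP.2.2.1
  have hyT : y ∉ T := fun h => hyr (by simpa using hT h)
  have h1 := count_card (p := p) hAT hP.2.2.2.2 hR (fun u hu v hv => hp u (hX' (by simp at hu ⊢; tauto)) v
    (hX' (by simp at hv ⊢; tauto))) hT
  have hsubA : A \ p ⊆ insert y T \ p := fun x hx => by
    simp only [Finset.mem_sdiff, Finset.mem_insert] at hx ⊢; exact ⟨Or.inr (hAT hx.1), hx.2⟩
  have hAr : ∀ x ∈ A, x ∈ r := fun x hx => by simpa using hT (hAT hx)
  by_cases hyp : y ∈ p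
  · have h2 := hB _ (Cfg.points (P := A \ p) Finset.sdiff_subset
      (fun x hx => by simp only [Finset.mem_sdiff] at hx; have := hAr x hx.1; simp [this])
      (fun a ha b hb => hind a (hsubA ha) b (hsubA hb)))
    have e1 : insert y T \ p = T \ p := Finset.insert_sdiff_of_mem _ hyp
    have e2 : (T ∩ p).card ≤ (insert y T ∩ p).card :=
      Finset.card_le_card (Finset.inter_subset_inter (Finset.subset_insert _ _) le_rfl)
    rw [e1] at hcard
    omega
  · have h2 := hB _ (Cfg.ed _ l y (A \ p).card (by simp) (by simp) ((hP.2.1 y (by simp)).2 rfl)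
      (Cfg.points (P := A \ p) Finset.sdiff_subset ?_
        (fun a ha b hb => hind a (hsubA ha) b (hsubA hb))))
    · have e1 : (insert y T \ p).card ≤ (T \ p).card + 1 := by
        rw [Finset.insert_sdiff_of_notMem _ hyp]; exact Finset.card_insert_le _ _
      have e2 : (T ∩ p).card ≤ (insert y T ∩ p).card :=
        Finset.card_le_card (Finset.inter_subset_inter (Finset.subset_insert _ _) le_rfl)
      push_cast at h2
      omega
    · intro x hx
      have hxr := hAr x (Finset.mem_sdiff.1 hx).1
      have hxy : x ≠ y := by rintro rfl; exact hyr hxr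
      rw [mem_rm, mem_rm]
      refine ⟨⟨by simp [hxr], ?_, ?_⟩, hxy, ?_⟩
      · rintro rfl; exact hP.1 (by simp [hxr])
      · rw [hP.2.1 x (by simp [hxr])]; simp [hxy.symm]
      · exact hind y (by simp [hyp]) x (hsubA hx)

def PR (K : Type) [Field K] {V : Type} (G : SimpleGraph V) (Cy : Finset V) (s : ℕ) (L : List V) : Prop :=
  ∀ (T A : Finset V) (B : ℤ), Run T A L → A ⊆ T → T ⊆ L.toFinset → Bd G Cy L.toFinset A B →
    QJ K G L.toFinset s T (2 * s - 1 + B - T.card)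

theorem NB_head {l y : V} {r : List V} (hP : IsP G (l :: y :: r)) :
    NB G (l :: y :: r).toFinset l = {l, y} := by
  ext x
  rw [mem_NB]
  simp only [List.mem_toFinset, List.mem_cons, Finset.mem_insert, Finset.mem_singleton]
  constructor
  · rintro ⟨h1, h2⟩
    by_cases hx : x = l
    · exact Or.inl hx
    · have h3 : x ∈ y :: r := by simp only [List.mem_cons]; tauto
      have := (hP.2.1 x h3).1 (h2.resolve_left hx)
      simp at this; exact Or.inr this.symm
  · rintro (rfl | rfl)
    · simp
    · exact ⟨by simp, Or.inr ((hP.2.1 x (by simp)).2 rfl)⟩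

theorem Simp_head {l y : V} {r : List V} (hP : IsP G (l :: y :: r)) :
    Simp G (l :: y :: r).toFinset l := by
  have hly : G.Adj l y := (hP.2.1 y (by simp)).2 rfl
  intro a ha b hb hab
  rw [NB_head hP] at ha hb
  simp at ha hb
  rcases ha with rfl | rfl <;> rcases hb with rfl | rfl
  · exact absurd rfl hab
  · exact hly
  · exact hly.symm
  · exact absurd rfl hab

theorem pr_peel {Cy T A : Finset V} {l y : V} {r : List V} {s : ℕ} {B : ℤ} (hAT : A ⊆ T)
    (hP : IsP G (l :: y :: r)) (hl : l ∈ T) (hy : y ∈ T) (hR : Run T A r)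
    (hT : T ⊆ (l :: y :: r).toFinset) (hB : Bd G Cy (l :: y :: r).toFinset A B)
    (hPR : PR K G Cy s (l :: y :: r)) :
    QJ K G (l :: y :: r).toFinset (s + 1) T (2 * (s + 1 : ℕ) - 1 + B - T.card) := by
  have hly : l ≠ y := by rintro rfl; exact hP.1 (by simp)
  have hlr : l ∉ r := fun h => hP.1 (by simp [h])
  have hyr : y ∉ r := hP.2.2.1
  have hc : ({l, y} : Finset V).card = 2 := Finset.card_pair hly
  have hsub : ({l, y} : Finset V) ⊆ T := by
    intro x; simp; rintro (rfl | rfl) <;> assumption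
  have hcard := Finset.card_sdiff_add_card_eq_card hsub
  rw [hc] at hcard
  have h := hPR (T \ {l, y}) (A \ {l, y}) B ?_ (Finset.sdiff_subset_sdiff hAT le_rfl)
    (Finset.sdiff_subset.trans hT) (hB.mono le_rfl (by intro u _; simp; tauto))
  · refine QJ.mono (D := 2 * s - 1 + B - (T \ {l, y}).card) (QR.congr h fun m => ?_) (by push_cast; omega)
    rw [peel (T := T) (by simp) (Simp_head hP) (by rw [NB_head hP]; exact hsub), NB_head hP, hc]
    rfl
  · refine ⟨by simp, by simp, hR.congr ?_ ?_⟩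
    · intro v hv
      have h1 : v ≠ l := by rintro rfl; exact hlr hv
      have h2 : v ≠ y := by rintro rfl; exact hyr hv
      simp [h1, h2]
    · intro v hv
      have h1 : v ≠ l := by rintro rfl; exact hlr hv
      have h2 : v ≠ y := by rintro rfl; exact hyr hv
      simp [h1, h2]

theorem QJ.iso {X T : Finset V} {s : ℕ} {v : V} {D : ℤ} (hs : NB G X v ⊆ {v})
    (h : QJ K G (X.erase v) s (T.erase v) D) : QJ K G X s T D :=
  QR.congr h fun m => (isolated hs m).symm

theorem QJ_noedge {X T : Finset V} {s : ℕ} {D : ℤ} (h : ∀ u ∈ X, ∀ v ∈ X, ¬ G.Adj u v) :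
    QJ K G X (s + 1) T D := by
  refine QR_false (fun m hm => ?_) D
  have := hm ∅ (fun u hu v hv huv => absurd huv (h u hu v hv))
  simp at this

theorem pathrun {Cy : Finset V} : ∀ (s : ℕ) (n : ℕ) (L : List V), L.length = n → IsP G L → PR K G Cy s L := by
  intro s
  induction s with
  | zero =>
    intro n L _ _ T A B _ _ _ _
    left; intro m p _; simp
  | succ s ihs =>
    intro n
    induction n using Nat.strong_induction_on with
    | _ n ihn =>
    intro L hn hP T A B hR hAT hT hB
    match L, hn, hP, hR, hT, hB with
    | [], hn, hP, hR, hT, hB => exact QJ_noedge (by simp)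
    | [l], hn, hP, hR, hT, hB => exact QJ_noedge (by simp)
    | l :: y :: r, hn, hP, hR, hT, hB =>
      have hPs := ihs _ (l :: y :: r) rfl hP
      have hly : l ≠ y := by rintro rfl; exact hP.1 (by simp)
      have hlr : l ∉ r := fun h => hP.1 (by simp [h])
      have hyr : y ∉ r := hP.2.2.1
      have hadj : G.Adj l y := (hP.2.1 y (by simp)).2 rfl
      have hel : (l :: y :: r).toFinset.erase l = (y :: r).toFinset := by
        rw [List.toFinset_cons, Finset.erase_insert (by simpa using hP.1)]
      have hTr : ∀ x ∈ T, x = l ∨ x = y ∨ x ∈ r := fun x hx => by simpa using hT hx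
      simp only [List.length_cons] at hn
      by_cases hyT : y ∈ T
      · by_cases hlT : l ∈ T
        · exact pr_peel hAT hP hlT hyT hR.2.2 hT hB hPs
        · refine QJ.ask hlT (sideS1 hAT hP hR hT hB) ?_ ?_
          · refine QJ.mono (pr_peel (T := insert l T) (A := A) (B := B) (hAT.trans (Finset.subset_insert _ _)) hP (by simp)
              (by simp [hyT]) ?_ (Finset.insert_subset (by simp) hT) hB hPs) ?_
            · refine hR.2.2.congr (fun v hv => ?_) (fun v hv => Iff.rfl)
              have : v ≠ l := by rintro rfl; exact hlr hv
              simp [this]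
            · rw [Finset.card_insert_of_notMem hlT]; push_cast; omega
          · rw [hel]
            refine ihn _ (by simp; omega) (y :: r) rfl hP.2.2 T A B hR.2 hAT ?_
              (hB.mono (by intro x; simp; tauto) (fun _ _ h => h))
            intro x hx
            rcases hTr x hx with rfl | h
            · exact absurd hx hlT
            · simpa using h
      · have hRl : l ∈ T → l ∈ A := by
          intro h
          rcases hR.1 h with h1 | ⟨b, hb, hbT⟩
          · exact h1
          · simp at hb; subst hb; exact absurd hbT hyT
        refine QJ.ask hyT (sideS1 hAT hP hR hT hB) ?_ ?_
        · -- y colon'd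
          have hc1 := Finset.card_insert_of_notMem hyT
          have hd : ∀ Q : Finset V, (2 * ((s + 1 : ℕ) : ℤ) - 1 + B - T.card - 1) = 2 * ((s + 1 : ℕ) : ℤ) - 1 + B - (insert y T).card := by
            intro _; rw [hc1]; push_cast; omega
          rw [hd ∅]
          have hsub1 : insert y T ⊆ (l :: y :: r).toFinset := Finset.insert_subset (by simp) hT
          have hRr : ∀ Q : Finset V, (∀ v ∈ r, v ∉ Q) → Run (Q ∪ T) A r := by
            intro Q hQ
            refine hR.2.2.congr (fun v hv => ?_) (fun v hv => Iff.rfl)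
            have := hQ v hv
            simp [this]
          by_cases hlT : l ∈ T
          · refine pr_peel (hAT.trans (Finset.subset_insert _ _)) hP (by simp [hlT]) (by simp) ?_ hsub1 hB hPs
            exact hRr {y} (by intro v hv; simp; rintro rfl; exact hyr hv)
          · have hTr' : T ⊆ r.toFinset := by
              intro x hx
              rcases hTr x hx with rfl | rfl | h
              · exact absurd hx hlT
              · exact absurd hx hyT
              · simpa using h
            have hl1 : l ∉ insert y T := by simp [hlT, hly]
            refine QJ.ask hl1 (sideS2 hAT hP le_rfl (by intro x; simp; tauto) hR.2.2 hTr' hB) ?_ ?_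
            · refine QJ.mono (pr_peel (T := insert l (insert y T)) (A := A) (B := B)
                ((hAT.trans (Finset.subset_insert _ _)).trans (Finset.subset_insert _ _)) hP (by simp)
                (by simp) ?_ (Finset.insert_subset (by simp) hsub1) hB hPs) ?_
              · have := hRr {l, y} (by
                  intro v hv; simp
                  exact ⟨by rintro rfl; exact hlr hv, by rintro rfl; exact hyr hv⟩)
                have e : ({l, y} : Finset V) ∪ T = insert l (insert y T) := by
                  ext x; simp
                rwa [e] at this
              · rw [Finset.card_insert_of_notMem hl1]; push_cast; omega
            · rw [hel]
              clear hPs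
              match r, hn, hP, hR, hT, hB, hyr, hel, hTr', hsub1, hRr, hlr with
              | [], hn, hP, hR, hT, hB, hyr, hel, hTr', hsub1, hRr, hlr => exact QJ_noedge (by simp)
              | z :: r, hn, hP, hR, hT, hB, hyr, hel, hTr', hsub1, hRr, hlr =>
                have hsub2 : insert y T ⊆ (y :: z :: r).toFinset := by
                  intro x hx
                  rw [Finset.mem_insert] at hx
                  rcases hx with rfl | hx
                  · simp
                  · have := hTr' hx; simp at this; simp [this]
                have hB2 : Bd G Cy (y :: z :: r).toFinset A B :=
                  hB.mono (by intro x; simp; tauto) (fun _ _ h => h)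
                have hR1 : Run (insert y T) A (z :: r) :=
                  hRr {y} (by intro v hv; simp; rintro rfl; exact hyr hv)
                by_cases hzT : z ∈ T
                · refine ihn _ (by simp at hn ⊢; omega) (y :: z :: r) rfl hP.2.2 (insert y T) A B ?_
                    (hAT.trans (Finset.subset_insert _ _)) hsub2 hB2
                  exact ⟨fun _ => Or.inr ⟨z, rfl, by simp [hzT]⟩, hR1⟩
                · have hyz : y ≠ z := by rintro rfl; exact hyr (by simp)
                  have hz1 : z ∉ insert y T := by simp [hzT, hyz.symm]
                  have hzr : z ∉ r := hP.2.2.2.2.1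
                  refine QJ.ask hz1 (sideS2 hAT hP (by intro x; simp; tauto) le_rfl hR.2.2 hTr' hB) ?_ ?_
                  · refine QJ.mono (pr_peel (T := insert z (insert y T)) (A := A) (B := B)
                      ((hAT.trans (Finset.subset_insert _ _)).trans (Finset.subset_insert _ _)) hP.2.2 (by simp)
                      (by simp) ?_ (Finset.insert_subset (by simp) hsub2) hB2 (ihs _ (y :: z :: r) rfl hP.2.2)) ?_
                    · refine hR.2.2.2.congr (fun v hv => ?_) (fun v hv => Iff.rfl)
                      have h1 : v ≠ y := by rintro rfl; exact hyr (by simp [hv])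
                      have h2 : v ≠ z := by rintro rfl; exact hzr hv
                      simp [h1, h2]
                    · rw [Finset.card_insert_of_notMem hz1]; push_cast; omega
                  · have hyr' : y ∉ r := fun h => hyr (by simp [h])
                    have hX : ((y :: z :: r).toFinset.erase z) = (y :: r).toFinset := by
                      ext x; simp only [Finset.mem_erase, List.mem_toFinset, List.mem_cons]
                      constructor
                      · tauto
                      · rintro (rfl | h)
                        · exact ⟨hyz, by simp⟩
                        · exact ⟨by rintro rfl; exact hzr h, by simp [h]⟩
                    rw [hX]
                    apply QJ.iso (v := y)
                    · intro x hx
                      rw [mem_NB] at hx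
                      simp only [List.mem_toFinset, List.mem_cons] at hx
                      rw [Finset.mem_singleton]
                      rcases hx with ⟨h1 | h1, h2 | h2⟩
                      · exact h1
                      · exact h1
                      · exact h2
                      · have h6 : (z :: r).head? = some x := ((hP.2.2 : IsP G (y :: z :: r)).2.1 x (by simp [h1])).1 h2
                        simp at h6; subst h6; exact absurd h1 hzr
                    · have e1 : (y :: r).toFinset.erase y = r.toFinset := by
                        rw [List.toFinset_cons, Finset.erase_insert (by simpa using hyr')]
                      rw [e1, Finset.erase_insert hyT]
                      have := ihn r.length (by simp at hn; omega) r rfl hP.2.2.2.2.2.2 T A (B - 1) hR.2.2.2 hAT ?_ ?_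
                      · refine QJ.mono this ?_
                        rw [hc1]; push_cast; omega
                      · intro x hx
                        have := hTr' hx
                        simp at this
                        rcases this with rfl | h
                        · exact absurd hx hzT
                        · simpa using h
                      · intro w hw
                        have := hB _ (Cfg.ed _ l y w (by simp) (by simp) hadj (hw.mono ?_ (fun _ _ h => h)))
                        · push_cast at this; omega
                        · intro x hx
                          have hxr : x ∈ r := by simpa using hx
                          have hxz : x ≠ z := by rintro rfl; exact hzr hxr
                          have hxy : x ≠ y := by rintro rfl; exact hyr' hxr
                          rw [mem_rm, mem_rm]
                          refine ⟨⟨by simp [hxr], ?_, ?_⟩, hxy, ?_⟩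
                          · rintro rfl; exact hP.1 (by simp [hxr])
                          · rw [hP.2.1 x (by simp [hxr])]; simp [hxy.symm]
                          · rw [(hP.2.2 : IsP G (y :: z :: r)).2.1 x (by simp [hxr])]; simp [hxz.symm]
        · -- y deleted
          have hX : ((l :: y :: r).toFinset.erase y) = (l :: r).toFinset := by
            ext x; simp only [Finset.mem_erase, List.mem_toFinset, List.mem_cons]
            constructor
            · tauto
            · rintro (rfl | h)
              · exact ⟨hly, by simp⟩
              · exact ⟨by rintro rfl; exact hyr h, by simp [h]⟩
          have hlx : ∀ x ∈ r, ¬ G.Adj l x := by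
            intro x hx h
            have := (hP.2.1 x (by simp [hx])).1 h
            simp at this; subst this; exact hyr hx
          rw [hX]
          apply QJ.iso (v := l)
          · intro x hx
            rw [mem_NB] at hx
            simp only [List.mem_toFinset, List.mem_cons] at hx
            rw [Finset.mem_singleton]
            rcases hx with ⟨h1 | h1, h2 | h2⟩
            · exact h1
            · exact h1
            · exact h2
            · exact absurd h2 (hlx x h1)
          · have e1 : (l :: r).toFinset.erase l = r.toFinset := by
              rw [List.toFinset_cons, Finset.erase_insert (by simpa using hlr)]
            rw [e1]
            have hTe : T.erase l ⊆ r.toFinset := by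
              intro x hx
              rw [Finset.mem_erase] at hx
              rcases hTr x hx.2 with rfl | rfl | h
              · exact absurd rfl hx.1
              · exact absurd hx.2 hyT
              · simpa using h
            have hRe : Run (T.erase l) (A.erase l) r := by
              refine hR.2.2.congr (fun v hv => ?_) (fun v hv => ?_) <;>
              · have : v ≠ l := by rintro rfl; exact hlr hv
                simp [this]
            by_cases hlT : l ∈ T
            · have := ihn r.length (by omega) r rfl hP.2.2.2.2 (T.erase l) (A.erase l) (B - 1) hRe
                (Finset.erase_subset_erase _ hAT) hTe ?_
              · refine QJ.mono this ?_
                have := Finset.card_erase_add_one hlT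
                omega
              · intro w hw
                have := hB _ (Cfg.pt _ l w (by simp) (hRl hlT) (hw.mono ?_ (fun u _ h => Finset.mem_of_mem_erase h)))
                · push_cast at this; omega
                · intro x hx
                  have hxr : x ∈ r := by simpa using hx
                  rw [mem_rm]
                  exact ⟨by simp [hxr], by rintro rfl; exact hlr hxr, hlx x hxr⟩
            · have := ihn r.length (by omega) r rfl hP.2.2.2.2 (T.erase l) (A.erase l) B hRe
                (Finset.erase_subset_erase _ hAT) hTe
                (hB.mono (by intro x; simp; tauto) (fun u _ h => Finset.mem_of_mem_erase h))
              rwa [Finset.erase_eq_of_notMem hlT] at this ⊢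

end ER

namespace ER

open scoped Classical

variable {V K : Type} [Field K] {G : SimpleGraph V}

structure ICyc (G : SimpleGraph V) (Cy : Finset V) (n : ℕ) (f : ZMod n → V) : Prop where
  n4 : 4 ≤ n
  inj : Function.Injective f
  adj : ∀ i j, G.Adj (f i) (f j) ↔ (j = i + 1 ∨ i = j + 1)
  mem : ∀ v, v ∈ Cy ↔ ∃ i, f i = v

theorem cast_inj' {n a b : ℕ} (ha : a < n) (hb : b < n) : ((a : ZMod n) = b) ↔ a = b := by
  rw [ZMod.natCast_eq_natCast_iff']
  rw [Nat.mod_eq_of_lt ha, Nat.mod_eq_of_lt hb]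

theorem ICyc.ne0 {Cy : Finset V} {n : ℕ} {f : ZMod n → V} (h : ICyc G Cy n f) {a : ℕ} (h0 : 0 < a) (ha : a < n) :
    (a : ZMod n) ≠ 0 := by
  intro e
  have := (cast_inj' (n := n) (a := a) (b := 0) ha (by omega)).1 (by simpa using e)
  omega

theorem ICyc.card {Cy : Finset V} {n : ℕ} {f : ZMod n → V} (h : ICyc G Cy n f) : Cy.card = n := by
  have : NeZero n := ⟨by have := h.n4; omega⟩
  have e : Cy = Finset.univ.image f := by
    ext v; rw [h.mem]; simp
  rw [e, Finset.card_image_of_injective _ h.inj, Finset.card_univ, ZMod.card]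

def EX {n : ℕ} [NeZero n] (f : ZMod n → V) (X : Finset V) : Finset (ZMod n) :=
  Finset.univ.filter (fun i => f i ∈ X ∨ f (i - 1) ∈ X)

theorem cfg_bound {Cy : Finset V} {n : ℕ} [NeZero n] {f : ZMod n → V} (h : ICyc G Cy n f) {u : V} (hu : u ∈ Cy)
    {X : Finset V} {w : ℕ} (hc : Cfg G Cy {u} X w) : X ⊆ Cy →
    3 * w ≤ (EX f X).card + (if u ∈ X then 1 else 0) := by
  have h1 : (1 : ZMod n) ≠ 0 := by simpa using h.ne0 (a := 1) (by omega) (by have := h.n4; omega)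
  have h2 : (2 : ZMod n) ≠ 0 := by simpa using h.ne0 (a := 2) (by omega) (by have := h.n4; omega)
  induction hc with
  | nil X => intro _; simp
  | pt X v w hv hvA hc ih =>
    intro hX
    rw [Finset.mem_singleton] at hvA
    subst hvA
    have hsub : rm G X v ⊆ X := fun x hx => (mem_rm.1 hx).1
    have ih' := ih (hsub.trans hX)
    have hvn : v ∉ rm G X v := fun hx => (mem_rm.1 hx).2.1 rfl
    rw [if_neg hvn] at ih'
    rw [if_pos hv]
    obtain ⟨i, rfl⟩ := (h.mem v).1 (hX hv)
    have hs : insert i (insert (i + 1) (EX f (rm G X (f i)))) ⊆ EX f X := by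
      intro j hj
      simp only [EX, Finset.mem_insert, Finset.mem_filter, Finset.mem_univ, true_and] at hj ⊢
      rcases hj with rfl | rfl | hj | hj
      · exact Or.inl hv
      · right; simpa using hv
      · exact Or.inl (hsub hj)
      · exact Or.inr (hsub hj)
    have hcard := Finset.card_le_card hs
    rw [Finset.card_insert_of_notMem, Finset.card_insert_of_notMem] at hcard
    · omega
    · simp only [EX, Finset.mem_filter, Finset.mem_univ, true_and, not_or, mem_rm, h.adj]
      simp
    · simp only [EX, Finset.mem_insert, Finset.mem_filter, Finset.mem_univ, true_and, not_or, mem_rm, h.adj]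
      refine ⟨by simpa using h1, by simp, by simp⟩
  | ed X a b w ha hb hab hc ih =>
    intro hX
    have key : ∀ i : ZMod n, f i ∈ X → f (i + 1) ∈ X → ∀ Y : Finset V, Y ⊆ X →
        (∀ x ∈ Y, x ≠ f i ∧ x ≠ f (i + 1) ∧ ¬ G.Adj (f i) x ∧ ¬ G.Adj (f (i + 1)) x) →
        (3 * w ≤ (EX f Y).card + (if u ∈ Y then 1 else 0)) →
        3 * (w + 1) ≤ (EX f X).card + (if u ∈ X then 1 else 0) := by
      intro i hi hi1 Y hY hY' h3
      have hs : insert i (insert (i + 1) (insert (i + 2) (EX f Y))) ⊆ EX f X := by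
        intro j hj
        simp only [EX, Finset.mem_insert, Finset.mem_filter, Finset.mem_univ, true_and] at hj ⊢
        rcases hj with rfl | rfl | rfl | hj | hj
        · exact Or.inl hi
        · exact Or.inl hi1
        · right
          have : i + 2 - 1 = i + 1 := by ring
          rwa [this]
        · exact Or.inl (hY hj)
        · exact Or.inr (hY hj)
      have hcard := Finset.card_le_card hs
      have n1 : f i ∉ Y := fun h => (hY' _ h).1 rfl
      have n2 : f (i + 1) ∉ Y := fun h => (hY' _ h).2.1 rfl
      have n3 : f (i - 1) ∉ Y := fun h' => (hY' _ h').2.2.1 ((h.adj _ _).2 (by right; ring))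
      have n4 : f (i + 2) ∉ Y := fun h' => (hY' _ h').2.2.2 ((h.adj _ _).2 (by left; ring))
      rw [Finset.card_insert_of_notMem, Finset.card_insert_of_notMem, Finset.card_insert_of_notMem] at hcard
      · have : (if u ∈ Y then 1 else 0) ≤ (if u ∈ X then 1 else 0) := by
          split_ifs with e1 e2
          · omega
          · exact absurd (hY e1) e2
          · omega
          · omega
        omega
      · have : i + 2 - 1 = i + 1 := by ring
        simp [EX, n4, this, n2]
      · have : i + 1 ≠ i + 2 := by
          intro e; apply h1; linear_combination -e
        simp [EX, n1, n2, this]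
      · have e1 : i ≠ i + 2 := by
          intro e; apply h2; linear_combination -e
        simp [EX, n1, n3, e1, h1]
    have hsub : rm G (rm G X a) b ⊆ X := fun x hx => (mem_rm.1 (mem_rm.1 hx).1).1
    have ih' := ih (hsub.trans hX)
    obtain ⟨i, rfl⟩ := (h.mem a).1 (hX ha)
    obtain ⟨j, rfl⟩ := (h.mem b).1 (hX hb)
    have hpr : ∀ x ∈ rm G (rm G X (f i)) (f j), x ≠ f i ∧ x ≠ f j ∧ ¬ G.Adj (f i) x ∧ ¬ G.Adj (f j) x := by
      intro x hx
      rw [mem_rm, mem_rm] at hx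
      tauto
    rcases (h.adj i j).1 hab with rfl | rfl
    · exact key i ha hb _ hsub hpr ih'
    · refine key j hb ha _ hsub (fun x hx => ?_) ih'
      have := hpr x hx
      tauto
  | cy X w hCX hc ih =>
    intro hX
    have hXe : X = Cy := le_antisymm hX hCX
    subst hXe
    have hr : rmC G X X = ∅ := by
      ext x; rw [mem_rmC]; simp; tauto
    have ih' := ih (by rw [hr]; simp)
    rw [hr] at ih'
    simp [EX] at ih'
    have hE : EX f X = Finset.univ := by
      ext i
      have : f i ∈ X := (h.mem _).2 ⟨i, rfl⟩
      simp [EX, this]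
    rw [hE, if_pos hu, Finset.card_univ, ZMod.card, h.card]
    omega

theorem bd_single {Cy : Finset V} {n : ℕ} {f : ZMod n → V} (h : ICyc G Cy n f) {u : V} (hu : u ∈ Cy) {B : ℤ}
    (hB : (((n + 1) / 3 : ℕ) : ℤ) ≤ B) : Bd G Cy Cy {u} B := by
  have : NeZero n := ⟨by have := h.n4; omega⟩
  intro w hw
  have h1 := cfg_bound h hu hw le_rfl
  rw [if_pos hu] at h1
  have h2 : (EX f Cy).card ≤ n := by
    have := Finset.card_le_univ (EX f Cy)
    rwa [ZMod.card] at this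
  omega

theorem bd_Dn {Cy A : Finset V} {n : ℕ} {f : ZMod n → V} (h : ICyc G Cy n f) {B : ℤ}
    (hB : Bd G Cy Cy A B) : (((n + 1) / 3 : ℕ) : ℤ) ≤ B := by
  have := hB _ (Cfg.cy Cy 0 le_rfl (Cfg.nil _))
  rw [h.card] at this
  simpa using this

theorem IsP_map {h : ℕ → V} (k : ℕ) : ∀ a, (∀ i j, a ≤ i → i < j → j < a + k → h i ≠ h j ∧ (G.Adj (h i) (h j) ↔ j = i + 1)) →
    IsP G ((List.range' a k).map h) := by
  induction k with
  | zero => intro a _; simp [IsP]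
  | succ k ih =>
    intro a H
    rw [List.range'_succ, List.map_cons]
    refine ⟨?_, ?_, ih (a + 1) (fun i j h1 h2 h3 => H i j (by omega) h2 (by omega))⟩
    · simp only [List.mem_map, List.mem_range'_1, not_exists, not_and]
      intro x hx e
      exact (H a x le_rfl (by omega) (by omega)).1 e.symm
    · intro x hx
      simp only [List.mem_map, List.mem_range'_1] at hx
      obtain ⟨j, hj, rfl⟩ := hx
      rw [(H a j le_rfl (by omega) (by omega)).2]
      cases k with
      | zero => omega
      | succ k =>
        rw [List.range'_succ, List.map_cons, List.head?_cons, Option.some.injEq]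
        constructor
        · rintro rfl; rfl
        · intro e
          by_contra hne
          exact (H (a + 1) j (by omega) (by omega) (by omega)).1 e

theorem Run_map {T A : Finset V} {h : ℕ → V} (k : ℕ) : ∀ a, (∀ i, a ≤ i → i < a + k → h i ∈ T →
      h i ∈ A ∨ (i + 1 < a + k ∧ h (i + 1) ∈ T)) →
    Run T A ((List.range' a k).map h) := by
  induction k with
  | zero => intro a _; simp [Run]
  | succ k ih =>
    intro a H
    rw [List.range'_succ, List.map_cons]
    refine ⟨?_, ih (a + 1) (fun i h1 h2 h3 => ?_)⟩
    · intro ha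
      rcases H a le_rfl (by omega) ha with h1 | ⟨h1, h2⟩
      · exact Or.inl h1
      · refine Or.inr ⟨h (a + 1), ?_, h2⟩
        cases k with
        | zero => omega
        | succ k => rw [List.range'_succ, List.map_cons, List.head?_cons]
    · rcases H i (by omega) (by omega) h3 with h1 | ⟨h1, h2⟩
      · exact Or.inl h1
      · exact Or.inr ⟨by omega, h2⟩

/-- the path obtained by deleting `f y`. -/
def delPath {n : ℕ} (f : ZMod n → V) (y : ZMod n) : List V :=
  (List.range' 0 (n - 1)).map (fun i : ℕ => f (y - 1 - i))

theorem delPath_toFinset {Cy : Finset V} {n : ℕ} {f : ZMod n → V} (h : ICyc G Cy n f) (y : ZMod n) :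
    (delPath f y).toFinset = Cy.erase (f y) := by
  have hn := h.n4
  have : NeZero n := ⟨by omega⟩
  ext v
  simp only [delPath, List.mem_toFinset, List.mem_map, List.mem_range'_1, Finset.mem_erase, h.mem]
  constructor
  · rintro ⟨i, hi, rfl⟩
    refine ⟨fun e => ?_, _, rfl⟩
    have := h.inj e
    apply h.ne0 (a := i + 1) (by omega) (by omega)
    push_cast; linear_combination -this
  · rintro ⟨hne, i, rfl⟩
    refine ⟨(y - 1 - i).val, ⟨by omega, ?_⟩, ?_⟩
    · have h1 := ZMod.val_lt (y - 1 - i)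
      by_contra h2
      have h3 : (y - 1 - i).val = n - 1 := by omega
      have h4 : ((y - 1 - i).val : ZMod n) = y - 1 - i := ZMod.natCast_zmod_val _
      rw [h3, Nat.cast_sub (by omega)] at h4
      simp at h4
      apply hne
      congr 1
      linear_combination h4
    · rw [ZMod.natCast_zmod_val]; congr 1; ring

theorem delPath_IsP {Cy : Finset V} {n : ℕ} {f : ZMod n → V} (h : ICyc G Cy n f) (y : ZMod n) :
    IsP G (delPath f y) := by
  have hn := h.n4
  apply IsP_map
  intro i j _ hij hj
  refine ⟨fun e => ?_, ?_⟩
  · have := h.inj e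
    have h2 : (i : ZMod n) = j := by linear_combination -this
    rw [cast_inj' (by omega) (by omega)] at h2
    omega
  · rw [h.adj]
    constructor
    · rintro (e | e)
      · exfalso
        have h2 : (i : ZMod n) = (j + 1 : ℕ) := by push_cast; linear_combination e
        rw [cast_inj' (by omega) (by omega)] at h2
        omega
      · have h2 : (j : ZMod n) = (i + 1 : ℕ) := by push_cast; linear_combination e
        rw [cast_inj' (by omega) (by omega)] at h2
        omega
    · rintro rfl
      right; push_cast; ring

theorem delPath_Run {Cy T A : Finset V} {n : ℕ} {f : ZMod n → V} (h : ICyc G Cy n f) (y : ZMod n)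
    (hy : f y ∉ T) (hT : ∀ i, f i ∈ T → f i ∈ A ∨ f (i - 1) ∈ T) : Run T A (delPath f y) := by
  have hn := h.n4
  apply Run_map
  intro i _ hi hiT
  rcases hT _ hiT with h1 | h1
  · exact Or.inl h1
  right
  have e : y - 1 - (i : ZMod n) - 1 = y - 1 - ((i + 1 : ℕ) : ZMod n) := by push_cast; ring
  rw [e] at h1
  refine ⟨?_, h1⟩
  by_contra hc
  have h2 : i + 1 = n - 1 := by omega
  apply hy
  rw [h2, Nat.cast_sub (by omega)] at h1
  simpa using h1

theorem side_cyc {Cy T A : Finset V} {n : ℕ} {f : ZMod n → V} (h : ICyc G Cy n f) {s : ℕ} {B : ℤ}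
    (hAT : A ⊆ T) (hTC : T ⊆ Cy) (hT : ∀ i, f i ∈ T → f i ∈ A ∨ f (i - 1) ∈ T) (hB : Bd G Cy Cy A B)
    (hJ : ¬ J G Cy s (ind T)) : (1:ℤ) ≤ 2 * s - 1 + B - T.card := by
  obtain ⟨p, hp, hps, hind, hcard⟩ := not_J hTC hJ
  have : NeZero n := ⟨by have := h.n4; omega⟩
  have : Nonempty (ZMod n) := ⟨0⟩
  have h2 := hB _ (Cfg.points (P := A \ p) Finset.sdiff_subset
    ((Finset.sdiff_subset.trans hAT).trans hTC)
    (fun a ha b hb => hind a (Finset.sdiff_subset_sdiff hAT le_rfl ha) b (Finset.sdiff_subset_sdiff hAT le_rfl hb)))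
  have h3 : ((T \ p) \ (A \ p)).card ≤ (T ∩ p).card := by
    have hinv : ∀ i, Function.invFun f (f i) = i := fun i => Function.leftInverse_invFun h.inj i
    refine Finset.card_le_card_of_injOn (fun v => f (Function.invFun f v - 1)) ?_ ?_
    · intro v hv
      simp only [Finset.coe_sdiff, Set.mem_diff, Finset.mem_coe, not_and, not_not] at hv
      obtain ⟨⟨hvT, hvp⟩, hvA⟩ := hv
      obtain ⟨i, rfl⟩ := (h.mem v).1 (hTC hvT)
      simp only [hinv, Finset.coe_inter, Set.mem_inter_iff, Finset.mem_coe]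
      have h4 := (hT i hvT).resolve_left (fun hA => hvp (hvA hA))
      exact ⟨h4, (hp _ ((h.mem _).2 ⟨i, rfl⟩) _ ((h.mem _).2 ⟨i - 1, rfl⟩)
        ((h.adj _ _).2 (Or.inr (by ring)))).resolve_left hvp⟩
    · intro a ha b hb e
      simp only [Finset.coe_sdiff, Set.mem_diff, Finset.mem_coe] at ha hb
      obtain ⟨i, rfl⟩ := (h.mem a).1 (hTC ha.1.1)
      obtain ⟨j, rfl⟩ := (h.mem b).1 (hTC hb.1.1)
      simp only [hinv] at e
      have := h.inj e
      congr 1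
      linear_combination this
  have h4 := Finset.card_sdiff_add_card_eq_card (Finset.sdiff_subset_sdiff hAT (le_refl p))
  omega

def TJ {n : ℕ} (f : ZMod n → V) (A : Finset V) (i0 : ZMod n) (j : ℕ) : Finset V :=
  A ∪ (Finset.range j).image (fun i : ℕ => f (i0 + i))

theorem cyc_run {Cy A : Finset V} {n : ℕ} {f : ZMod n → V} (h : ICyc G Cy n f) {s : ℕ} {B : ℤ} {i0 : ZMod n}
    (hi0 : f i0 ∈ A) (hA : A ⊆ Cy) (hB : Bd G Cy Cy A B)
    (hK : QJ K G Cy s Cy (2 * s - 1 + B - n)) : ∀ (k j : ℕ), j + k = n →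
    QJ K G Cy s (TJ f A i0 j) (2 * s - 1 + B - (TJ f A i0 j).card) := by
  have hn := h.n4
  have : NeZero n := ⟨by omega⟩
  intro k
  induction k with
  | zero =>
    intro j hj
    have e : TJ f A i0 j = Cy := by
      ext v
      simp only [TJ, Finset.mem_union, Finset.mem_image, Finset.mem_range]
      constructor
      · rintro (h1 | ⟨i, _, rfl⟩)
        · exact hA h1
        · exact (h.mem _).2 ⟨_, rfl⟩
      · intro hv
        obtain ⟨i, rfl⟩ := (h.mem _).1 hv
        refine Or.inr ⟨(i - i0).val, ?_, ?_⟩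
        · have := ZMod.val_lt (i - i0); omega
        · rw [ZMod.natCast_zmod_val]; congr 1; ring
    rw [e, h.card]; exact hK
  | succ k ih =>
    intro j hj
    have ih' := ih (j + 1) (by omega)
    have e : TJ f A i0 (j + 1) = insert (f (i0 + j)) (TJ f A i0 j) := by
      simp [TJ, Finset.range_add_one, Finset.image_insert]
    rw [e] at ih'
    have hTC : TJ f A i0 j ⊆ Cy := by
      intro v
      simp only [TJ, Finset.mem_union, Finset.mem_image, Finset.mem_range]
      rintro (h1 | ⟨i, _, rfl⟩)
      · exact hA h1
      · exact (h.mem _).2 ⟨_, rfl⟩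
    have hAT : A ⊆ TJ f A i0 j := Finset.subset_union_left
    have hR : ∀ i, f i ∈ TJ f A i0 j → f i ∈ A ∨ f (i - 1) ∈ TJ f A i0 j := by
      intro i hi
      simp only [TJ, Finset.mem_union, Finset.mem_image, Finset.mem_range] at hi ⊢
      rcases hi with hi | ⟨l, hl, e⟩
      · exact Or.inl hi
      · have := h.inj e
        subst this
        cases l with
        | zero => left; simpa using hi0
        | succ l =>
          right; right
          refine ⟨l, by omega, ?_⟩
          congr 1; push_cast; ring
    by_cases hy : f (i0 + j) ∈ TJ f A i0 j
    · rwa [Finset.insert_eq_self.2 hy] at ih'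
    · refine QJ.ask hy (side_cyc h hAT hTC hR hB) ?_ ?_
      · refine QJ.mono ih' ?_
        rw [Finset.card_insert_of_notMem hy]; push_cast; omega
      · rw [← delPath_toFinset h]
        refine pathrun (Cy := Cy) s _ _ rfl (delPath_IsP h _) _ A B (delPath_Run h _ hy hR) hAT ?_ ?_
        · rw [delPath_toFinset h]
          intro x hx
          exact Finset.mem_erase.2 ⟨by rintro rfl; exact hy hx, hTC hx⟩
        · rw [delPath_toFinset h]
          exact hB.mono (Finset.erase_subset _ _) (fun _ _ h => h)

/-- from the all-colon'd case to arbitrary `A`. -/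
theorem cyc_all {Cy A : Finset V} {n : ℕ} {f : ZMod n → V} (h : ICyc G Cy n f) {s : ℕ} (hs : 1 ≤ s) {B : ℤ}
    (hA : A ⊆ Cy) (hB : Bd G Cy Cy A B)
    (hK : QJ K G Cy s Cy (2 * s - 1 + B - n)) : QJ K G Cy s A (2 * s - 1 + B - A.card) := by
  have hn := h.n4
  rcases A.eq_empty_or_nonempty with rfl | ⟨u, hu⟩
  · have hD := bd_Dn h hB
    have h0 : f 0 ∈ Cy := (h.mem _).2 ⟨_, rfl⟩
    refine QJ.ask (x := f 0) (by simp) (fun _ => by simp; omega) ?_ ?_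
    · have := cyc_run (K := K) h (A := {f 0}) (i0 := 0) (by simp) (by simpa using h0) (bd_single h h0 hD) hK n 0 (by omega)
      simp [TJ] at this ⊢
      exact this
    · rw [← delPath_toFinset h]
      refine pathrun (Cy := Cy) s _ _ rfl (delPath_IsP h _) _ ∅ B (delPath_Run h _ (by simp) (by simp)) (by simp) (by simp) ?_
      rw [delPath_toFinset h]
      exact hB.mono (Finset.erase_subset _ _) (fun _ _ h => h)
  · obtain ⟨i, rfl⟩ := (h.mem u).1 (hA hu)
    have := cyc_run (K := K) h hu hA hB hK n 0 (by omega)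
    simpa [TJ] using this

end ER

namespace ER

open scoped Classical

variable {V K : Type} [Field K] {G : SimpleGraph V}

/-- truncation for predicates depending only on the variables in `U` -/
theorem R.truncU {H Q : (V →₀ ℕ) → Prop} {d : ℤ} (U : Finset V) (hU : ∀ m v, v ∉ U → (Q (m.erase v) ↔ Q m))
    (h : R K H d) (h1 : ∀ m, H m → Q m)
    (h2 : ∀ m : V →₀ ℕ, m.support ⊆ U → d < (m.degree : ℤ) → Q m → H m) : R K Q d := by
  intro a i hi c hc hbd
  by_cases haU : a.support ⊆ U
  · obtain ⟨b, hb, hb'⟩ := h a i hi c (by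
      intro σ hσ
      obtain ⟨e1, e2, e3⟩ := hc σ hσ
      refine ⟨e1, e2, h2 _ ?_ ?_ e3⟩
      · intro v hv
        apply haU
        simp only [Finsupp.mem_support_iff, Finsupp.coe_tsub, Pi.sub_apply] at hv ⊢
        omega
      have := congrArg Finsupp.degree (tsub_add_cancel_of_le (ind_le e1))
      rw [map_add, degree_ind, e2] at this
      omega) hbd
    exact ⟨b, hb.imp h1, hb'⟩
  · obtain ⟨v, hv, hvU⟩ := Finset.not_subset.1 haU
    refine ⟨op v c, ?_, ?_⟩
    · intro σ hσ
      unfold op at hσ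
      split_ifs at hσ with h
      · obtain ⟨h1, h2, h3⟩ := hc _ (right_ne_zero_of_mul hσ)
        refine ⟨?_, ?_, ?_⟩
        · intro u hu
          by_cases huv : u = v
          · subst huv; exact hv
          · exact h1 (by simp [huv, hu])
        · rw [Finset.card_erase_of_mem h] at h2
          have := Finset.card_pos.2 ⟨v, h⟩
          omega
        · rw [← hU _ v hvU] at h3 ⊢
          convert h3 using 1
          ext x
          by_cases hx : x = v
          · subst hx; simp
          · simp [Finsupp.erase_ne hx, ind_apply, hx]
      · simp at hσ
    · rw [bd_op _ _ hv, hbd]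
      funext τ; simp [op]

/-- path covers of `0..N` -/
def PC (a N : ℕ) (q : ℕ → Prop) : Prop := ∀ i, a ≤ i → i < N → q i ∨ q (i + 1)

def wt (a k : ℕ) (W : ℕ → ℕ) (q : ℕ → Prop) : ℕ := ∑ i ∈ Finset.range k, if q (a + i) then W (a + i) else 0

def tv (p0 q0 p1 q1 : ℤ) (x y : Prop) : ℤ := if x then (if y then q1 else q0) else (if y then p1 else p0)

theorem Sat_sem (g : ℕ → V) (w : V →₀ ℕ) (N : ℕ) : ∀ (k a : ℕ), a + k = N → ∀ p0 q0 p1 q1 : ℤ,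
    Sat (g N) ((List.range' a k).map g) p0 q0 p1 q1 w ↔ ∀ q : ℕ → Prop, PC a N q →
      tv p0 q0 p1 q1 (q a) (q N) ≤ wt a (k + 1) (fun i => w (g i)) q := by
  intro k
  induction k with
  | zero =>
    intro a ha p0 q0 p1 q1
    have : a = N := by omega
    subst this
    simp only [List.range'_zero, List.map_nil, Sat, PC, wt, tv]
    constructor
    · rintro ⟨h1, h2⟩ q _
      by_cases h : q a <;> simp [h, h1, h2]
    · intro h
      constructor
      · simpa using h (fun _ => False) (by intros; omega)
      · simpa using h (fun _ => True) (by intros; omega)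
  | succ k ih =>
    intro a ha p0 q0 p1 q1
    rw [List.range'_succ, List.map_cons]
    simp only [Sat]
    rw [ih (a + 1) (by omega)]
    have hw : ∀ q, wt a (k + 1 + 1) (fun i => w (g i)) q = (if q a then w (g a) else 0) + wt (a + 1) (k + 1) (fun i => w (g i)) q := by
      intro q
      unfold wt
      rw [Finset.sum_range_succ', add_comm]
      congr 1
      apply Finset.sum_congr rfl
      intro i _
      rw [show a + (i + 1) = a + 1 + i by omega]
    constructor
    · intro h q hq
      have h1 := h q (fun i h1 h2 => hq i (by omega) h2)
      have h2 := hq a le_rfl (by omega)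
      rw [hw]
      by_cases ha : q a <;> by_cases hb : q (a + 1) <;> by_cases hN : q N <;>
        simp [ha, hb, hN, tv] at h1 h2 ⊢ <;> omega
    · intro h q hq
      have hx : ∀ x : Prop, (x ∨ q (a + 1)) → tv p0 q0 p1 q1 x (q N) ≤ (if x then (w (g a) : ℤ) else 0) + wt (a + 1) (k + 1) (fun i => w (g i)) q := by
        intro x hx
        have h1 := h (fun i => if i = a then x else q i) (by
          intro i hi1 hi2
          by_cases hi : i = a
          · subst hi; simpa using hx
          · have : i + 1 ≠ a := by omega
            simpa [hi, this] using hq i (by omega) hi2)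
        rw [hw] at h1
        have e : wt (a + 1) (k + 1) (fun i => w (g i)) (fun i => if i = a then x else q i) = wt (a + 1) (k + 1) (fun i => w (g i)) q := by
          unfold wt
          apply Finset.sum_congr rfl
          intro i _
          have : a + 1 + i ≠ a := by omega
          simp [this]
        rw [e] at h1
        have : N ≠ a := by omega
        simp [this] at h1
        exact h1
      have h1 := hx True (by simp)
      by_cases hb : q (a + 1)
      · have h2 := hx False (by simp [hb])
        by_cases hN : q N <;> simp [hb, hN, tv] at h1 h2 ⊢ <;> omega
      · by_cases hN : q N <;> simp [hb, hN, tv] at h1 ⊢ <;> omega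

theorem uncross {N s : ℕ} {W : ℕ → ℕ} {p q : ℕ → Prop}
    (hK : ∀ q, PC 0 N q → (q 0 ∨ q N) → s ≤ wt 0 (N + 1) W q)
    (hq : PC 0 N q) (hq0 : ¬ q 0) (hqN : ¬ q N) (hqs : wt 0 (N + 1) W q < s)
    (hp : PC 0 N p) (hp0 : p 0) (hpN : p N) (hps : wt 0 (N + 1) W p ≤ s)
    (htot : 2 * s ≤ ∑ i ∈ Finset.range (N + 1), W i) : False := by
  by_cases hk : ∃ k ≤ N, p k ∧ q k
  · obtain ⟨k, hkN, hpk, hqk⟩ := hk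
    have hkN' : k ≠ N := by rintro rfl; exact hqN hqk
    have h1 := hK (fun i => if i ≤ k then p i else q i) (by
      intro i h1 h2
      by_cases h3 : i + 1 ≤ k
      · have : i ≤ k := by omega
        simpa [h3, this] using hp i h1 h2
      · by_cases h4 : i ≤ k
        · have : i = k := by omega
          subst this; simp [hpk]
        · simpa [h3, h4] using hq i h1 h2) (by simp [hp0])
    have h2 := hK (fun i => if i ≤ k then q i else p i) (by
      intro i h1 h2
      by_cases h3 : i + 1 ≤ k
      · have : i ≤ k := by omega
        simpa [h3, this] using hq i h1 h2
      · by_cases h4 : i ≤ k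
        · have : i = k := by omega
          subst this; simp [hqk]
        · simpa [h3, h4] using hp i h1 h2) (by
      right
      have : ¬ N ≤ k := by omega
      simp [hpN, this])
    have h3 : wt 0 (N + 1) W (fun i => if i ≤ k then p i else q i) + wt 0 (N + 1) W (fun i => if i ≤ k then q i else p i)
        = wt 0 (N + 1) W p + wt 0 (N + 1) W q := by
      unfold wt
      rw [← Finset.sum_add_distrib, ← Finset.sum_add_distrib]
      apply Finset.sum_congr rfl
      intro i _
      rw [zero_add]
      by_cases h : i ≤ k
      · simp [h]
      · simp [h]; omega
    omega
  · push Not at hk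
    have : ∑ i ∈ Finset.range (N + 1), W i ≤ wt 0 (N + 1) W p + wt 0 (N + 1) W q := by
      unfold wt
      rw [← Finset.sum_add_distrib]
      apply Finset.sum_le_sum
      intro i hi
      rw [Finset.mem_range] at hi
      rw [zero_add]
      by_cases h1 : p i
      · simp [h1]
      · by_cases h2 : q i
        · simp [h2]
        · exfalso
          cases i with
          | zero => exact h1 hp0
          | succ i =>
            exact hk i (by omega) ((hp i (by omega) (by omega)).resolve_right h1) ((hq i (by omega) (by omega)).resolve_right h2)
    omega

variable {Cy : Finset V} {n : ℕ} {f : ZMod n → V}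

theorem cyc_sum (h : ICyc G Cy n f) (p : Finset V) (w : V →₀ ℕ) :
    ∑ v ∈ Cy ∩ p, w v = wt 0 n (fun i => w (f i)) (fun i => f i ∈ p) := by
  have hn := h.n4
  have : NeZero n := ⟨by omega⟩
  have e : Cy = (Finset.range n).image (fun i : ℕ => f i) := by
    ext v
    rw [h.mem]
    simp only [Finset.mem_image, Finset.mem_range]
    constructor
    · rintro ⟨i, rfl⟩
      exact ⟨i.val, ZMod.val_lt i, by rw [ZMod.natCast_zmod_val]⟩
    · rintro ⟨i, _, rfl⟩; exact ⟨_, rfl⟩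
  unfold wt
  rw [← Finset.filter_mem_eq_inter, Finset.sum_filter, e, Finset.sum_image]
  · simp
  · intro i hi j hj hij
    simp only [Finset.coe_range, Set.mem_Iio] at hi hj
    exact (cast_inj' hi hj).1 (h.inj hij)

theorem J_sem {N : ℕ} {f' : ZMod (N + 1) → V} (h : ICyc G Cy (N + 1) f') (s : ℕ) (w : V →₀ ℕ) : J G Cy s w ↔
    ∀ q : ℕ → Prop, PC 0 N q → (q 0 ∨ q N) → s ≤ wt 0 (N + 1) (fun i => w (f' i)) q := by
  have hn := h.n4
  have hNe : ((N : ℕ) : ZMod (N + 1)) + 1 = 0 := by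
    have := ZMod.natCast_self (N + 1)
    push_cast at this; exact this
  constructor
  · intro hJ q hq hq0
    have h1 := hJ (((Finset.range (N + 1)).filter q).image (fun i : ℕ => f' i)) (by
      have key : ∀ a : ZMod (N + 1), f' a ∈ (((Finset.range (N + 1)).filter q).image (fun i : ℕ => f' i)) ∨
         f' (a + 1) ∈ (((Finset.range (N + 1)).filter q).image (fun i : ℕ => f' i)) := by
        intro a
        simp only [Finset.mem_image, Finset.mem_filter, Finset.mem_range]
        have ha := ZMod.val_lt a
        have ha' := ZMod.natCast_zmod_val a
        by_cases hN : a.val = N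
        · rcases hq0 with h0 | h0
          · right
            refine ⟨0, ⟨by omega, h0⟩, ?_⟩
            rw [← ha', hN, hNe]; simp
          · left
            refine ⟨N, ⟨by omega, h0⟩, ?_⟩
            rw [hN] at ha'
            rw [ha']
        · rcases hq a.val (by omega) (by omega) with h0 | h0
          · left
            exact ⟨a.val, ⟨by omega, h0⟩, by rw [ha']⟩
          · right
            exact ⟨a.val + 1, ⟨by omega, h0⟩, by push_cast; rw [ha']⟩
      intro u hu v hv huv
      obtain ⟨a, rfl⟩ := (h.mem _).1 hu
      obtain ⟨b, rfl⟩ := (h.mem _).1 hv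
      rcases (h.adj _ _).1 huv with rfl | rfl
      · exact key a
      · exact (key b).symm)
    rw [cyc_sum h] at h1
    refine h1.trans (le_of_eq ?_)
    unfold wt
    apply Finset.sum_congr rfl
    intro i hi
    rw [Finset.mem_range] at hi
    have : f' ((0 + i : ℕ) : ZMod (N + 1)) ∈ (((Finset.range (N + 1)).filter q).image (fun i : ℕ => f' i)) ↔ q (0 + i) := by
      rw [zero_add]
      simp only [Finset.mem_image, Finset.mem_filter, Finset.mem_range]
      constructor
      · rintro ⟨j, ⟨hj, hqj⟩, e⟩
        have := (cast_inj' hj hi).1 (h.inj e)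
        rwa [← this]
      · intro hqi; exact ⟨i, ⟨hi, hqi⟩, rfl⟩
    simp only [this]
  · intro hJ p hp
    rw [cyc_sum h]
    have hm : ∀ a, f' a ∈ Cy := fun a => (h.mem _).2 ⟨a, rfl⟩
    apply hJ
    · intro i _ hi
      exact hp _ (hm _) _ (hm _) ((h.adj _ _).2 (Or.inl (by push_cast; ring)))
    · exact (hp _ (hm _) _ (hm _) ((h.adj (N : ℕ) (0 : ℕ)).2 (Or.inl (by push_cast; rw [hNe])))).symm

theorem wt_split {N : ℕ} (hN : N ≠ 0) {W W' : ℕ → ℕ} {q : ℕ → Prop}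
    (hW : ∀ i, i ≤ N → W i = W' i + if i = 0 ∨ i = N then 1 else 0) :
    wt 0 (N + 1) W q = wt 0 (N + 1) W' q + (if q 0 then 1 else 0) + (if q N then 1 else 0) := by
  have e1 : (if q 0 then 1 else 0) = ∑ i ∈ Finset.range (N + 1), (if i = 0 then (if q 0 then 1 else 0) else 0) := by
    rw [Finset.sum_ite_eq']; simp
  have e2 : (if q N then 1 else 0) = ∑ i ∈ Finset.range (N + 1), (if i = N then (if q N then 1 else 0) else 0) := by
    rw [Finset.sum_ite_eq']; simp
  rw [e1, e2]
  unfold wt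
  rw [← Finset.sum_add_distrib, ← Finset.sum_add_distrib]
  apply Finset.sum_congr rfl
  intro i hi
  rw [Finset.mem_range] at hi
  rw [zero_add, hW i (by omega)]
  by_cases h0 : i = 0
  · subst h0
    have : (0 : ℕ) ≠ N := hN.symm
    by_cases hq : q 0 <;> simp [hq, this]
  · by_cases hi : i = N
    · subst hi
      by_cases hq : q i <;> simp [hq, hN]
    · by_cases hq : q i <;> simp [hq, h0, hi]

theorem cyc_J_dep (T : Finset V) (s : ℕ) (m : V →₀ ℕ) (v : V) (hv : v ∉ Cy) :
    J G Cy s (ind T + m.erase v) ↔ J G Cy s (ind T + m) := by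
  have : ∀ p, ∑ x ∈ Cy ∩ p, (ind T + m.erase v) x = ∑ x ∈ Cy ∩ p, (ind T + m) x := by
    intro p
    apply Finset.sum_congr rfl
    intro x hx
    have : x ≠ v := by rintro rfl; exact hv (Finset.mem_inter.1 hx).1
    simp [Finsupp.erase_ne this]
  unfold J
  simp only [this]

theorem Ks5 {N : ℕ} {f : ZMod (N + 1) → V} (h : ICyc G Cy (N + 1) f) (hN : 5 ≤ N + 1) {s : ℕ} (hs : 1 ≤ s)
    (hK : QJ K G Cy (s - 1) Cy (2 * (s - 1 : ℕ) - 1 + ((N + 1 + 1) / 3 : ℕ) - (N + 1 : ℕ))) {B : ℤ}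
    (hB : ((N + 1 + 1) / 3 : ℕ) ≤ B) : QJ K G Cy s Cy (2 * s - 1 + B - (N + 1 : ℕ)) := by
  have hcard := h.card
  have hmemC : ∀ a, f a ∈ Cy := fun a => (h.mem _).2 ⟨a, rfl⟩
  set g : ℕ → V := fun i => f i with hg
  have ginj : ∀ i j, i ≤ N → j ≤ N → g i = g j → i = j := by
    intro i j hi hj hij
    exact (cast_inj' (by omega) (by omega)).1 (h.inj hij)
  set L := (List.range' 0 N).map g with hL
  have hTZ : TZ (g N) L = Cy := by
    ext v
    rw [mem_TZ, h.mem]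
    simp only [hL, List.mem_map, List.mem_range'_1]
    constructor
    · rintro (rfl | ⟨i, _, rfl⟩) <;> exact ⟨_, rfl⟩
    · rintro ⟨i, rfl⟩
      have h1 := ZMod.val_lt i
      have h2 := ZMod.natCast_zmod_val i
      by_cases h3 : i.val = N
      · left; rw [h3] at h2; simp only [hg]; rw [h2]
      · right; exact ⟨i.val, by omega, by simp only [hg]; rw [h2]⟩
  have hND : ND (g N) L := by
    constructor
    · rw [hL]
      refine List.Nodup.map_on ?_ List.nodup_range'
      intro i hi j hj
      simp only [List.mem_range'_1] at hi hj
      exact ginj i j (by omega) (by omega)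
    · simp only [hL, List.mem_map, List.mem_range'_1, not_exists, not_and]
      intro i hi e
      have := ginj _ _ (by omega) (by omega) e
      omega
  have hLlen : L.length = N := by simp [hL]
  have hLcons : ∃ a L', L = a :: L' := by
    refine ⟨g 0, (List.range' 1 (N - 1)).map g, ?_⟩
    rw [hL]
    obtain ⟨k, rfl⟩ : ∃ k, N = k + 1 := ⟨N - 1, by omega⟩
    simp [List.range'_succ]
  -- the three pieces
  have hNN := caseN (K := K) hND s
  have hYY : FA K (g N) L s s s (s + 1) (2 * s + 2) := by
    obtain ⟨a, L', e⟩ := hLcons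
    rw [e] at hND ⊢
    exact caseY hND s
  unfold FA QS at hNN hYY
  rw [hTZ, hLlen] at hNN hYY
  have hMM := cyc_run (K := K) h (A := {f 1}) (i0 := 1) (by simp) (by simpa using hmemC 1)
    (bd_single h (hmemC 1) le_rfl) hK 2 (N - 1) (by omega)
  have hT2 : TJ f {f 1} 1 (N - 1) = (Cy.erase (g 0)).erase (g N) := by
    ext v
    simp only [TJ, Finset.mem_union, Finset.mem_image, Finset.mem_range, Finset.mem_erase, Finset.mem_singleton, h.mem]
    have e1 : ∀ i : ℕ, f (1 + i) = g (i + 1) := by intro i; simp only [hg]; congr 1; push_cast; ring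
    constructor
    · rintro (rfl | ⟨i, hi, rfl⟩)
      · have : f 1 = g 1 := by simp [hg]
        refine ⟨?_, ?_, _, rfl⟩ <;> rw [this] <;> intro e <;> have := ginj _ _ (by omega) (by omega) e <;> omega
      · refine ⟨?_, ?_, _, rfl⟩ <;> rw [e1] <;> intro e <;> have := ginj _ _ (by omega) (by omega) e <;> omega
    · rintro ⟨h1, h2, i, rfl⟩
      have h3 := ZMod.val_lt i
      have h4 : f i = g i.val := by simp only [hg]; rw [ZMod.natCast_zmod_val i]
      have h5 : i.val ≠ 0 := by intro e; apply h2; rw [h4, e]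
      have h6 : i.val ≠ N := by intro e; apply h1; rw [h4, e]
      right
      exact ⟨i.val - 1, by omega, by rw [e1, h4]; congr 1; omega⟩
  have h0N : g N ≠ g 0 := by intro e; have := ginj _ _ (by omega) (by omega) e; omega
  have hT2c : (TJ f {f 1} 1 (N - 1)).card = N - 1 := by
    rw [hT2, Finset.card_erase_of_mem (Finset.mem_erase.2 ⟨h0N, hmemC _⟩), Finset.card_erase_of_mem (hmemC _), hcard]; omega
  rw [hT2c, hT2] at hMM
  -- semantics
  set W : (V →₀ ℕ) → ℕ → ℕ := fun m i => (ind Cy + m) (f i) with hWd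
  have hWW : ∀ (m : V →₀ ℕ) (q : ℕ → Prop), wt 0 (N + 1) (W m) q =
      wt 0 (N + 1) (fun i => (ind ((Cy.erase (g 0)).erase (g N)) + m) (f i)) q + (if q 0 then 1 else 0) + (if q N then 1 else 0) := by
    intro m q
    apply wt_split (by omega)
    intro i hi
    simp only [hWd, Finsupp.add_apply, ind_apply, Finset.mem_erase, hmemC, if_true]
    have e0 : f i = g 0 ↔ i = 0 := ⟨fun e => ginj i 0 hi (by omega) e, fun e => by rw [e]⟩
    have eN : f i = g N ↔ i = N := ⟨fun e => ginj i N hi (by omega) e, fun e => by rw [e]⟩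
    simp only [ne_eq, e0, eN]
    by_cases h1 : i = 0 <;> by_cases h2 : i = N <;> simp [h1, h2] <;> omega
  have semK : ∀ m, J G Cy s (ind Cy + m) ↔ ∀ q : ℕ → Prop, PC 0 N q → (q 0 ∨ q N) → s ≤ wt 0 (N + 1) (W m) q :=
    fun m => J_sem h s _
  have semN : ∀ m, Sat (g N) L s s s s (ind Cy + m) ↔ ∀ q : ℕ → Prop, PC 0 N q → s ≤ wt 0 (N + 1) (W m) q := by
    intro m
    rw [hL, Sat_sem g _ N N 0 (by omega)]
    simp only [tv, ite_self, Nat.cast_le]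
    rfl
  have semY : ∀ m, Sat (g N) L s s s (s + 1) (ind Cy + m) ↔ ∀ q : ℕ → Prop, PC 0 N q →
      s + (if q 0 ∧ q N then 1 else 0) ≤ wt 0 (N + 1) (W m) q := by
    intro m
    rw [hL, Sat_sem g _ N N 0 (by omega)]
    refine forall_congr' fun q => forall_congr' fun _ => ?_
    change _ ≤ ((wt 0 (N + 1) (W m) q : ℕ) : ℤ) ↔ _
    by_cases h1 : q 0 <;> by_cases h2 : q N <;> simp [tv, h1, h2]
  have semM : ∀ m, J G Cy (s - 1) (ind ((Cy.erase (g 0)).erase (g N)) + m) ↔ ∀ q : ℕ → Prop, PC 0 N q →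
      (q 0 ∨ q N) → s + (if q 0 ∧ q N then 1 else 0) ≤ wt 0 (N + 1) (W m) q := by
    intro m
    rw [J_sem h]
    refine forall_congr' fun q => forall_congr' fun _ => forall_congr' fun h0 => ?_
    rw [hWW]
    by_cases h1 : q 0 <;> by_cases h2 : q N <;> simp [h1, h2] at h0 ⊢ <;> omega
  have eY : ∀ m, (Sat (g N) L s s s s (ind Cy + m) ∧ J G Cy (s - 1) (ind ((Cy.erase (g 0)).erase (g N)) + m)) ↔
      Sat (g N) L s s s (s + 1) (ind Cy + m) := by
    intro m
    rw [semN, semM, semY]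
    constructor
    · rintro ⟨h1, h2⟩ q hq
      by_cases h0 : q 0 ∨ q N
      · exact h2 q hq h0
      · have : ¬ (q 0 ∧ q N) := by tauto
        simpa [this] using h1 q hq
    · intro h1
      exact ⟨fun q hq => by have := h1 q hq; omega, fun q hq _ => h1 q hq⟩
  have hHK : ∀ m, (Sat (g N) L s s s s (ind Cy + m) ∨ J G Cy (s - 1) (ind ((Cy.erase (g 0)).erase (g N)) + m)) →
      J G Cy s (ind Cy + m) := by
    intro m hm
    rw [semK]
    rw [semN, semM] at hm
    intro q hq h0
    rcases hm with hm | hm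
    · exact hm q hq
    · have := hm q hq h0; omega
  unfold QJ QR
  rcases hNN with hNN | hNN
  · exact Or.inl fun m => hHK m (Or.inl (hNN m))
  rcases hMM with hMM | hMM
  · exact Or.inl fun m => hHK m (Or.inr (hMM m))
  rcases hYY with hYY | hYY
  · exact Or.inl fun m => hHK m (Or.inl ((eY m).2 (hYY m)).1)
  right
  have hB2 : 2 ≤ B := by omega
  have hH := R.master (A := fun m => Sat (g N) L s s s s (ind Cy + m))
    (B := fun m => J G Cy (s - 1) (ind ((Cy.erase (g 0)).erase (g N)) + m)) (d := 2 * s - 1 + B - (N + 1 : ℕ)) Sat_up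
    (fun m m' h => J_up Cy _ _ _ (by gcongr)) (hNN.mono (by push_cast; omega)) (hMM.mono (by push_cast; omega))
    ((hYY.congr fun m => (eY m).symm).mono (by push_cast; omega))
  refine R.truncU Cy (fun m v hv => cyc_J_dep _ _ _ _ hv) hH hHK ?_
  intro m hmU hdeg hm
  by_contra hcon
  rw [not_or, semN, semM] at hcon
  rw [semK] at hm
  obtain ⟨hc1, hc2⟩ := hcon
  push Not at hc1 hc2
  obtain ⟨q, hq, hqs⟩ := hc1
  obtain ⟨p, hp, hp0, hps⟩ := hc2
  have hq0 : ¬ (q 0 ∨ q N) := fun h' => by have := hm q hq h'; omega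
  push Not at hq0
  have hpb : p 0 ∧ p N := by
    by_contra h'
    have := hm p hp hp0
    simp only [h', if_false] at hps
    omega
  simp only [hpb, and_self, if_true] at hps
  refine uncross hm hq hq0.1 hq0.2 hqs hp hpb.1 hpb.2 (by omega) ?_
  have e1 : ∑ i ∈ Finset.range (N + 1), W m i = ∑ v ∈ Cy ∩ Cy, (ind Cy + m) v := by
    rw [cyc_sum h]
    unfold wt
    apply Finset.sum_congr rfl
    intro i _
    simp [hmemC, hWd]
  rw [e1, sum_ind_add, Finset.inter_self, Finset.inter_self, hcard]
  have e2 : ∑ v ∈ Cy, m v = m.degree := by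
    rw [Finsupp.degree_apply]
    symm
    apply Finset.sum_subset hmU
    intro v _ hv
    simpa using hv
  rw [e2]
  push_cast at hdeg
  omega

theorem QJ_zero {X T : Finset V} {D : ℤ} : QJ K G X 0 T D := Or.inl fun _ _ _ => Nat.zero_le _

theorem Ks4 {f : ZMod (3 + 1) → V} (h : ICyc G Cy (3 + 1) f) {s : ℕ} (hs : 1 ≤ s)
    {B : ℤ} (hK : QJ K G Cy (s - 2) Cy (2 * (s - 2 : ℕ) - 1 + B - (3 + 1 : ℕ)))
    (hB : 1 ≤ B) : QJ K G Cy s Cy (2 * s - 1 + B - (3 + 1 : ℕ)) := by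
  have hmemC : ∀ a, f a ∈ Cy := fun a => (h.mem _).2 ⟨a, rfl⟩
  have e : ∀ m, J G Cy (s - 2) (ind ∅ + m) ↔ J G Cy s (ind Cy + m) := by
    intro m
    rw [J_sem h, J_sem h]
    simp only [wt, Finset.sum_range_succ, Finset.sum_range_zero, Finsupp.add_apply, ind_apply, hmemC, if_true,
      Finset.notMem_empty, if_false, zero_add]
    constructor
    · intro h1 q hq h0
      have h2 := h1 q hq h0
      have e1 := hq 0 (by omega) (by omega)
      have e2 := hq 1 (by omega) (by omega)
      have e3 := hq 2 (by omega) (by omega)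
      by_cases a0 : q 0 <;> by_cases a1 : q 1 <;> by_cases a2 : q 2 <;> by_cases a3 : q 3 <;>
        simp [a0, a1, a2, a3] at h2 e1 e2 e3 h0 ⊢ <;> omega
    · intro h1 q hq h0
      have h2 := h1 (fun i => i = 0 ∨ i = 2) (by intro i _ hi; omega) (by simp)
      have h3 := h1 (fun i => i = 1 ∨ i = 3) (by intro i _ hi; omega) (by simp)
      have e1 := hq 0 (by omega) (by omega)
      have e2 := hq 1 (by omega) (by omega)
      have e3 := hq 2 (by omega) (by omega)
      simp at h2 h3
      by_cases a0 : q 0 <;> by_cases a1 : q 1 <;> by_cases a2 : q 2 <;> by_cases a3 : q 3 <;>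
        simp [a0, a1, a2, a3] at e1 e2 e3 h0 ⊢ <;> omega
  have hc : QJ K G Cy (s - 2) ∅ (2 * s - 1 + B - (3 + 1 : ℕ)) := by
    by_cases h2 : s ≤ 2
    · have : s - 2 = 0 := by omega
      rw [this]; exact QJ_zero
    · have := cyc_all h (A := ∅) (by omega) (by simp) ((bd_single h (hmemC 0) (by norm_num; exact hB)).mono subset_rfl (by simp)) hK
      refine QJ.mono this ?_
      simp; omega
  exact QR.congr hc e

theorem Ks {n : ℕ} {f : ZMod n → V} (h : ICyc G Cy n f) (s : ℕ) : ∀ {B : ℤ}, ((n + 1) / 3 : ℕ) ≤ B →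
    QJ K G Cy s Cy (2 * s - 1 + B - n) := by
  induction s using Nat.strong_induction_on with
  | _ s ih =>
    intro B hB
    rcases Nat.eq_zero_or_pos s with rfl | hs
    · exact QJ_zero
    have hn := h.n4
    obtain ⟨N, rfl⟩ : ∃ N, n = N + 1 := ⟨n - 1, by omega⟩
    by_cases h4 : N = 3
    · subst h4
      refine Ks4 h hs (ih _ (by omega) hB) ?_
      norm_num at hB; omega
    · exact Ks5 h (by omega) hs (ih _ (by omega) le_rfl) hB

theorem cyc_step {n : ℕ} {f : ZMod n → V} (h : ICyc G Cy n f) {s : ℕ} (hs : 1 ≤ s) {A : Finset V} {B : ℤ}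
    (hA : A ⊆ Cy) (hB : Bd G Cy Cy A B) : QJ K G Cy s A (2 * s - 1 + B - A.card) :=
  cyc_all h hs hA hB (Ks h s (bd_Dn h hB))

end ER

namespace ER

open scoped Classical

variable {V K : Type} [Field K]

section kd
variable [Fintype V] {W W' : Type} [AddCommGroup W] [Module (MvPolynomial V K) W] [AddCommGroup W'] [Module (MvPolynomial V K) W']

def kd (c : Finset V → W) (τ : Finset V) : W :=
  ∑ v ∈ Finset.univ \ τ, (C (sgn K v τ) * X v : MvPolynomial V K) • c (insert v τ)

theorem kd_add (c c' : Finset V → W) : kd (K := K) (c + c') = kd (K := K) c + kd (K := K) c' := by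
  funext τ; simp [kd, Finset.sum_add_distrib]

theorem kd_sub (c c' : Finset V → W) : kd (K := K) (c - c') = kd (K := K) c - kd (K := K) c' := by
  funext τ; simp [kd, smul_sub]

theorem kd_map (f : W →ₗ[MvPolynomial V K] W') (c : Finset V → W) :
    kd (K := K) (fun σ => f (c σ)) = fun τ => f (kd (K := K) c τ) := by
  funext τ; simp [kd, map_sum]

theorem kd_kd (c : Finset V → W) : kd (K := K) (kd (K := K) c) = 0 := by
  funext τ
  unfold kd
  simp_rw [Finset.smul_sum]
  rw [Finset.sum_sigma']
  refine Finset.sum_involution (fun x _ => ⟨x.2, x.1⟩) ?_ ?_ ?_ ?_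
  · rintro ⟨v, w⟩ h
    simp only [Finset.mem_sigma, Finset.mem_sdiff, Finset.mem_insert, not_or] at h
    obtain ⟨⟨_, h1⟩, _, h2, h3⟩ := h
    have := sgn_anti (K := K) v w τ (Ne.symm h2) h1 h3
    simp only
    rw [smul_smul, smul_smul, Finset.insert_comm, ← add_smul]
    have e : (C (sgn K v τ) * X v * (C (sgn K w (insert v τ)) * X w) : MvPolynomial V K) +
        C (sgn K w τ) * X w * (C (sgn K v (insert w τ)) * X v) = 0 := by
      have e2 : (C (sgn K v τ) * X v * (C (sgn K w (insert v τ)) * X w) : MvPolynomial V K)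
        = C (sgn K v τ * sgn K w (insert v τ)) * (X v * X w) := by rw [C_mul]; ring
      rw [e2, this, C_neg, C_mul]; ring
    rw [e, zero_smul]
  · rintro ⟨v, w⟩ h _
    simp only [Finset.mem_sigma, Finset.mem_sdiff, Finset.mem_insert, not_or] at h
    intro h'
    exact h.2.2.1 (by simpa using congrArg Sigma.fst h')
  · rintro ⟨v, w⟩ h
    simp only [Finset.mem_sigma, Finset.mem_sdiff, Finset.mem_insert, not_or] at h ⊢
    tauto
  · rintro ⟨v, w⟩ h; rfl

end kd

def hom (z : ℤ) (f : MvPolynomial V K) : Prop := ∀ m, coeff m f ≠ 0 → (m.degree : ℤ) = z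

theorem hom.zero (z : ℤ) : hom z (0 : MvPolynomial V K) := by intro m h; simp at h

theorem hom.add {z : ℤ} {f g : MvPolynomial V K} (hf : hom z f) (hg : hom z g) : hom z (f + g) := by
  intro m h
  rw [coeff_add] at h
  by_cases h1 : coeff m f = 0
  · exact hg m (by simpa [h1] using h)
  · exact hf m h1

theorem hom.neg {z : ℤ} {f : MvPolynomial V K} (hf : hom z f) : hom z (-f) := by
  intro m h
  rw [coeff_neg] at h
  exact hf m (by simpa using h)

theorem hom.sub {z : ℤ} {f g : MvPolynomial V K} (hf : hom z f) (hg : hom z g) : hom z (f - g) := by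
  rw [sub_eq_add_neg]; exact hf.add hg.neg

theorem hom.sum {ι : Type} {z : ℤ} (s : Finset ι) {f : ι → MvPolynomial V K} (hf : ∀ i ∈ s, hom z (f i)) :
    hom z (∑ i ∈ s, f i) := by
  induction s using Finset.induction_on with
  | empty => simpa using hom.zero z
  | insert a s ha ih =>
    rw [Finset.sum_insert ha]
    exact (hf a (by simp)).add (ih fun i hi => hf i (by simp [hi]))

theorem hom.mul {z z' : ℤ} {f g : MvPolynomial V K} (hf : hom z f) (hg : hom z' g) : hom (z + z') (f * g) := by
  intro m h
  rw [coeff_mul] at h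
  obtain ⟨⟨a, b⟩, hab, h1⟩ := Finset.exists_ne_zero_of_sum_ne_zero h
  have e1 := hf a (left_ne_zero_of_mul h1)
  have e2 := hg b (right_ne_zero_of_mul h1)
  rw [Finset.HasAntidiagonal.mem_antidiagonal] at hab
  simp only at hab
  rw [← hab, map_add]; push_cast; omega

theorem hom.monomial {a : V →₀ ℕ} {k : K} : hom (a.degree : ℤ) (MvPolynomial.monomial a k) := by
  intro m h
  rw [coeff_monomial] at h
  split_ifs at h with h1
  · rw [h1]
  · simp at h

theorem hom.CX {v : V} {k : K} : hom 1 (C k * X v : MvPolynomial V K) := by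
  rw [C_mul_X_eq_monomial]
  simpa using hom.monomial (a := Finsupp.single v 1) (k := k)

theorem hom_iff {z : ℕ} {f : MvPolynomial V K} : hom (z : ℤ) f ↔ f.IsHomogeneous z := by
  unfold hom IsHomogeneous IsWeightedHomogeneous
  simp only [Finsupp.degree_eq_weight_one, Nat.cast_inj]
  rfl

/-- homogeneous component, integer degree -/
def hc (z : ℤ) (f : MvPolynomial V K) : MvPolynomial V K := if 0 ≤ z then homogeneousComponent z.toNat f else 0

theorem coeff_hc (z : ℤ) (f : MvPolynomial V K) (m : V →₀ ℕ) :
    coeff m (hc z f) = if (m.degree : ℤ) = z then coeff m f else 0 := by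
  unfold hc
  split_ifs with h1 h2 h2
  · rw [coeff_homogeneousComponent, if_pos (by omega)]
  · rw [coeff_homogeneousComponent, if_neg (by omega)]
  · omega
  · simp

theorem hc_hom (z : ℤ) (f : MvPolynomial V K) : hom z (hc z f) := by
  intro m h
  rw [coeff_hc] at h
  by_contra h1
  simp [h1] at h

theorem hc_of {z : ℤ} {f : MvPolynomial V K} (h : hom z f) : hc z f = f := by
  ext m
  rw [coeff_hc]
  split_ifs with h1
  · rfl
  · by_contra h2
    exact h1 (h m (Ne.symm h2))

theorem hc_add (z : ℤ) (f g : MvPolynomial V K) : hc z (f + g) = hc z f + hc z g := by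
  ext m; simp only [coeff_hc, coeff_add]; split_ifs <;> simp

theorem hc_zero (z : ℤ) : hc z (0 : MvPolynomial V K) = 0 := by
  ext m; simp [coeff_hc]

theorem hc_sum {ι : Type} (z : ℤ) (s : Finset ι) (f : ι → MvPolynomial V K) : hc z (∑ i ∈ s, f i) = ∑ i ∈ s, hc z (f i) := by
  induction s using Finset.induction_on with
  | empty => simp [hc_zero]
  | insert a s ha ih => rw [Finset.sum_insert ha, Finset.sum_insert ha, hc_add, ih]

theorem hc_mul {z t : ℤ} {g : MvPolynomial V K} (hg : hom z g) (f : MvPolynomial V K) :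
    hc t (g * f) = g * hc (t - z) f := by
  ext m
  rw [coeff_hc, coeff_mul, coeff_mul]
  split_ifs with h
  · apply Finset.sum_congr rfl
    rintro ⟨a, b⟩ hab
    rw [Finset.HasAntidiagonal.mem_antidiagonal] at hab
    simp only at hab ⊢
    by_cases h1 : coeff a g = 0
    · simp [h1]
    · rw [coeff_hc, if_pos]
      have := hg a h1
      rw [← hab, map_add] at h; push_cast at h; omega
  · symm
    apply Finset.sum_eq_zero
    rintro ⟨a, b⟩ hab
    rw [Finset.HasAntidiagonal.mem_antidiagonal] at hab
    simp only at hab ⊢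
    by_cases h1 : coeff a g = 0
    · simp [h1]
    · rw [coeff_hc, if_neg, mul_zero]
      have := hg a h1
      rw [← hab, map_add] at h; push_cast at h; omega

theorem sum_hc (f : MvPolynomial V K) : ∃ N : ℕ, ∀ M, N ≤ M → f = ∑ i ∈ Finset.range M, hc (i : ℤ) f := by
  refine ⟨f.totalDegree + 1, fun M hM => ?_⟩
  ext m
  rw [coeff_sum]
  simp only [coeff_hc, Nat.cast_inj]
  rw [Finset.sum_ite_eq]
  split_ifs with h
  · rfl
  · by_contra h1
    have := le_totalDegree (mem_support_iff.2 h1)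
    rw [Finset.mem_range] at h
    rw [Finsupp.degree_apply] at h
    simp only [Finsupp.sum] at this
    omega

theorem coeff_kd [Fintype V] (e : Finset V → MvPolynomial V K) (a : V →₀ ℕ) (τ : Finset V) (hτ : τ ⊆ a.support) :
    coeff (a - ind τ) (kd (K := K) e τ) = bd a.support (fun σ => if σ ⊆ a.support then coeff (a - ind σ) (e σ) else 0) τ := by
  unfold kd bd
  rw [coeff_sum]
  symm
  have hsub : a.support \ τ ⊆ Finset.univ \ τ := Finset.sdiff_subset_sdiff (Finset.subset_univ _) subset_rfl
  have hev : ∀ v ∈ a.support \ τ, sgn K v τ * (if insert v τ ⊆ a.support then coeff (a - ind (insert v τ)) (e (insert v τ)) else 0) =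
      coeff (a - ind τ) ((C (sgn K v τ) * X v : MvPolynomial V K) • e (insert v τ)) := by
    intro v hv
    rw [Finset.mem_sdiff] at hv
    rw [if_pos (Finset.insert_subset hv.1 hτ), smul_eq_mul, mul_assoc, coeff_C_mul, coeff_X_mul', if_pos]
    · congr 2
      rw [ind_insert hv.2, tsub_add_eq_tsub_tsub]
    · have := hv.1
      simp [ind_apply, hv.2] at this ⊢
      omega
  rw [Finset.sum_congr rfl hev]
  apply Finset.sum_subset hsub
  intro v hv hv'
  rw [smul_eq_mul, mul_assoc, coeff_C_mul, coeff_X_mul', if_neg, mul_zero]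
  simp only [Finset.mem_sdiff, Finset.mem_univ, true_and] at hv hv'
  have : v ∉ a.support := fun h => hv' ⟨h, hv⟩
  simp at this
  simp [this]

/-- global exactness from multigraded exactness -/
theorem glob [Fintype V] {Q : (V →₀ ℕ) → Prop} {t : ℤ} {j : ℕ}
    (hR : ∀ a : V →₀ ℕ, (a.degree : ℤ) = t → ∀ c : Finset V → K, Adm Q a j c → bd a.support c = 0 →
      ∃ b : Finset V → K, Adm Q a (j + 1) b ∧ bd a.support b = c)
    (c : Finset V → MvPolynomial V K) (hc1 : ∀ σ, c σ ≠ 0 → σ.card = j) (hc2 : ∀ σ m, coeff m (c σ) ≠ 0 → Q m)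
    (hc3 : ∀ σ, hom (t - j) (c σ)) (hbd : kd (K := K) c = 0) :
    ∃ b : Finset V → MvPolynomial V K, (∀ σ, b σ ≠ 0 → σ.card = j + 1) ∧ (∀ σ m, coeff m (b σ) ≠ 0 → Q m) ∧
      (∀ σ, hom (t - (j + 1 : ℕ)) (b σ)) ∧ kd (K := K) b = c := by
  -- components
  set ca : (V →₀ ℕ) → Finset V → K := fun a σ => if σ ⊆ a.support then coeff (a - ind σ) (c σ) else 0 with hca
  have hAdm : ∀ a, Adm Q a j (ca a) := by
    intro a σ hσ
    simp only [hca] at hσ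
    split_ifs at hσ with h1
    · refine ⟨h1, hc1 σ ?_, hc2 σ _ hσ⟩
      intro h; rw [h] at hσ; simp at hσ
    · simp at hσ
  have key := coeff_kd (V := V) (K := K)
  have hbda : ∀ a, bd a.support (ca a) = 0 := by
    intro a
    funext τ
    by_cases hτ : τ ⊆ a.support
    · rw [hca, ← key c a τ hτ, hbd]; simp
    · apply Finset.sum_eq_zero
      intro v hv
      have : ¬ insert v τ ⊆ a.support := fun h => hτ ((Finset.subset_insert _ _).trans h)
      simp [hca, this]
  choose! bb hb1 hb2 using fun a ha => hR a ha (ca a) (hAdm a) (hbda a)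
  set DS : Finset (V →₀ ℕ) := Finset.finsuppAntidiag Finset.univ t.toNat with hDS
  have mDS : ∀ a : V →₀ ℕ, 0 ≤ t → (a ∈ DS ↔ (a.degree : ℤ) = t) := by
    intro a ht
    rw [hDS, Finset.mem_finsuppAntidiag]
    have : a.degree = Finset.univ.sum a := by
      rw [Finsupp.degree_apply]
      exact Finset.sum_subset (Finset.subset_univ _) (fun v _ h => by simpa using h)
    rw [this]
    simp only [Finset.subset_univ, and_true]
    omega
  by_cases ht : 0 ≤ t
  swap
  · have hz : ∀ σ, c σ = 0 := by
      intro σ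
      ext m
      by_contra h
      have := hc3 σ m h
      omega
    refine ⟨0, by simp, by simp, fun σ => hom.zero _, ?_⟩
    funext τ
    simp [kd, hz]
  set b : Finset V → MvPolynomial V K := fun σ => ∑ a ∈ DS, monomial (a - ind σ) (bb a σ) with hb
  have inj : ∀ (a : V →₀ ℕ) (σ : Finset V), σ ⊆ a.support → ∀ a', a' ∈ DS → bb a' σ ≠ 0 → a' - ind σ = a - ind σ → a' = a := by
    intro a σ h1 a' ha' h2 h3
    rw [mDS _ ht] at ha'
    have h4 := (hb1 a' ha' σ h2).1
    rw [← tsub_add_cancel_of_le (ind_le h1), ← tsub_add_cancel_of_le (ind_le h4), h3]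
  have hbco : ∀ (a : V →₀ ℕ) (σ : Finset V), a ∈ DS → σ ⊆ a.support → coeff (a - ind σ) (b σ) = bb a σ := by
    intro a σ ha hσ
    rw [hb]
    simp only [coeff_sum, coeff_monomial]
    rw [Finset.sum_eq_single a]
    · simp
    · intro a' ha' hne
      split_ifs with h
      · by_contra h2
        exact hne (inj a σ hσ a' ha' h2 h)
      · rfl
    · intro h; exact absurd ha h
  have hterm : ∀ σ m, coeff m (b σ) ≠ 0 → ∃ a ∈ DS, bb a σ ≠ 0 ∧ a - ind σ = m := by
    intro σ m h
    rw [hb] at h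
    simp only [coeff_sum, coeff_monomial] at h
    obtain ⟨a, ha, h1⟩ := Finset.exists_ne_zero_of_sum_ne_zero h
    refine ⟨a, ha, ?_⟩
    split_ifs at h1 with h2
    · exact ⟨h1, h2⟩
    · simp at h1
  refine ⟨b, ?_, ?_, ?_, ?_⟩
  · intro σ hσ
    obtain ⟨m, hm⟩ := ne_zero_iff.1 hσ
    obtain ⟨a, ha, h1, -⟩ := hterm σ m hm
    exact (hb1 a ((mDS _ ht).1 ha) σ h1).2.1
  · intro σ m hm
    obtain ⟨a, ha, h1, rfl⟩ := hterm σ m hm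
    exact (hb1 a ((mDS _ ht).1 ha) σ h1).2.2
  · intro σ m hm
    obtain ⟨a, ha, h1, rfl⟩ := hterm σ m hm
    rw [mDS _ ht] at ha
    obtain ⟨h2, h3, -⟩ := hb1 a ha σ h1
    have := congrArg Finsupp.degree (tsub_add_cancel_of_le (ind_le h2))
    rw [map_add, degree_ind, h3] at this
    omega
  · funext τ
    ext m
    -- multidegree
    set a := m + ind τ with ha
    have hτ : τ ⊆ a.support := by
      intro v hv; simp [ha, ind_apply, hv]
    have hm : a - ind τ = m := by rw [ha]; simp
    rw [← hm, key b a τ hτ]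
    by_cases haD : a ∈ DS
    · have haD' := (mDS _ ht).1 haD
      have : (fun σ => if σ ⊆ a.support then coeff (a - ind σ) (b σ) else 0) = bb a := by
        funext σ
        split_ifs with h
        · exact hbco a σ haD h
        · by_contra h1
          exact h (hb1 a haD' σ (Ne.symm h1)).1
      rw [this, hb2 a haD']
      simp [hca, hτ]
    · rw [mDS _ ht] at haD
      have e1 : coeff (a - ind τ) (c τ) = 0 := by
        by_contra h
        have h1 := hc3 τ _ h
        have h2 := hc1 τ (by intro h'; rw [h'] at h; simp at h)
        have := congrArg Finsupp.degree (tsub_add_cancel_of_le (ind_le hτ))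
        rw [map_add, degree_ind, h2] at this
        omega
      rw [e1]
      apply Finset.sum_eq_zero
      intro v hv
      beta_reduce
      split_ifs with h
      · have : coeff (a - ind (insert v τ)) (b (insert v τ)) = 0 := by
          by_contra h'
          obtain ⟨a', ha', h1, h2⟩ := hterm _ _ h'
          have := inj a _ h a' ha' h1 h2
          subst this
          exact haD ((mDS _ ht).1 ha')
        rw [this, mul_zero]
      · simp

end ER

namespace ER

open scoped Classical

variable {V K : Type} [Field K]

/-- homogeneous vectors -/
def HF {n : ℕ} (deg : Fin n → ℕ) (t : ℤ) (u : Fin n → MvPolynomial V K) : Prop :=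
  ∀ k, hom (t - deg k) (u k)

theorem HF.zero {n : ℕ} (deg : Fin n → ℕ) (t : ℤ) : HF deg t (0 : Fin n → MvPolynomial V K) :=
  fun _ => hom.zero _

theorem HF.sub {n : ℕ} {deg : Fin n → ℕ} {t : ℤ} {u w : Fin n → MvPolynomial V K} (hu : HF deg t u)
    (hw : HF deg t w) : HF deg t (u - w) := fun k => (hu k).sub (hw k)

def hcF {n : ℕ} (deg : Fin n → ℕ) (t : ℤ) (u : Fin n → MvPolynomial V K) : Fin n → MvPolynomial V K :=
  fun k => hc (t - deg k) (u k)

theorem hcF_HF {n : ℕ} (deg : Fin n → ℕ) (t : ℤ) (u : Fin n → MvPolynomial V K) : HF deg t (hcF deg t u) :=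
  fun k => hc_hom _ _

theorem hcF_of {n : ℕ} {deg : Fin n → ℕ} {t : ℤ} {u : Fin n → MvPolynomial V K} (h : HF deg t u) :
    hcF deg t u = u := funext fun k => hc_of (h k)

/-- homogeneous matrices -/
def HM {n n' : ℕ} (deg : Fin n → ℕ) (deg' : Fin n' → ℕ) (A : Matrix (Fin n) (Fin n') (MvPolynomial V K)) : Prop :=
  ∀ k j, hom ((deg' j : ℤ) - deg k) (A k j)

theorem HM.hcF {n n' : ℕ} {deg : Fin n → ℕ} {deg' : Fin n' → ℕ}
    {A : Matrix (Fin n) (Fin n') (MvPolynomial V K)} (hA : HM deg deg' A) (t : ℤ) (u : Fin n' → MvPolynomial V K) :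
    A.mulVecLin (ER.hcF deg' t u) = ER.hcF deg t (A.mulVecLin u) := by
  funext k
  simp only [Matrix.mulVecLin_apply, Matrix.mulVec, dotProduct, ER.hcF, hc_sum]
  apply Finset.sum_congr rfl
  intro j _
  rw [hc_mul (hA k j)]
  congr 2
  omega

theorem HM.HF {n n' : ℕ} {deg : Fin n → ℕ} {deg' : Fin n' → ℕ}
    {A : Matrix (Fin n) (Fin n') (MvPolynomial V K)} (hA : HM deg deg' A) {t : ℤ} {u : Fin n' → MvPolynomial V K}
    (hu : HF deg' t u) : ER.HF deg t (A.mulVecLin u) := by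
  rw [← hcF_of hu, hA.hcF]; exact hcF_HF _ _ _

theorem HM.lift {n n' : ℕ} {deg : Fin n → ℕ} {deg' : Fin n' → ℕ}
    {A : Matrix (Fin n) (Fin n') (MvPolynomial V K)} (hA : HM deg deg' A) {t : ℤ} {u : Fin n → MvPolynomial V K}
    (hu : ER.HF deg t u) (h : u ∈ LinearMap.range A.mulVecLin) : ∃ g, ER.HF deg' t g ∧ A.mulVecLin g = u := by
  obtain ⟨g, rfl⟩ := h
  exact ⟨ER.hcF deg' t g, hcF_HF _ _ _, by rw [hA.hcF, hcF_of hu]⟩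

theorem HM.homog {n n' : ℕ} {deg : Fin n → ℕ} {deg' : Fin n' → ℕ}
    {A : Matrix (Fin n) (Fin n') (MvPolynomial V K)} (hA : HM deg deg' A) (k : Fin n) (j : Fin n') :
    A k j = 0 ∨ ∃ e, deg' j = deg k + e ∧ (A k j).IsHomogeneous e := by
  by_cases h : A k j = 0
  · exact Or.inl h
  right
  obtain ⟨m, hm⟩ := ne_zero_iff.1 h
  have := hA k j m hm
  refine ⟨m.degree, by omega, ?_⟩
  rw [← hom_iff, this]; exact hA k j

theorem HM.of_homog {n n' : ℕ} {deg : Fin n → ℕ} {deg' : Fin n' → ℕ}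
    {A : Matrix (Fin n) (Fin n') (MvPolynomial V K)}
    (h : ∀ k j, A k j = 0 ∨ ∃ e, deg' j = deg k + e ∧ (A k j).IsHomogeneous e) : HM deg deg' A := by
  intro k j
  rcases h k j with h | ⟨e, h1, h2⟩
  · rw [h]; exact hom.zero _
  · rw [← hom_iff] at h2
    rw [h1]; push_cast; simpa using h2

section
variable [Fintype V]

structure CH {n : ℕ} (M : Submodule (MvPolynomial V K) (Fin n → MvPolynomial V K)) (deg : Fin n → ℕ) (t : ℤ) (j : ℕ)
    (c : Finset V → Fin n → MvPolynomial V K) : Prop where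
  card : ∀ σ, c σ ≠ 0 → σ.card = j
  mem : ∀ σ, c σ ∈ M
  hf : ∀ σ, HF deg (t - j) (c σ)

def KV {n : ℕ} (M : Submodule (MvPolynomial V K) (Fin n → MvPolynomial V K)) (deg : Fin n → ℕ) (t : ℤ) (j : ℕ) : Prop :=
  ∀ c, CH M deg t j c → kd (K := K) c = 0 → ∃ b, CH M deg t (j + 1) b ∧ kd (K := K) b = c

theorem HF.kd {n : ℕ} {deg : Fin n → ℕ} {t : ℤ} {c : Finset V → Fin n → MvPolynomial V K}
    (h : ∀ σ, HF deg (t - 1) (c σ)) (τ : Finset V) : HF deg t (kd (K := K) c τ) := by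
  intro k
  unfold ER.kd
  rw [Finset.sum_apply]
  apply hom.sum
  intro v _
  rw [Pi.smul_apply, smul_eq_mul]
  have := (hom.CX (v := v) (k := sgn K v τ)).mul (h (insert v τ) k)
  convert this using 1; omega

theorem CH.kd {n : ℕ} {M : Submodule (MvPolynomial V K) (Fin n → MvPolynomial V K)} {deg : Fin n → ℕ} {t : ℤ} {j : ℕ}
    {c : Finset V → Fin n → MvPolynomial V K} (h : CH M deg t (j + 1) c) : CH M deg t j (kd (K := K) c) := by
  refine ⟨fun σ hσ => ?_, fun σ => ?_, fun σ => HF.kd (fun σ => ?_) σ⟩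
  · obtain ⟨v, hv, h1⟩ := Finset.exists_ne_zero_of_sum_ne_zero hσ
    have := h.card _ (fun h' => h1 (by rw [h', smul_zero]))
    rw [Finset.card_insert_of_notMem (by simpa using hv)] at this
    omega
  · exact Submodule.sum_mem _ fun v _ => Submodule.smul_mem _ _ (h.mem _)
  · have := h.hf σ
    convert this using 1; push_cast; omega

theorem CH.mono {n : ℕ} {M M' : Submodule (MvPolynomial V K) (Fin n → MvPolynomial V K)} {deg : Fin n → ℕ} {t : ℤ} {j : ℕ}
    {c : Finset V → Fin n → MvPolynomial V K} (h : CH M deg t j c) (hM : ∀ σ, c σ ∈ M') : CH M' deg t j c :=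
  ⟨h.card, hM, h.hf⟩

theorem CH.sub {n : ℕ} {M : Submodule (MvPolynomial V K) (Fin n → MvPolynomial V K)} {deg : Fin n → ℕ} {t : ℤ} {j : ℕ}
    {c c' : Finset V → Fin n → MvPolynomial V K} (h : CH M deg t j c) (h' : CH M deg t j c') : CH M deg t j (c - c') := by
  refine ⟨fun σ hσ => ?_, fun σ => Submodule.sub_mem _ (h.mem _) (h'.mem _), fun σ => (h.hf σ).sub (h'.hf σ)⟩
  by_contra h1
  apply hσ
  have e1 : c σ = 0 := by by_contra h2; exact h1 (h.card σ h2)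
  have e2 : c' σ = 0 := by by_contra h2; exact h1 (h'.card σ h2)
  simp [e1, e2]

theorem CH.map {n n' : ℕ} {deg : Fin n → ℕ} {deg' : Fin n' → ℕ}
    {A : Matrix (Fin n) (Fin n') (MvPolynomial V K)} (hA : HM deg deg' A) {t : ℤ} {j : ℕ}
    {M : Submodule (MvPolynomial V K) (Fin n' → MvPolynomial V K)}
    {c : Finset V → Fin n' → MvPolynomial V K} (h : CH M deg' t j c) :
    CH (LinearMap.range A.mulVecLin) deg t j (fun σ => A.mulVecLin (c σ)) := by
  refine ⟨fun σ hσ => h.card σ ?_, fun σ => ⟨_, rfl⟩, fun σ => hA.HF (h.hf σ)⟩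
  intro h'
  apply hσ
  rw [h', map_zero]

theorem CH.lift {n n' : ℕ} {deg : Fin n → ℕ} {deg' : Fin n' → ℕ}
    {A : Matrix (Fin n) (Fin n') (MvPolynomial V K)} (hA : HM deg deg' A) {t : ℤ} {j : ℕ}
    {c : Finset V → Fin n → MvPolynomial V K} (h : CH (LinearMap.range A.mulVecLin) deg t j c) :
    ∃ g, CH ⊤ deg' t j g ∧ ∀ σ, A.mulVecLin (g σ) = c σ := by
  have : ∀ σ, ∃ g, HF deg' (t - j) g ∧ A.mulVecLin g = c σ ∧ (g ≠ 0 → c σ ≠ 0) := by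
    intro σ
    by_cases h0 : c σ = 0
    · exact ⟨0, HF.zero _ _, by rw [map_zero, h0], fun h => absurd rfl h⟩
    · obtain ⟨g, h1, h2⟩ := hA.lift (h.hf σ) (h.mem σ)
      exact ⟨g, h1, h2, fun _ => h0⟩
  choose g h1 h2 h3 using this
  exact ⟨g, ⟨fun σ hσ => h.card σ (h3 σ hσ), fun σ => trivial, h1⟩, h2⟩

theorem KVfree {n : ℕ} {deg : Fin n → ℕ} {t : ℤ} {j : ℕ} (h : 1 ≤ j ∨ ∀ k, (deg k : ℤ) < t) :
    KV (⊤ : Submodule (MvPolynomial V K) (Fin n → MvPolynomial V K)) deg t j := by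
  intro c hc hk
  have : ∀ k : Fin n, ∃ b : Finset V → MvPolynomial V K, (∀ σ, b σ ≠ 0 → σ.card = j + 1) ∧ (∀ σ m, coeff m (b σ) ≠ 0 → True) ∧
      (∀ σ, hom ((t - deg k) - (j + 1 : ℕ)) (b σ)) ∧ kd (K := K) b = fun σ => c σ k := by
    intro k
    refine glob (Q := fun _ => True) (t := t - deg k) (j := j) ?_ (fun σ => c σ k) ?_ ?_ ?_ ?_
    · intro a ha e he hbd
      by_cases ha0 : a = 0
      · refine ⟨0, Adm.zero _ _ _, ?_⟩
        rw [bd_zero]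
        funext σ
        by_contra h1
        obtain ⟨h2, h3, -⟩ := he σ (Ne.symm h1)
        subst ha0
        simp at h2 ha
        subst h2
        simp at h3
        rcases h with h | h
        · omega
        · have := h k; omega
      · obtain ⟨v, hv⟩ := Finsupp.support_nonempty_iff.2 ha0
        refine ⟨op v e, ?_, ?_⟩
        · intro σ hσ
          unfold op at hσ
          split_ifs at hσ with h1
          · obtain ⟨h2, h3, -⟩ := he _ (right_ne_zero_of_mul hσ)
            refine ⟨?_, ?_, trivial⟩
            · rw [← Finset.insert_erase h1]; exact Finset.insert_subset hv h2
            · rw [Finset.card_erase_of_mem h1] at h3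
              have := Finset.card_pos.2 ⟨v, h1⟩
              omega
          · simp at hσ
        · rw [bd_op _ _ hv, hbd]
          funext σ; simp [op]
    · intro σ hσ
      exact hc.card σ (fun h => hσ (by rw [h]; rfl))
    · intros; trivial
    · intro σ
      have := hc.hf σ k
      convert this using 1; omega
    · funext τ
      have := congrFun (congrFun hk τ) k
      simpa [kd, Finset.sum_apply] using this
  choose b hb1 _ hb3 hb4 using this
  refine ⟨fun σ k => b k σ, ⟨?_, fun _ => trivial, ?_⟩, ?_⟩
  · intro σ hσ
    obtain ⟨k, hk⟩ := Function.ne_iff.1 hσ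
    exact hb1 k σ hk
  · intro σ k
    have := hb3 k σ
    convert this using 1; omega
  · funext τ k
    have := congrFun (hb4 k) τ
    simpa [kd, Finset.sum_apply] using this

def Grd {n : ℕ} (M : Submodule (MvPolynomial V K) (Fin n → MvPolynomial V K)) (deg : Fin n → ℕ) : Prop :=
  ∀ u ∈ M, ∀ t : ℤ, hcF deg t u ∈ M

theorem sum_hcF {n : ℕ} (deg : Fin n → ℕ) (u : Fin n → MvPolynomial V K) :
    ∃ N : ℕ, u = ∑ i ∈ Finset.range N, hcF deg (i : ℤ) u := by
  refine ⟨∑ k, ((u k).totalDegree + deg k + 1), ?_⟩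
  funext k
  rw [Finset.sum_apply]
  ext m
  rw [coeff_sum]
  simp only [hcF, coeff_hc]
  by_cases h : coeff m (u k) = 0
  · simp [h]
  rw [Finset.sum_eq_single (m.degree + deg k)]
  · rw [if_pos (by push_cast; omega)]
  · intro b _ hb
    rw [if_neg (by omega)]
  · intro h1
    exfalso; apply h1
    have := le_totalDegree (mem_support_iff.2 h)
    have h2 : (u k).totalDegree + deg k + 1 ≤ ∑ k, ((u k).totalDegree + deg k + 1) :=
      Finset.single_le_sum (f := fun k => (u k).totalDegree + deg k + 1) (fun _ _ => Nat.zero_le _) (Finset.mem_univ k)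
    rw [Finset.mem_range, Finsupp.degree_apply]
    simp only [Finsupp.sum] at this
    omega

theorem gen {n : ℕ} {M : Submodule (MvPolynomial V K) (Fin n → MvPolynomial V K)} {deg : Fin n → ℕ} (hM : Grd M deg) {e : ℕ}
    (hK : ∀ t : ℤ, (e : ℤ) < t → KV M deg t 0) :
    M = Submodule.span _ {u | u ∈ M ∧ ∃ t : ℕ, t ≤ e ∧ HF deg t u} := by
  apply le_antisymm
  swap
  · rw [Submodule.span_le]; exact fun u hu => hu.1
  set N := Submodule.span (MvPolynomial V K) {u | u ∈ M ∧ ∃ t : ℕ, t ≤ e ∧ HF deg t u} with hN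
  have key : ∀ t : ℕ, ∀ u ∈ M, HF deg t u → u ∈ N := by
    intro t
    induction t with
    | zero => exact fun u hu h => Submodule.subset_span ⟨hu, 0, by omega, h⟩
    | succ t ih =>
      intro u hu h
      by_cases hte : t + 1 ≤ e
      · exact Submodule.subset_span ⟨hu, t + 1, hte, h⟩
      obtain ⟨b, hb, hb2⟩ := hK (t + 1 : ℕ) (by omega) (fun σ => if σ = ∅ then u else 0) (by
        refine ⟨fun σ hσ => ?_, fun σ => ?_, fun σ => ?_⟩
        · split_ifs at hσ with h1
          · simp [h1]
          · simp at hσ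
        · split_ifs
          · exact hu
          · exact Submodule.zero_mem _
        · split_ifs
          · simpa using h
          · exact HF.zero _ _) (by
        funext τ
        apply Finset.sum_eq_zero
        intro v _
        simp)
      have := congrFun hb2 ∅
      simp only [if_true] at this
      rw [← this]
      apply Submodule.sum_mem
      intro v _
      apply Submodule.smul_mem
      apply ih _ (hb.mem _)
      have := hb.hf (insert v ∅)
      convert this using 1; push_cast; omega
  intro u hu
  obtain ⟨L, hL⟩ := sum_hcF deg u
  rw [hL]
  exact Submodule.sum_mem _ fun i _ => key i _ (hM u hu i) (hcF_HF _ _ _)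

theorem stepA {n : ℕ} {M : Submodule (MvPolynomial V K) (Fin n → MvPolynomial V K)} {deg : Fin n → ℕ} (hM : Grd M deg) {e : ℕ}
    (hK : ∀ (t : ℤ) (j : ℕ), (e : ℤ) + j < t → KV M deg t j) :
    ∃ (n' : ℕ) (deg' : Fin n' → ℕ) (A : Matrix (Fin n) (Fin n') (MvPolynomial V K)), HM deg deg' A ∧
      LinearMap.range A.mulVecLin = M ∧ (∀ k, deg' k ≤ e) ∧ Grd (LinearMap.ker A.mulVecLin) deg' ∧
      ∀ (t : ℤ) (j : ℕ), ((e + 1 : ℕ) : ℤ) + j < t → KV (LinearMap.ker A.mulVecLin) deg' t j := by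
  have hg := gen hM (fun t ht => hK t 0 (by simpa using ht))
  have hfg : M.FG := IsNoetherian.noetherian M
  rw [hg] at hfg
  rw [Submodule.fg_span_iff_fg_span_finset_subset] at hfg
  obtain ⟨s, hs, hs2⟩ := hfg
  choose! dg hd1 hd2 using fun u (hu : u ∈ s) => (hs hu).2
  let E := s.equivFin
  set A : Matrix (Fin n) (Fin s.card) (MvPolynomial V K) := fun k j => (E.symm j).1 k with hA
  set deg' : Fin s.card → ℕ := fun j => dg (E.symm j).1 with hdeg'
  have hHM : HM deg deg' A := fun k j => hd2 _ (E.symm j).2 k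
  have hrange : LinearMap.range A.mulVecLin = M := by
    rw [Matrix.range_mulVecLin, hg, hs2]
    congr 1
    ext u
    constructor
    · rintro ⟨j, rfl⟩; exact (E.symm j).2
    · intro hu; exact ⟨E ⟨u, hu⟩, by funext k; change (E.symm (E ⟨u, hu⟩)).1 k = u k; rw [E.symm_apply_apply]⟩
  have hdle : ∀ k, deg' k ≤ e := fun k => hd1 _ (E.symm k).2
  refine ⟨s.card, deg', A, hHM, hrange, hdle, ?_, ?_⟩
  · intro u hu t
    rw [LinearMap.mem_ker] at hu ⊢
    rw [hHM.hcF, hu]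
    funext k; simp [hcF, hc_zero]
  · intro t j ht c hc hk
    obtain ⟨b, hb, hbk⟩ := KVfree (V := V) (K := K) (deg := deg') (t := t) (j := j)
      (Or.inr (fun k => by have := hdle k; push_cast at ht; omega)) c (hc.mono fun _ => trivial) hk
    have h1 := CH.map hHM hb
    rw [hrange] at h1
    obtain ⟨h, hh, hhk⟩ := hK t (j + 1) (by push_cast at ht ⊢; omega) _ h1 (by
      rw [kd_map, hbk]
      funext τ
      exact hc.mem τ)
    rw [← hrange] at hh
    obtain ⟨g, hg1, hg2⟩ := CH.lift hHM hh
    refine ⟨b - kd (K := K) g, (hb.sub hg1.kd).mono fun σ => ?_, ?_⟩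
    · rw [LinearMap.mem_ker]
      have e1 := congrFun (kd_map A.mulVecLin g) σ
      rw [show (fun σ => A.mulVecLin (g σ)) = h from funext hg2, hhk] at e1
      rw [Pi.sub_apply, map_sub, sub_eq_zero]
      exact e1
    · rw [kd_sub, kd_kd, sub_zero, hbk]

/-- state of the recursion -/
structure St (V K : Type) [Field K] [Fintype V] where
  n : ℕ
  deg : Fin n → ℕ
  M : Submodule (MvPolynomial V K) (Fin n → MvPolynomial V K)
  e : ℕ
  grd : Grd M deg
  kv : ∀ (t : ℤ) (j : ℕ), (e : ℤ) + j < t → KV M deg t j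

def St.next (s : St V K) : St V K where
  n := (stepA s.grd s.kv).choose
  deg := (stepA s.grd s.kv).choose_spec.choose
  M := LinearMap.ker ((stepA s.grd s.kv).choose_spec.choose_spec.choose).mulVecLin
  e := s.e + 1
  grd := (stepA s.grd s.kv).choose_spec.choose_spec.choose_spec.2.2.2.1
  kv := (stepA s.grd s.kv).choose_spec.choose_spec.choose_spec.2.2.2.2

def St.A (s : St V K) : Matrix (Fin s.n) (Fin s.next.n) (MvPolynomial V K) :=
  (stepA s.grd s.kv).choose_spec.choose_spec.choose

theorem St.A_HM (s : St V K) : HM s.deg s.next.deg s.A := (stepA s.grd s.kv).choose_spec.choose_spec.choose_spec.1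

theorem St.A_range (s : St V K) : LinearMap.range s.A.mulVecLin = s.M :=
  (stepA s.grd s.kv).choose_spec.choose_spec.choose_spec.2.1

theorem St.deg_le (s : St V K) (k) : s.next.deg k ≤ s.e := (stepA s.grd s.kv).choose_spec.choose_spec.choose_spec.2.2.1 k

theorem St.ker (s : St V K) : LinearMap.ker s.A.mulVecLin = s.next.M := rfl

def St.it (s : St V K) (i : ℕ) : St V K := Nat.rec s (fun _ s => s.next) i

theorem St.it_e (s : St V K) (i : ℕ) : (s.it i).e = s.e + i := by
  induction i with
  | zero => rfl
  | succ i ih => 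
    have : (s.it (i + 1)).e = (s.it i).e + 1 := rfl
    rw [this, ih]; omega

open EdgeIdealReg

def St.res (s : St V K) (I : Ideal (MvPolynomial V K)) (h1 : s.n = 1) (h0 : ∀ k, s.deg k = 0)
    (hI : ∀ f, f ∈ I ↔ (fun _ => f) ∈ s.M) : GradedFreeResolution I where
  rank i := (s.it i).n
  deg i := (s.it i).deg
  rank_zero := h1
  deg_zero := h0
  mat i := (s.it i).A
  homog i := (s.it i).A_HM.homog
  range_zero f := (hI f).trans (by
    have := (s.it 0).A_range
    exact (SetLike.ext_iff.1 this _).symm)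
  isExact i := (St.ker (s.it i)).trans ((s.it (i + 1)).A_range).symm

/-- the monomial ideal resolution -/
theorem exists_res {I : Ideal (MvPolynomial V K)} {Q : (V →₀ ℕ) → Prop} (hI : ∀ f, f ∈ I ↔ ∀ m, coeff m f ≠ 0 → Q m)
    {D : ℕ} (hR : R K Q D) (hD : 1 ≤ D) : ∃ F : GradedFreeResolution I, ∀ i k, (F.deg i k : ℤ) ≤ (D : ℤ) - 1 + i := by
  let M : Submodule (MvPolynomial V K) (Fin 1 → MvPolynomial V K) := Submodule.comap (LinearMap.proj 0) I
  have mM : ∀ u, u ∈ M ↔ u 0 ∈ I := fun u => Iff.rfl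
  let s : St V K := {
    n := 1
    deg := fun _ => 0
    M := M
    e := D
    grd := by
      intro u hu t
      rw [mM, hI] at hu ⊢
      intro m hm
      apply hu m
      intro h
      apply hm
      simp only [hcF, coeff_hc, h]; simp
    kv := by
      intro t j htj c hc hk
      obtain ⟨b, hb1, hb2, hb3, hb4⟩ := glob (Q := Q) (t := t) (j := j) (fun a ha => hR a j (by omega)) (fun σ => c σ 0)
        (fun σ hσ => hc.card σ (fun h => hσ (by rw [h]; rfl)))
        (fun σ m hm => (hI _).1 (hc.mem σ) m hm)
        (fun σ => by simpa using hc.hf σ 0)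
        (by
          funext τ
          have := congrFun (congrFun hk τ) 0
          simpa [kd, Finset.sum_apply] using this)
      refine ⟨fun σ _ => b σ, ⟨?_, ?_, ?_⟩, ?_⟩
      · intro σ hσ
        obtain ⟨k, hk⟩ := Function.ne_iff.1 hσ
        exact hb1 σ hk
      · intro σ
        rw [mM, hI]
        exact hb2 σ
      · intro σ k
        simpa using hb3 σ
      · funext τ k
        have := congrFun hb4 τ
        rw [Subsingleton.elim k 0]
        simpa [kd, Finset.sum_apply] using this }
  refine ⟨s.res I rfl (fun _ => rfl) (fun f => (mM (fun _ => f)).symm), ?_⟩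
  intro i k
  cases i with
  | zero => 
    have : (s.res I rfl (fun _ => rfl) (fun f => (mM (fun _ => f)).symm)).deg 0 k = 0 := rfl
    rw [this]; push_cast; omega
  | succ i =>
    have h1 : (s.res I rfl (fun _ => rfl) (fun f => (mM (fun _ => f)).symm)).deg (i + 1) k ≤ (s.it i).e := (s.it i).deg_le k
    rw [St.it_e] at h1
    have : s.e = D := rfl
    push_cast; omega

end

end ER

namespace ER

open scoped Classical
open EdgeIdealReg

section
variable {V K : Type} [Field K] (p : V → Prop)

def psi : MvPolynomial V K ≃ₐ[K] MvPolynomial {v // ¬ p v} (MvPolynomial {v // p v} K) :=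
  (renameEquiv K ((Equiv.sumCompl p).symm.trans (Equiv.sumComm _ _))).trans (sumAlgEquiv K _ _)

theorem psi_rename (f : MvPolynomial {v // p v} K) : psi p (rename Subtype.val f) = C f := by
  induction f using MvPolynomial.induction_on with
  | C a => simp [psi]
  | add f g hf hg => rw [map_add, map_add, hf, hg, map_add]
  | mul_X f v hf =>
    rw [map_mul, map_mul, hf, map_mul]
    congr 1
    simp [psi]

def qq (μ : {v // ¬ p v} →₀ ℕ) (f : MvPolynomial V K) : MvPolynomial {v // p v} K := coeff μ (psi p f)

theorem qq_ext {f g : MvPolynomial V K} (h : ∀ μ, qq p μ f = qq p μ g) : f = g :=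
  (psi p).injective (MvPolynomial.ext _ _ h)

theorem qq_mulVec {n n' : ℕ} (A : Matrix (Fin n) (Fin n') (MvPolynomial {v // p v} K)) (w : Fin n' → MvPolynomial V K) (μ k) :
    qq p μ ((A.map (rename Subtype.val)).mulVecLin w k) = A.mulVecLin (fun j => qq p μ (w j)) k := by
  simp only [Matrix.mulVecLin_apply, Matrix.mulVec, dotProduct, qq, map_sum, coeff_sum, Matrix.map_apply, map_mul, psi_rename,
    coeff_C_mul]

theorem ker_iff {n n' : ℕ} (A : Matrix (Fin n) (Fin n') (MvPolynomial {v // p v} K)) (w : Fin n' → MvPolynomial V K) :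
    w ∈ LinearMap.ker (A.map (rename Subtype.val)).mulVecLin ↔ ∀ μ, (fun j => qq p μ (w j)) ∈ LinearMap.ker A.mulVecLin := by
  simp only [LinearMap.mem_ker]
  constructor
  · intro h μ
    funext k
    rw [← qq_mulVec, h]
    simp [qq]
  · intro h
    funext k
    apply qq_ext p
    intro μ
    rw [qq_mulVec, h μ]
    simp [qq]

theorem range_iff {n n' : ℕ} (A : Matrix (Fin n) (Fin n') (MvPolynomial {v // p v} K)) (u : Fin n → MvPolynomial V K) :
    u ∈ LinearMap.range (A.map (rename Subtype.val)).mulVecLin ↔ ∀ μ, (fun j => qq p μ (u j)) ∈ LinearMap.range A.mulVecLin := by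
  constructor
  · rintro ⟨w, rfl⟩ μ
    exact ⟨fun j => qq p μ (w j), by funext k; rw [qq_mulVec]⟩
  · intro h
    choose w hw using h
    let s : Finset ({v // ¬ p v} →₀ ℕ) := Finset.univ.biUnion fun k => (psi p (u k)).support
    refine ⟨fun j => (psi p).symm (∑ μ ∈ s, monomial μ (w μ j)), ?_⟩
    funext k
    apply qq_ext p
    intro μ
    rw [qq_mulVec]
    have : (fun j => qq p μ ((psi p).symm (∑ μ ∈ s, monomial μ (w μ j)))) = if μ ∈ s then w μ else 0 := by
      funext j
      rw [qq, AlgEquiv.apply_symm_apply, coeff_sum]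
      simp only [coeff_monomial]
      rw [Finset.sum_ite_eq']
      split_ifs <;> rfl
    rw [this]
    split_ifs with h
    · rw [hw]
    · have h2 : coeff μ (psi p (u k)) = 0 := by
        by_contra h3
        exact h (Finset.mem_biUnion.2 ⟨k, Finset.mem_univ _, mem_support_iff.2 h3⟩)
      rw [map_zero]; exact h2.symm

theorem mem_map_iff (I : Ideal (MvPolynomial {v // p v} K)) (f : MvPolynomial V K) :
    f ∈ I.map (rename Subtype.val : MvPolynomial {v // p v} K →ₐ[K] MvPolynomial V K) ↔ ∀ μ, qq p μ f ∈ I := by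
  have h := mem_map_C_iff (σ := {v // ¬ p v}) (I := I) (f := psi p f)
  rw [show (∀ μ, qq p μ f ∈ I) ↔ ∀ μ, coeff μ (psi p f) ∈ I from Iff.rfl, ← h]
  have e : (psi p : MvPolynomial V K ≃ₐ[K] _).toRingEquiv.toRingHom.comp (rename Subtype.val : MvPolynomial {v // p v} K →ₐ[K] MvPolynomial V K).toRingHom = C := by
    apply RingHom.ext
    exact psi_rename p
  constructor
  · intro hf
    have := Ideal.mem_map_of_mem (psi p : MvPolynomial V K ≃ₐ[K] _).toRingEquiv.toRingHom hf
    have h2 := Ideal.map_map (I := I) (rename Subtype.val : MvPolynomial {v // p v} K →ₐ[K] MvPolynomial V K).toRingHom (psi p : MvPolynomial V K ≃ₐ[K] _).toRingEquiv.toRingHom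
    rw [e] at h2
    rw [← h2]
    exact this
  · intro hf
    have h2 := Ideal.map_map (I := I) (C : _ →+* MvPolynomial {v // ¬ p v} (MvPolynomial {v // p v} K)) (psi (K := K) p).symm.toRingEquiv.toRingHom
    have e' : (psi (K := K) p).symm.toRingEquiv.toRingHom.comp (C : _ →+* MvPolynomial {v // ¬ p v} (MvPolynomial {v // p v} K)) =
        (rename Subtype.val : MvPolynomial {v // p v} K →ₐ[K] MvPolynomial V K).toRingHom := by
      apply RingHom.ext
      intro x
      change (psi p).symm (C x) = rename Subtype.val x
      rw [← psi_rename, AlgEquiv.symm_apply_apply]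
    rw [e'] at h2
    have := Ideal.mem_map_of_mem (psi (K := K) p).symm.toRingEquiv.toRingHom hf
    rw [h2] at this
    have e3 : (psi (K := K) p).symm.toRingEquiv.toRingHom ((psi p) f) = f := (psi p).symm_apply_apply f
    rw [e3] at this
    exact this

def baseChange {I : Ideal (MvPolynomial {v // p v} K)} (F : GradedFreeResolution I) :
    GradedFreeResolution (I.map (rename Subtype.val : MvPolynomial {v // p v} K →ₐ[K] MvPolynomial V K)) where
  rank := F.rank
  deg := F.deg
  rank_zero := F.rank_zero
  deg_zero := F.deg_zero
  mat i := (F.mat i).map (rename Subtype.val)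
  homog i k j := by
    rcases F.homog i k j with h | ⟨e, h1, h2⟩
    · left; rw [Matrix.map_apply, h, map_zero]
    · right; exact ⟨e, h1, h2.rename_isHomogeneous⟩
  range_zero f := by
    rw [mem_map_iff, range_iff]
    exact forall_congr' fun μ => F.range_zero _
  isExact i := by
    ext u
    rw [ker_iff, range_iff, F.isExact]

/-- monomial ideals extend -/
theorem map_mono {I0 : Ideal (MvPolynomial {v // p v} K)} {I : Ideal (MvPolynomial V K)} {Q : (V →₀ ℕ) → Prop} 
    (hQ : ∀ m, Q m → Q ((m.comapDomain Subtype.val Subtype.val_injective.injOn : {v // p v} →₀ ℕ).mapDomain Subtype.val))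
    (h0 : ∀ f, f ∈ I0 ↔ ∀ m, coeff m f ≠ 0 → Q (m.mapDomain Subtype.val))
    (hI : ∀ f, f ∈ I ↔ ∀ m, coeff m f ≠ 0 → Q m) :
    I = I0.map (rename Subtype.val : MvPolynomial {v // p v} K →ₐ[K] MvPolynomial V K) := by
  apply le_antisymm
  · intro f hf
    rw [hI] at hf
    rw [f.as_sum]
    apply Ideal.sum_mem
    intro m hm
    have h1 := hQ m (hf m (mem_support_iff.1 hm))
    set m0 : {v // p v} →₀ ℕ := m.comapDomain Subtype.val Subtype.val_injective.injOn with hm0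
    have hle : m0.mapDomain Subtype.val ≤ m := by
      intro v
      by_cases hv : p v
      · have : m0.mapDomain Subtype.val ((⟨v, hv⟩ : {v // p v}) : V) = m0 ⟨v, hv⟩ := Finsupp.mapDomain_apply Subtype.val_injective _ _
        rw [this]; simp [hm0]
      · rw [Finsupp.mapDomain_of_notMem_range]
        · simp
        · rintro ⟨x, rfl⟩; exact hv x.2
    have : monomial m (coeff m f) = monomial (m - m0.mapDomain Subtype.val) (coeff m f) * rename Subtype.val (monomial m0 (1 : K)) := by
      rw [rename_monomial, monomial_mul, tsub_add_cancel_of_le hle, mul_one]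
    rw [this]
    apply Ideal.mul_mem_left
    apply Ideal.mem_map_of_mem
    rw [h0]
    intro m' hm'
    rw [coeff_monomial] at hm'
    split_ifs at hm' with h
    · rw [← h]; exact h1
    · simp at hm'
  · rw [Ideal.map_le_iff_le_comap]
    intro f hf
    rw [Ideal.mem_comap, hI]
    intro m hm
    rw [h0] at hf
    obtain ⟨u, hu, hu2⟩ := coeff_rename_ne_zero _ _ _ hm
    rw [← hu]; exact hf u hu2

end
end ER

namespace ER

open scoped Classical
open EdgeIdealReg

theorem stepB {V K : Type} [Field K] [Fintype V] (rank : ℕ → ℕ) (deg : (i : ℕ) → Fin (rank i) → ℕ)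
    (mat : (i : ℕ) → Matrix (Fin (rank i)) (Fin (rank (i + 1))) (MvPolynomial V K)) (N : ℕ) (d : ℤ)
    (hHM : ∀ i, i ≤ N → HM (deg i) (deg (i + 1)) (mat i))
    (hex : ∀ i, i < N → LinearMap.ker (mat i).mulVecLin = LinearMap.range (mat (i + 1)).mulVecLin)
    (hdeg : ∀ i k, (deg i k : ℤ) ≤ d + i) :
    ∀ j i, i + j ≤ N → ∀ t : ℤ, d + 1 + i + j < t → KV (LinearMap.range (mat i).mulVecLin) (deg i) t j := by
  intro j
  induction j with
  | zero =>
    intro i hi t ht c hc hk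
    obtain ⟨g, hg, hg2⟩ := CH.lift (hHM i (by omega)) hc
    have hkg : kd (K := K) g = 0 := by
      funext τ
      apply Finset.sum_eq_zero
      intro v hv
      have : g (insert v τ) = 0 := by
        by_contra h
        have := hg.card _ h
        simp at this
      rw [this, smul_zero]
    obtain ⟨b, hb, hb2⟩ := KVfree (K := K) (deg := deg (i + 1)) (t := t) (j := 0)
      (Or.inr fun k => by have := hdeg (i + 1) k; push_cast at this ht; omega) g hg hkg
    refine ⟨_, CH.map (hHM i (by omega)) hb, ?_⟩
    rw [kd_map, hb2]
    exact funext hg2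
  | succ j ih =>
    intro i hi t ht c hc hk
    obtain ⟨g, hg, hg2⟩ := CH.lift (hHM i (by omega)) hc
    have hkg : CH (LinearMap.range (mat (i + 1)).mulVecLin) (deg (i + 1)) t j (kd (K := K) g) := by
      refine hg.kd.mono fun σ => ?_
      rw [← hex i (by omega), LinearMap.mem_ker]
      have e1 := congrFun (kd_map (mat i).mulVecLin g) σ
      rw [show (fun σ => (mat i).mulVecLin (g σ)) = c from funext hg2, hk] at e1
      exact e1.symm
    obtain ⟨h, hh, hh2⟩ := ih (i + 1) (by omega) t (by push_cast at ht ⊢; omega) _ hkg (kd_kd g)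
    obtain ⟨b, hb, hb2⟩ := KVfree (K := K) (deg := deg (i + 1)) (t := t) (j := j + 1) (Or.inl (by omega)) (g - h)
      (hg.sub (hh.mono fun _ => trivial)) (by rw [kd_sub, hh2, sub_self])
    refine ⟨_, CH.map (hHM i (by omega)) hb, ?_⟩
    rw [kd_map, hb2]
    funext σ
    have : (mat i).mulVecLin (h σ) = 0 := by
      have := hh.mem σ
      rw [← hex i (by omega)] at this
      exact this
    rw [Pi.sub_apply, map_sub, this, sub_zero, hg2]

theorem killCompl_mulVec {V K : Type} [Field K] {U : Finset V} {n n' : ℕ} (A : Matrix (Fin n) (Fin n') (MvPolynomial {v // v ∈ U} K))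
    (A' : Matrix (Fin n) (Fin n') (MvPolynomial V K)) (hA : ∀ k j, rename Subtype.val (A k j) = A' k j) (w : Fin n' → MvPolynomial V K) :
    A.mulVecLin (fun j => killCompl Subtype.val_injective (w j)) = fun k => killCompl Subtype.val_injective (A'.mulVecLin w k) := by
  funext k
  simp only [Matrix.mulVecLin_apply, Matrix.mulVec, dotProduct, map_sum, map_mul, ← hA, killCompl_rename_app]

theorem rename_mulVec {V K : Type} [Field K] {U : Finset V} {n n' : ℕ} (A : Matrix (Fin n) (Fin n') (MvPolynomial {v // v ∈ U} K))
    (A' : Matrix (Fin n) (Fin n') (MvPolynomial V K)) (hA : ∀ k j, rename Subtype.val (A k j) = A' k j) (w : Fin n' → MvPolynomial {v // v ∈ U} K) :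
    A'.mulVecLin (fun j => rename Subtype.val (w j)) = fun k => rename Subtype.val (A.mulVecLin w k) := by
  funext k
  simp only [Matrix.mulVecLin_apply, Matrix.mulVec, dotProduct, map_sum, map_mul, ← hA]

theorem hom.of_rename {V U K : Type} [Field K] {ι : U → V} (hι : Function.Injective ι) {z : ℤ} {f : MvPolynomial U K}
    (h : hom z (rename ι f)) : hom z f := by
  intro m hm
  have := h (m.mapDomain ι) (by rwa [coeff_rename_mapDomain _ hι])
  rw [← this]
  rw [Finsupp.degree_mapDomain]

theorem kv_exact {W K : Type} [Field K] [Fintype W] {Q : (W →₀ ℕ) → Prop} {n : ℕ} (hn : n = 1)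
    {M : Submodule (MvPolynomial W K) (Fin n → MvPolynomial W K)} {deg : Fin n → ℕ} (hdeg : ∀ k, deg k = 0)
    (hM : ∀ f : MvPolynomial W K, (fun _ => f) ∈ M ↔ ∀ m, coeff m f ≠ 0 → Q m)
    (a : W →₀ ℕ) (j : ℕ) (hKV : KV M deg (a.degree : ℤ) j) : ∀ c : Finset W → K,
      Adm Q a j c → bd a.support c = 0 →
      ∃ b : Finset W → K, Adm Q a (j + 1) b ∧ bd a.support b = c := by
  intro c hc hbd
  have h1n : ∀ k : Fin n, k = ⟨0, by omega⟩ := by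
    intro k; ext; have := k.2; simp only; omega
  -- chain of monomials
  set t : ℤ := (a.degree : ℤ) with ht
  have key : ∀ (e : Finset W → MvPolynomial W K) (τ : Finset W), τ ⊆ a.support →
      coeff (a - ind τ) (kd (K := K) e τ) = bd a.support (fun σ => if σ ⊆ a.support then coeff (a - ind σ) (e σ) else 0) τ :=
    fun e τ hτ => coeff_kd e a τ hτ
  set cc : Finset W → MvPolynomial W K := fun σ => monomial (a - ind σ) (c σ) with hcc
  have hdega : ∀ σ, c σ ≠ 0 → (((a - ind σ).degree : ℕ) : ℤ) = t - j := by
    intro σ hσ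
    obtain ⟨h1, h2, -⟩ := hc σ hσ
    have := congrArg Finsupp.degree (tsub_add_cancel_of_le (ind_le h1))
    rw [map_add, degree_ind, h2] at this
    omega
  have hkd : kd (K := K) cc = 0 := by
    funext τ
    by_cases hτ : τ ⊆ a.support
    · have : kd (K := K) cc τ = monomial (a - ind τ) (bd a.support c τ) := by
        unfold kd bd
        rw [map_sum]
        symm
        have hsub : a.support \ τ ⊆ Finset.univ \ τ := Finset.sdiff_subset_sdiff (Finset.subset_univ _) subset_rfl
        have hev : ∀ v ∈ a.support \ τ, (monomial (a - ind τ)) (sgn K v τ * c (insert v τ)) =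
            (C (sgn K v τ) * X v : MvPolynomial W K) • cc (insert v τ) := by
          intro v hv
          rw [Finset.mem_sdiff] at hv
          rw [smul_eq_mul, hcc, C_mul_X_eq_monomial, monomial_mul]
          congr 2
          rw [ind_insert hv.2, tsub_add_eq_tsub_tsub, add_comm, tsub_add_cancel_of_le]
          intro w
          have := hv.1
          rw [Finsupp.single_apply]
          split_ifs with h
          · subst h
            simp [ind_apply, hv.2] at this ⊢
            omega
          · simp
        rw [Finset.sum_congr rfl hev]
        apply Finset.sum_subset hsub
        intro v hv hv'
        have : c (insert v τ) = 0 := by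
          by_contra h
          have := (hc _ h).1 (Finset.mem_insert_self v τ)
          simp only [Finset.mem_sdiff, Finset.mem_univ, true_and] at hv hv'
          exact hv' ⟨this, hv⟩
        rw [hcc]; simp [this]
      rw [this, hbd]; simp
    · apply Finset.sum_eq_zero
      intro v hv
      have : c (insert v τ) = 0 := by
        by_contra h
        exact hτ ((Finset.subset_insert _ _).trans (hc _ h).1)
      rw [hcc]; simp [this]
  obtain ⟨b, hb, hb2⟩ := hKV (fun σ _ => cc σ) (by
    refine ⟨fun σ hσ => ?_, fun σ => ?_, fun σ k => ?_⟩
    · have : c σ ≠ 0 := by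
        intro h; apply hσ; funext k; simp [hcc, h]
      exact (hc σ this).2.1
    · rw [hM]
      intro m hm
      simp only [hcc, coeff_monomial] at hm
      split_ifs at hm with h
      · rw [← h]; exact (hc σ hm).2.2
      · simp at hm
    · by_cases h : c σ = 0
      · simp only [hcc, h, map_zero]; exact hom.zero _
      · rw [hdeg, Nat.cast_zero, sub_zero, ← hdega σ h]
        exact hom.monomial) (by
    funext τ k
    have := congrFun hkd τ
    simpa [kd, Finset.sum_apply] using this)
  set k0 : Fin n := ⟨0, by omega⟩ with hk0
  have hbk : ∀ σ, b σ = fun _ => b σ k0 := by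
    intro σ; funext k; rw [h1n k]
  refine ⟨fun σ => if σ ⊆ a.support then coeff (a - ind σ) (b σ k0) else 0, ?_, ?_⟩
  · intro σ hσ
    beta_reduce at hσ
    split_ifs at hσ with h
    · refine ⟨h, hb.card σ ?_, ?_⟩
      · intro h'; apply hσ; rw [h']; simp
      · have := hb.mem σ
        rw [hbk, hM] at this
        exact this _ hσ
    · simp at hσ
  · funext τ
    by_cases hτ : τ ⊆ a.support
    · rw [← key (fun σ => b σ k0) τ hτ]
      have := congrFun (congrFun hb2 τ) k0
      have e : kd (K := K) (fun σ => b σ k0) τ = cc τ := by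
        rw [← this]; simp [kd, Finset.sum_apply]
      rw [e, hcc]; simp
    · have : c τ = 0 := by
        by_contra h; exact hτ (hc τ h).1
      rw [this]
      apply Finset.sum_eq_zero
      intro v hv
      beta_reduce
      rw [if_neg, mul_zero]
      exact fun h => hτ ((Finset.subset_insert _ _).trans h)

/-- truncated descent and Koszul vanishing -/
theorem descent {V K : Type} [Field K] {I : Ideal (MvPolynomial V K)} {Q : (V →₀ ℕ) → Prop}
    (hI : ∀ f, f ∈ I ↔ ∀ m, coeff m f ≠ 0 → Q m) (F : GradedFreeResolution I) {d : ℤ}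
    (hdeg : ∀ i k, (F.deg i k : ℤ) ≤ d + i) (N : ℕ) (U0 : Finset V) :
    ∃ U : Finset V, U0 ⊆ U ∧ ∀ (a : {v // v ∈ U} →₀ ℕ) (j : ℕ), j ≤ N → d + 1 + j < (a.degree : ℤ) → ∀ c : Finset {v // v ∈ U} → K,
      Adm (fun m => Q (m.mapDomain Subtype.val)) a j c → bd a.support c = 0 →
      ∃ b : Finset {v // v ∈ U} → K, Adm (fun m => Q (m.mapDomain Subtype.val)) a (j + 1) b ∧ bd a.support b = c := by
  set U : Finset V := U0 ∪ (Finset.range (N + 1)).biUnion fun i => Finset.univ.biUnion fun k => Finset.univ.biUnion fun j => (F.mat i k j).vars with hU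
  refine ⟨U, Finset.subset_union_left, ?_⟩
  have hv : ∀ i, i ≤ N → ∀ k j, (F.mat i k j).vars ⊆ U := by
    intro i hi k j v hv
    rw [hU, Finset.mem_union]
    right
    simp only [Finset.mem_biUnion, Finset.mem_range, Finset.mem_univ, true_and]
    exact ⟨i, by omega, k, j, hv⟩
  clear_value U
  let mat : (i : ℕ) → Matrix (Fin (F.rank i)) (Fin (F.rank (i + 1))) (MvPolynomial {v // v ∈ U} K) :=
    fun i k j => killCompl Subtype.val_injective (F.mat i k j)
  have hmat : ∀ i, i ≤ N → ∀ k j, rename Subtype.val (mat i k j) = F.mat i k j := by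
    intro i hi k j
    obtain ⟨q, hq⟩ := exists_rename_eq_of_vars_subset_range (F.mat i k j) (Subtype.val : {v // v ∈ U} → V) Subtype.val_injective
      (fun v h => ⟨⟨v, hv i hi k j h⟩, rfl⟩)
    simp only [mat]
    rw [← hq, killCompl_rename_app]
  have kr : ∀ {n : ℕ} (u : Fin n → MvPolynomial {v // v ∈ U} K), (fun j => killCompl Subtype.val_injective (rename Subtype.val (u j))) = u := by
    intro n u; funext j; rw [killCompl_rename_app]
  have hHM : ∀ i, i ≤ N → HM (F.deg i) (F.deg (i + 1)) (mat i) := by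
    intro i hi k j
    have := HM.of_homog (F.homog i) k j
    rw [← hmat i hi] at this
    exact this.of_rename Subtype.val_injective
  have hex : ∀ i, i < N → LinearMap.ker (mat i).mulVecLin = LinearMap.range (mat (i + 1)).mulVecLin := by
    intro i hi
    ext u
    constructor
    · intro hu
      rw [LinearMap.mem_ker] at hu
      have h1 : (fun j => rename Subtype.val (u j)) ∈ LinearMap.ker (F.mat i).mulVecLin := by
        rw [LinearMap.mem_ker, rename_mulVec _ _ (hmat i (by omega)), hu]
        funext k; simp
      rw [F.isExact] at h1
      obtain ⟨w, hw⟩ := h1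
      refine ⟨_, (killCompl_mulVec _ _ (hmat (i + 1) (by omega)) w).trans ?_⟩
      rw [hw, kr]
    · rintro ⟨w, rfl⟩
      rw [LinearMap.mem_ker]
      have h1 : (fun j => rename Subtype.val ((mat (i + 1)).mulVecLin w j)) ∈ LinearMap.ker (F.mat i).mulVecLin := by
        rw [F.isExact, ← rename_mulVec _ _ (hmat (i + 1) (by omega))]
        exact ⟨_, rfl⟩
      rw [LinearMap.mem_ker, rename_mulVec _ _ (hmat i (by omega))] at h1
      funext k
      have := congrFun h1 k
      exact rename_injective _ Subtype.val_injective (this.trans (map_zero _).symm)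
  have hM : ∀ f : MvPolynomial {v // v ∈ U} K, (fun _ => f) ∈ LinearMap.range (mat 0).mulVecLin ↔ ∀ m, coeff m f ≠ 0 → Q (m.mapDomain Subtype.val) := by
    intro f
    have e : rename Subtype.val f ∈ I ↔ ∀ m, coeff m f ≠ 0 → Q (m.mapDomain Subtype.val) := by
      rw [hI]
      constructor
      · intro h m hm
        exact h _ (by rwa [coeff_rename_mapDomain _ Subtype.val_injective])
      · intro h m hm
        obtain ⟨u, hu, hu2⟩ := coeff_rename_ne_zero _ _ _ hm
        rw [← hu]; exact h u hu2
    rw [← e, F.range_zero]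
    constructor
    · rintro ⟨w, hw⟩
      exact ⟨_, (rename_mulVec _ _ (hmat 0 (by omega)) w).trans (by rw [hw])⟩
    · rintro ⟨w, hw⟩
      refine ⟨_, (killCompl_mulVec _ _ (hmat 0 (by omega)) w).trans ?_⟩
      rw [hw]
      exact kr (fun _ => f)
  have hKV := stepB F.rank F.deg mat N d hHM hex hdeg
  intro a j hj had
  exact kv_exact F.rank_zero F.deg_zero hM a j (hKV j 0 (by omega) _ (by push_cast; omega))

end ER

namespace ER

open scoped Classical
open EdgeIdealReg

section
variable {V K : Type} [Field K] {G : SimpleGraph V}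

def th (K : Type) [Field K] {V : Type} (c : Finset V) :
    MvPolynomial V K →ₐ[K] Polynomial (MvPolynomial V K) :=
  aeval (fun v => if v ∈ c then Polynomial.X * Polynomial.C (X v) else Polynomial.C (X v))

theorem th_monomial (c : Finset V) (m : V →₀ ℕ) (a : K) :
    th K c (monomial m a) =
      Polynomial.X ^ (∑ v ∈ c, m v) * Polynomial.C (monomial m a) := by
  have h : ∀ v : V, (if v ∈ c then Polynomial.X * Polynomial.C (X v) else Polynomial.C (X v) :
      Polynomial (MvPolynomial V K)) =
      Polynomial.X ^ (if v ∈ c then 1 else 0) * Polynomial.C (X v) := by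
    intro v; split_ifs <;> simp
  unfold th
  rw [aeval_monomial, Finsupp.prod]
  simp_rw [h, mul_pow, ← pow_mul]
  rw [Finset.prod_mul_distrib, Finset.prod_pow_eq_pow_sum]
  have h1 : ∑ i ∈ m.support, (if i ∈ c then 1 else 0) * m i = ∑ v ∈ c, m v := by
    simp_rw [ite_mul, one_mul, zero_mul]
    rw [← Finset.sum_filter]
    apply Finset.sum_subset_zero_on_sdiff
    · intro v hv; simp at hv; exact hv.2
    · intro v hv; simp at hv; by_contra h0; exact hv.2 h0 hv.1
    · intros; rfl
  rw [h1, monomial_eq, Finsupp.prod]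
  simp only [map_mul, map_prod, map_pow]
  rw [← mul_assoc, mul_comm (algebraMap _ _ a), mul_assoc]
  rfl

theorem th_coeff (c : Finset V) (f : MvPolynomial V K) (k : ℕ) (m : V →₀ ℕ) :
    coeff m ((th K c f).coeff k) = if ∑ v ∈ c, m v = k then coeff m f else 0 := by
  induction f using MvPolynomial.monomial_add_induction_on with
  | C a =>
    have := th_monomial c 0 a
    rw [show (C a : MvPolynomial V K) = monomial 0 a from rfl, this, Polynomial.coeff_X_pow_mul']
    simp only [coeff_monomial]
    by_cases h : (0 : V →₀ ℕ) = m
    · subst h; by_cases h2 : 0 = k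
      · subst h2; simp
      · have : k ≠ 0 := Ne.symm h2
        simp [h2, Polynomial.coeff_C, this]
    · simp [Polynomial.coeff_C]
      split_ifs <;> simp [*]
  | monomial_add m' a f h1 h2 ih =>
    rw [map_add, Polynomial.coeff_add, coeff_add, ih, th_monomial, Polynomial.coeff_X_pow_mul',
      coeff_add, coeff_monomial]
    by_cases h : m' = m
    · subst h
      by_cases h2 : ∑ v ∈ c, m' v = k
      · subst h2; simp
      · rw [if_neg h2, if_neg h2, add_zero]
        split_ifs with h3
        · rw [Polynomial.coeff_C, if_neg (by omega)]; simp
        · simp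
    · rw [if_neg h, zero_add]
      have : coeff m (if ∑ v ∈ c, m' v ≤ k then
          (Polynomial.C (monomial m' a)).coeff (k - ∑ v ∈ c, m' v) else 0) = 0 := by
        split_ifs with h3
        · rw [Polynomial.coeff_C]; split_ifs <;> simp [coeff_monomial, h]
        · simp
      rw [this, zero_add]

theorem th_dvd (c : Finset V) (f : MvPolynomial V K) (r : ℕ) :
    Polynomial.X ^ r ∣ th K c f ↔ ∀ m, coeff m f ≠ 0 → r ≤ ∑ v ∈ c, m v := by
  rw [Polynomial.X_pow_dvd_iff]
  constructor
  · intro h m hm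
    by_contra hlt
    push Not at hlt
    have h1 := th_coeff c f (∑ v ∈ c, m v) m
    rw [h _ hlt, if_pos rfl] at h1
    exact hm (by rw [← h1]; simp)
  · intro h k hk
    ext m
    rw [th_coeff]
    split_ifs with h1
    · by_contra h2
      have := h m (by simpa using h2)
      omega
    · simp

def Pc (K : Type) [Field K] {V : Type} (c : Finset V) : Ideal (MvPolynomial V K) :=
  (Ideal.span {Polynomial.X}).comap (th K c)

theorem mem_Pc (c : Finset V) (f : MvPolynomial V K) :
    f ∈ Pc K c ↔ Polynomial.X ∣ th K c f := by
  unfold Pc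
  rw [Ideal.mem_comap, Ideal.mem_span_singleton]

theorem mem_Pc' (c : Finset V) (f : MvPolynomial V K) :
    f ∈ Pc K c ↔ ∀ m, coeff m f ≠ 0 → 1 ≤ ∑ v ∈ c, m v := by
  rw [mem_Pc, ← th_dvd, pow_one]

instance Pc_prime (c : Finset V) : (Pc K c).IsPrime := by
  have : (Ideal.span {(Polynomial.X : Polynomial (MvPolynomial V K))}).IsPrime := by
    rw [Ideal.span_singleton_prime Polynomial.X_ne_zero]
    exact Polynomial.prime_X
  exact Ideal.IsPrime.comap _

theorem X_mem_Pc (c : Finset V) (v : V) : (X v : MvPolynomial V K) ∈ Pc K c ↔ v ∈ c := by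
  rw [mem_Pc']
  constructor
  · intro h
    have := h (Finsupp.single v 1) (by simp)
    by_contra hv
    rw [Finset.sum_eq_zero] at this
    · omega
    · intro u hu
      rw [Finsupp.single_apply, if_neg]
      rintro rfl; exact hv hu
  · intro h m hm
    have hm' : Finsupp.single v 1 = m := by
      by_contra h2; rw [coeff_X, if_neg h2] at hm; exact hm rfl
    subst hm'
    refine le_trans ?_ (Finset.single_le_sum (f := fun u => Finsupp.single v 1 u)
      (fun _ _ => Nat.zero_le _) h)
    simp

theorem Pc_le {c : Finset V} {I : Ideal (MvPolynomial V K)} (h : ∀ v ∈ c, X v ∈ I) :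
    Pc K c ≤ I := by
  intro f hf
  rw [mem_Pc'] at hf
  rw [f.as_sum]
  apply Ideal.sum_mem
  intro m hm
  have := hf m (mem_support_iff.1 hm)
  obtain ⟨v, hv, hv1⟩ : ∃ v ∈ c, m v ≠ 0 := by
    by_contra hcon; push Not at hcon
    rw [Finset.sum_eq_zero hcon] at this; omega
  have h2 : (X v : MvPolynomial V K) ∣ monomial m (coeff m f) := by
    rw [X_dvd_monomial]; exact Or.inr hv1
  exact Ideal.mem_of_dvd _ h2 (h v hv)

variable {X0 : Finset V}

theorem I_le_iff {I : Ideal (MvPolynomial V K)} [I.IsPrime] :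
    edgeIdeal K G ≤ I ↔ ∀ u v, G.Adj u v → X u ∈ I ∨ X v ∈ I := by
  unfold edgeIdeal
  rw [Ideal.span_le]
  constructor
  · intro h u v huv
    exact Ideal.IsPrime.mem_or_mem ‹_› (h ⟨u, v, huv, rfl⟩)
  · rintro h _ ⟨u, v, huv, rfl⟩
    rcases h u v huv with h | h
    · exact Ideal.mul_mem_right _ _ h
    · exact Ideal.mul_mem_left _ _ h

theorem I_le_Pc (hX0 : ∀ u v, G.Adj u v → u ∈ X0) {c : Finset V} : edgeIdeal K G ≤ Pc K c ↔ Cov G X0 c := by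
  rw [I_le_iff]
  simp only [X_mem_Pc]
  exact ⟨fun h u _ v _ huv => h u v huv, fun h u v huv => h u (hX0 u v huv) v (hX0 v u huv.symm) huv⟩

theorem minp (hX0 : ∀ u v, G.Adj u v → u ∈ X0) {p : Ideal (MvPolynomial V K)} (hp : p ∈ (edgeIdeal K G).minimalPrimes) :
    ∃ c : Finset V, p = Pc K c ∧ c ⊆ X0 ∧ Cov G X0 c ∧
      ∀ v ∈ c, ∃ w, w ∉ c ∧ G.Adj v w := by
  have hpp := hp.1.1
  have hmin : ∀ c : Finset V, Cov G X0 c → (∀ v ∈ c, X v ∈ p) → p = Pc K c := by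
    intro c hc h
    have h1 := Pc_le h
    exact le_antisymm (hp.2 ⟨Pc_prime c, (I_le_Pc hX0).2 hc⟩ h1) h1
  set c := X0.filter (fun v => X v ∈ p) with hc
  have hcov : Cov G X0 c := by
    intro u hu v hv huv
    have := (I_le_iff (I := p)).1 hp.1.2 u v huv
    simp only [hc, Finset.mem_filter]; tauto
  have e := hmin c hcov (fun v hv => (Finset.mem_filter.1 hv).2)
  refine ⟨c, e, Finset.filter_subset _ _, hcov, ?_⟩
  intro v hv
  by_contra hcon
  push Not at hcon
  have hc2 : Cov G X0 (c.erase v) := by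
    intro a ha b hb hab
    simp only [Finset.mem_erase]
    by_cases h1 : a = v
    · subst h1
      right
      refine ⟨hab.ne', ?_⟩
      by_contra h; exact hcon b h hab
    by_cases h2 : b = v
    · subst h2
      left
      refine ⟨h1, ?_⟩
      by_contra h; exact hcon a h hab.symm
    have := hcov a ha b hb hab
    tauto
  have e2 := hmin (c.erase v) hc2 (fun u hu => (Finset.mem_filter.1 (Finset.mem_of_mem_erase hu)).2)
  have h3 : (X v : MvPolynomial V K) ∈ Pc K (c.erase v) := by
    rw [← e2]; exact (Finset.mem_filter.1 hv).2
  rw [X_mem_Pc] at h3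
  simp at h3

theorem mem_edgeIdeal (hX0 : ∀ u v, G.Adj u v → u ∈ X0) (f : MvPolynomial V K) :
    f ∈ edgeIdeal K G ↔ ∀ m, coeff m f ≠ 0 → J G X0 1 m := by
  have e : edgeIdeal K G = Ideal.span ((fun s => monomial s (1 : K)) ''
      {s | ∃ u v, G.Adj u v ∧ s = Finsupp.single u 1 + Finsupp.single v 1}) := by
    unfold edgeIdeal
    congr 1
    ext q
    constructor
    · rintro ⟨u, v, h, rfl⟩
      exact ⟨_, ⟨u, v, h, rfl⟩, by simp [X, monomial_mul]⟩
    · rintro ⟨_, ⟨u, v, h, rfl⟩, rfl⟩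
      exact ⟨u, v, h, by simp [X, monomial_mul]⟩
  rw [e, mem_ideal_span_monomial_image]
  apply forall_congr'
  intro m
  rw [mem_support_iff]
  apply imp_congr_right
  intro _
  constructor
  · rintro ⟨_, ⟨u, v, h, rfl⟩, hle⟩ p hp
    have hu : 1 ≤ m u := by
      have := hle u
      simp at this; omega
    have hv : 1 ≤ m v := by
      have := hle v
      simp at this; omega
    have hu0 := hX0 u v h
    have hv0 := hX0 v u h.symm
    rcases hp u hu0 v hv0 h with h1 | h1
    · exact hu.trans (Finset.single_le_sum (f := fun u => m u) (fun _ _ => Nat.zero_le _)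
        (Finset.mem_inter.2 ⟨hu0, h1⟩))
    · exact hv.trans (Finset.single_le_sum (f := fun u => m u) (fun _ _ => Nat.zero_le _)
        (Finset.mem_inter.2 ⟨hv0, h1⟩))
  · intro h
    by_cases hc : Cov G X0 (X0 \ m.support)
    · have := h _ hc
      rw [Finset.sum_eq_zero] at this
      · omega
      · intro v hv
        simp at hv; exact hv.2
    · unfold Cov at hc
      push Not at hc
      obtain ⟨u, hu, v, hv, huv, h1, h2⟩ := hc
      refine ⟨_, ⟨u, v, huv, rfl⟩, ?_⟩
      intro x
      simp [hu, hv] at h1 h2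
      have := huv.ne
      simp only [Finsupp.add_apply, Finsupp.single_apply]
      split_ifs with h3 h4 h4
      · exact absurd (h3.trans h4.symm) this
      · subst h3; omega
      · subst h4; omega
      · omega

theorem mem_symb (hX0 : ∀ u v, G.Adj u v → u ∈ X0) (r : ℕ) (f : MvPolynomial V K) :
    f ∈ symbolicPower (edgeIdeal K G) r ↔ ∀ m, coeff m f ≠ 0 → J G X0 r m := by
  constructor
  · intro hf m hm q hq
    have hq' : Cov G X0 (X0 ∩ q) := by
      intro u hu v hv huv
      have := hq u hu v hv huv
      simp only [Finset.mem_inter]; tauto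
    obtain ⟨p, hp, hpq⟩ := Ideal.exists_minimalPrimes_le ((I_le_Pc (K := K) hX0).2 hq')
    obtain ⟨c, rfl, hc0, hc, -⟩ := minp hX0 hp
    have hcq : c ⊆ X0 ∩ q := by
      intro v hv
      rw [← X_mem_Pc (K := K)]
      exact hpq ((X_mem_Pc _ _).2 hv)
    obtain ⟨s, hs, hsf⟩ := hf _ hp
    have h1 : Polynomial.X ^ r ∣ th K c (s * f) := by
      have h2 : (edgeIdeal K G).map (th K c) ≤ Ideal.span {Polynomial.X} := by
        rw [Ideal.map_le_iff_le_comap]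
        exact (I_le_Pc hX0).2 hc
      have h3 := Ideal.mem_map_of_mem (th K c) hsf
      rw [Ideal.map_pow] at h3
      have h4 := Ideal.pow_right_mono h2 r h3
      rw [Ideal.span_singleton_pow, Ideal.mem_span_singleton] at h4
      exact h4
    rw [map_mul] at h1
    have h2 := Polynomial.prime_X.pow_dvd_of_dvd_mul_left r (by rwa [mem_Pc] at hs) h1
    exact ((th_dvd _ _ _).1 h2 m hm).trans (Finset.sum_le_sum_of_subset hcq)
  · intro hf p hp
    obtain ⟨c, rfl, hc0, hc, hw⟩ := minp hX0 hp
    choose! w hw1 hw2 using hw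
    refine ⟨∏ v ∈ c, X (w v) ^ r, ?_, ?_⟩
    · intro h
      obtain ⟨v, hv, h1⟩ := (Ideal.IsPrime.prod_mem_iff (p := Pc K c)).1 h
      have := Ideal.IsPrime.mem_of_pow_mem inferInstance r h1
      rw [X_mem_Pc] at this
      exact hw1 v hv this
    · rw [f.as_sum, Finset.mul_sum]
      apply Ideal.sum_mem
      intro m hm
      have hJ := hf m (mem_support_iff.1 hm) c hc
      rw [Finset.inter_eq_right.2 hc0] at hJ
      have hd : ∏ v ∈ c, X v ^ m v ∣ monomial m (coeff m f) := by
        have e : (∏ v ∈ c, (X v : MvPolynomial V K) ^ m v) =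
            monomial (m.filter (fun v => v ∈ c)) 1 := by
          rw [monomial_eq, map_one, one_mul, Finsupp.prod, Finsupp.support_filter]
          symm
          apply Finset.prod_subset_one_on_sdiff
          · intro v hv; simp at hv; exact hv.2
          · intro v hv; simp at hv
            have : m v = 0 := by by_contra h; exact hv.2 h hv.1
            rw [this, pow_zero]
          · intro v hv; simp at hv
            rw [Finsupp.filter_apply_pos _ _ hv.2]
        rw [e, monomial_dvd_monomial]
        refine ⟨Or.inr fun v => ?_, one_dvd _⟩
        rw [Finsupp.filter_apply]; split_ifs <;> simp
      have hd2 := mul_dvd_mul_left (∏ v ∈ c, (X (w v) : MvPolynomial V K) ^ r) hd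
      refine Ideal.mem_of_dvd _ hd2 ?_
      rw [← Finset.prod_mul_distrib]
      have h5 : ∏ v ∈ c, ((X (w v) : MvPolynomial V K) ^ r * X v ^ m v) ∈
          ∏ v ∈ c, (edgeIdeal K G) ^ (min r (m v)) := by
        apply Ideal.prod_mem_prod
        intro v hv
        have h6 : (X (w v) * X v : MvPolynomial V K) ^ (min r (m v)) ∈
            (edgeIdeal K G) ^ (min r (m v)) :=
          Ideal.pow_mem_pow (by
            unfold edgeIdeal
            exact Ideal.subset_span ⟨w v, v, (hw2 v hv).symm, rfl⟩) _
        refine Ideal.mem_of_dvd _ ?_ h6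
        rw [mul_pow]
        exact mul_dvd_mul (pow_dvd_pow _ (min_le_left _ _)) (pow_dvd_pow _ (min_le_right _ _))
      rw [Finset.prod_pow_eq_pow_sum] at h5
      refine Ideal.pow_le_pow_right ?_ h5
      by_cases hb : ∃ v ∈ c, r ≤ m v
      · obtain ⟨v, hv, hle⟩ := hb
        refine le_trans ?_ (Finset.single_le_sum (f := fun v => min r (m v))
          (fun _ _ => Nat.zero_le _) hv)
        simp [hle]
      · push Not at hb
        rw [Finset.sum_congr rfl (fun v hv => min_eq_right (hb v hv).le)]
        exact hJ

end
end ER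

namespace ER

open scoped Classical
open EdgeIdealReg

section
variable {V K : Type} [Field K] {G : SimpleGraph V}

theorem op_add (v : V) (c c' : Finset V → K) : op v (c + c') = op v c + op v c' := by
  funext σ; simp only [op, Pi.add_apply]; split_ifs <;> ring

theorem op_zero (v : V) : op v (0 : Finset V → K) = 0 := by
  funext σ; simp [op]

theorem op_sub (v : V) (c c' : Finset V → K) : op v (c - c') = op v c - op v c' := by
  funext σ; simp only [op, Pi.sub_apply]; split_ifs <;> ring

theorem op_neg (v : V) (c : Finset V → K) : op v (-c) = - op v c := by
  funext σ; simp only [op, Pi.neg_apply]; split_ifs <;> ring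

theorem op_op (v : V) (c : Finset V → K) : op v (op v c) = 0 := by
  funext σ; simp [op]

theorem op_anti {u v : V} (huv : u ≠ v) (c : Finset V → K) :
    op u (op v c) = - op v (op u c) := by
  funext σ
  simp only [op, Pi.neg_apply, Finset.mem_erase]
  by_cases hu : u ∈ σ <;> by_cases hv : v ∈ σ
  · have e : (σ.erase v).erase u = (σ.erase u).erase v := Finset.erase_right_comm
    set τ := (σ.erase u).erase v with hτ
    have hu' : u ∉ τ := by simp [hτ]
    have hv' : v ∉ τ := by simp [hτ]
    have e1 : σ.erase u = insert v τ := by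
      rw [hτ, Finset.insert_erase]; simp [hv, huv.symm]
    have e2 : σ.erase v = insert u τ := by
      rw [← e, Finset.insert_erase]; simp [hu, huv]
    have h := sgn_anti (K := K) u v τ huv hu' hv'
    rw [if_pos hu, if_pos ⟨huv.symm, hv⟩, if_pos hv, if_pos ⟨huv, hu⟩, e, e1, e2]
    have h3 := sgn_anti (K := K) u v τ huv hu' hv'
    linear_combination (c τ) * h3
  · simp [hv]
  · simp [hu]
  · simp [hu, hv]

def E (U : Finset V) (c : Finset V → K) : Finset V → K := ∑ v ∈ U, op v c

theorem E_insert {U : Finset V} {v : V} (hv : v ∉ U) (c : Finset V → K) :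
    E (insert v U) c = op v c + E U c := by
  unfold E; rw [Finset.sum_insert hv]

theorem E_add (U : Finset V) (c c' : Finset V → K) : E U (c + c') = E U c + E U c' := by
  unfold E; simp_rw [op_add]; rw [Finset.sum_add_distrib]

theorem E_op {U : Finset V} {v : V} (hv : v ∉ U) (c : Finset V → K) :
    E U (op v c) = - op v (E U c) := by
  unfold E
  induction U using Finset.induction_on with
  | empty => simp [op_zero]
  | insert u U hu ih =>
    have h1 : v ≠ u := by rintro rfl; simp at hv
    have h2 : v ∉ U := by intro h; exact hv (Finset.mem_insert_of_mem h)
    rw [Finset.sum_insert hu, Finset.sum_insert hu, op_add, ih h2, op_anti h1.symm]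
    abel

theorem E_in {U : Finset V} {v : V} (hv : v ∉ U) {c : Finset V → K} (h : E U c = 0) :
    E (insert v U) (op v c) = 0 := by
  rw [E_insert hv, E_op hv, h, op_op, op_zero]; simp

theorem E_edge {U : Finset V} {u v : V} (hu : u ∉ U) (hv : v ∉ U) (huv : u ≠ v)
    {c : Finset V → K} (h : E U c = 0) :
    E (insert u (insert v U)) (op u c + op v c) = 0 := by
  rw [E_insert (by simp [hu, huv]), E_insert hv, E_add, E_op hv, E_op hu, h]
  simp only [op_add, op_op, op_zero]
  rw [op_anti huv]; abel

def Sp (G : SimpleGraph V) (U : Finset V) (D : Set V) (c : Finset V → K) : Prop :=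
  ∀ σ, c σ ≠ 0 → σ ⊆ U ∧ (∀ v ∈ D, v ∈ σ) ∧ ∀ x ∈ U, ∀ y ∈ U, x ∉ σ → y ∉ σ → ¬ G.Adj x y

theorem Sp.add {U : Finset V} {D : Set V} {c c' : Finset V → K} (h : Sp G U D c)
    (h' : Sp G U D c') : Sp G U D (c + c') := by
  intro σ hσ
  by_cases h1 : c σ = 0
  · exact h' σ (by intro h2; apply hσ; simp [h1, h2])
  · exact h σ h1

theorem Sp.weak {U : Finset V} {D D' : Set V} {c : Finset V → K} (h : Sp G U D c)
    (hD : D' ⊆ D) : Sp G U D' c := by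
  intro σ hσ
  obtain ⟨h1, h2, h3⟩ := h σ hσ
  exact ⟨h1, fun v hv => h2 v (hD hv), h3⟩

theorem Sp.inn {U : Finset V} {D : Set V} {c : Finset V → K} (h : Sp G U D c) (v : V)
    (hv : v ∉ U) : Sp G (insert v U) (insert v D) (op v c) := by
  intro σ hσ
  unfold op at hσ
  split_ifs at hσ with h1
  · obtain ⟨h2, h3, h4⟩ := h (σ.erase v) (by intro h0; apply hσ; rw [h0, mul_zero])
    refine ⟨?_, ?_, ?_⟩
    · intro x hx
      by_cases hxv : x = v
      · simp [hxv]
      · exact Finset.mem_insert_of_mem (h2 (Finset.mem_erase.2 ⟨hxv, hx⟩))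
    · rintro x (rfl | hx)
      · exact h1
      · exact Finset.mem_of_mem_erase (h3 x hx)
    · intro x hx y hy hxs hys
      have hxv : x ≠ v := by rintro rfl; exact hxs h1
      have hyv : y ≠ v := by rintro rfl; exact hys h1
      exact h4 x (Finset.mem_of_mem_insert_of_ne hx hxv) y (Finset.mem_of_mem_insert_of_ne hy hyv)
        (fun h => hxs (Finset.mem_of_mem_erase h)) (fun h => hys (Finset.mem_of_mem_erase h))
  · exact absurd rfl hσ

theorem Sp.out {U : Finset V} {D : Set V} {c : Finset V → K} (h : Sp G U D c) (v : V)
    (hv : ∀ u ∈ U, G.Adj v u → u ∈ D) : Sp G (insert v U) D c := by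
  intro σ hσ
  obtain ⟨h2, h3, h4⟩ := h σ hσ
  refine ⟨h2.trans (Finset.subset_insert _ _), h3, ?_⟩
  intro x hx y hy hxs hys hadj
  rcases Finset.mem_insert.1 hx with rfl | hx' <;> rcases Finset.mem_insert.1 hy with rfl | hy'
  · exact hadj.ne rfl
  · exact hys (h3 y (hv y hy' hadj))
  · exact hxs (h3 x (hv x hx' hadj.symm))
  · exact h4 x hx' y hy' hxs hys hadj

theorem op_ne {v : V} {σ : Finset V} {c : Finset V → K} (hv : v ∉ σ) (h : c σ ≠ 0) :
    op v c (insert v σ) ≠ 0 := by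
  unfold op
  rw [if_pos (Finset.mem_insert_self _ _), Finset.erase_insert hv]
  have := sgn_sq (K := K) v σ
  intro h0
  rcases mul_eq_zero.1 h0 with h1 | h1
  · rw [h1] at this; simp at this
  · exact h h1

theorem op_notMem {v : V} {σ : Finset V} {c : Finset V → K} (hv : v ∉ σ) : op v c σ = 0 := by
  unfold op; rw [if_neg hv]

/-- nonvanishing certificate -/
def NV (K : Type) [Field K] {V : Type} (G : SimpleGraph V) (U : Finset V) (w : ℕ) : Prop :=
  ∃ (z : Finset V → K) (s : Finset V), E U z = 0 ∧ Sp G U ∅ z ∧ z s ≠ 0 ∧ s.card + w = U.card ∧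
    ∀ v ∈ s, ∃ u ∈ U, u ∉ s ∧ G.Adj v u

theorem NV_empty : NV K G ∅ 0 := by
  refine ⟨fun σ => if σ = ∅ then 1 else 0, ∅, by simp [E], ?_, by simp, by simp, by simp⟩
  intro σ hσ
  have : σ = ∅ := by by_contra h; simp [h] at hσ
  subst this; simp

theorem NV.edge {U : Finset V} {w : ℕ} (h : NV K G U w) {u v : V} (huv : G.Adj u v) (hu : u ∉ U)
    (hv : v ∉ U) (hu' : ∀ x ∈ U, ¬ G.Adj u x) (hv' : ∀ x ∈ U, ¬ G.Adj v x) :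
    NV K G (insert u (insert v U)) (w + 1) := by
  obtain ⟨z, s, h1, h2, h3, h4, h5⟩ := h
  have hs := (h2 s h3).1
  have hus : u ∉ s := fun h => hu (hs h)
  have hvs : v ∉ s := fun h => hv (hs h)
  refine ⟨op u z + op v z, insert v s, E_edge hu hv huv.ne h1, ?_, ?_, ?_, ?_⟩
  · have a1 := ((h2.out v (fun x hx h => absurd h (hv' x hx))).inn u (by simp [hu, huv.ne])).weak
      (Set.empty_subset _)
    have a2 := ((h2.out u (fun x hx h => absurd h (hu' x hx))).inn v (by simp [hv, huv.ne'])).weak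
      (Set.empty_subset _)
    rw [Finset.insert_comm] at a2
    exact a1.add a2
  · rw [Pi.add_apply, op_notMem (by simp [hus, huv.ne]), zero_add]
    exact op_ne hvs h3
  · rw [Finset.card_insert_of_notMem hvs, Finset.card_insert_of_notMem (by simp [hu, huv.ne]),
      Finset.card_insert_of_notMem hv]
    omega
  · intro x hx
    rcases Finset.mem_insert.1 hx with rfl | hx
    · exact ⟨u, by simp, by simp [hus, huv.ne], huv.symm⟩
    · obtain ⟨y, hy, hys, hxy⟩ := h5 x hx
      refine ⟨y, by simp [hy], ?_, hxy⟩
      simp only [Finset.mem_insert, not_or]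
      exact ⟨by rintro rfl; exact hv hy, hys⟩

theorem E_F {U : Finset V} {x y z : V} (hx : x ∉ U) (hy : y ∉ U) (hz : z ∉ U)
    (hxy : x ≠ y) (hxz : x ≠ z) (hyz : y ≠ z) {a b F : Finset V → K} (ha : E U a = 0)
    (hF : E U F = b - a) :
    E (insert x (insert y (insert z U))) (op x (op y F + op z F) + op y a) =
      op x (op y b + op z b) - (op x (op z a) + op y (op z a)) := by
  rw [E_insert (by simp [hx, hxy, hxz]), E_insert (by simp [hy, hyz]), E_insert hz]
  simp only [E_add, op_add, E_op hx, E_op hy, E_op hz, hF, ha, op_sub, op_neg, op_op, op_zero]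
  have e1 := op_anti hxy.symm (op y F)
  have e2 := op_anti hxy.symm (op z F)
  have e3 := op_anti hxz.symm (op y F)
  have e4 := op_anti hxz.symm (op z F)
  have e5 := op_anti hyz.symm a
  have e6 := op_anti hyz.symm F
  simp only [op_op, op_zero, e6, op_neg] at e1 e2 e3 e4
  rw [e1, e2, e3, e4, e5]
  abel

theorem E_fin {U : Finset V} {p q : V} (hp : p ∉ U) (hq : q ∉ U) (hpq : p ≠ q)
    {a b F : Finset V → K} (ha : E U a = 0) (hb : E U b = 0) (hF : E U F = b - a) :
    E (insert p (insert q U)) (op p (op q F) + op q a + op p b) = 0 := by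
  rw [E_insert (by simp [hp, hpq]), E_insert hq]
  simp only [E_add, op_add, E_op hp, E_op hq, hF, ha, hb, op_sub, op_neg, op_op, op_zero]
  have e1 := op_anti hpq.symm (op q F)
  have e2 := op_anti hpq.symm b
  rw [e1, e2]
  simp only [op_op, op_zero]
  abel

end
end ER

namespace ER

open scoped Classical
open EdgeIdealReg

section
variable {V K : Type} [Field K] {G : SimpleGraph V}

structure LC (G : SimpleGraph V) (U0 : Finset V) (n : ℕ) (c : ℕ → V) : Prop where
  inj : ∀ i j, i < n → j < n → c i = c j → i = j
  adj : ∀ i j, i < j → j < n → (G.Adj (c i) (c j) ↔ j = i + 1 ∨ (i = 0 ∧ j + 1 = n))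
  hU : ∀ i, i < n → c i ∉ U0
  hUa : ∀ i, i < n → ∀ x ∈ U0, ¬ G.Adj (c i) x

def Um (U0 : Finset V) (c : ℕ → V) (m : ℕ) : Finset V := U0 ∪ (Finset.range m).image c

theorem Um_zero (U0 : Finset V) (c : ℕ → V) : Um U0 c 0 = U0 := by simp [Um]

theorem Um_succ (U0 : Finset V) (c : ℕ → V) (m : ℕ) :
    Um U0 c (m + 1) = insert (c m) (Um U0 c m) := by
  unfold Um
  rw [Finset.range_add_one, Finset.image_insert, Finset.union_insert]

variable {U0 : Finset V} {n : ℕ} {c : ℕ → V}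

theorem LC.notMem (h : LC G U0 n c) {m i : ℕ} (hm : m ≤ i) (hi : i < n) : c i ∉ Um U0 c m := by
  unfold Um
  simp only [Finset.mem_union, Finset.mem_image, Finset.mem_range, not_or, not_exists, not_and]
  refine ⟨h.hU i hi, fun j hj hji => ?_⟩
  have := h.inj j i (by omega) hi hji
  omega

theorem LC.nb (h : LC G U0 n c) {m i : ℕ} (hm : m ≤ i) (hi : i < n) {x : V}
    (hx : x ∈ Um U0 c m) (hadj : G.Adj (c i) x) :
    ∃ j, j < m ∧ x = c j ∧ (i = j + 1 ∨ (j = 0 ∧ i + 1 = n)) := by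
  unfold Um at hx
  simp only [Finset.mem_union, Finset.mem_image, Finset.mem_range] at hx
  rcases hx with hx | ⟨j, hj, rfl⟩
  · exact absurd hadj (h.hUa i hi x hx)
  · exact ⟨j, hj, rfl, (h.adj j i (by omega) hi).1 hadj.symm⟩

set_option maxHeartbeats 1600000 in
theorem LC.state (h : LC G U0 n c) {w : ℕ} (h0 : NV K G U0 w) (j : ℕ) (hj : 3 * j + 2 ≤ n) :
    ∃ (a b F : Finset V → K) (s : Finset V),
      E (Um U0 c (3 * j)) a = 0 ∧ E (Um U0 c (3 * j)) b = 0 ∧ E (Um U0 c (3 * j)) F = b - a ∧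
      Sp G (Um U0 c (3 * j)) {v | ∃ i, i + 1 = 3 * j ∧ v = c i} a ∧
      Sp G (Um U0 c (3 * j)) {v | 0 < j ∧ v = c 0} b ∧ Sp G (Um U0 c (3 * j)) ∅ F ∧
      a s ≠ 0 ∧ s.card + (w + j) = (Um U0 c (3 * j)).card ∧
      ∀ v ∈ s, (∃ u ∈ Um U0 c (3 * j), u ∉ s ∧ G.Adj v u) ∨ (∃ i, i + 1 = 3 * j ∧ v = c i) := by
  induction j with
  | zero =>
    obtain ⟨z, s, h1, h2, h3, h4, h5⟩ := h0
    simp only [Nat.mul_zero, Um_zero]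
    refine ⟨z, z, 0, s, h1, h1, ?_, ?_, ?_, ?_, h3, by omega, fun v hv => Or.inl (h5 v hv)⟩
    · simp [E, op_zero]
    · refine h2.weak ?_
      rintro v ⟨i, hi, _⟩; omega
    · refine h2.weak ?_
      rintro v ⟨hi, _⟩; omega
    · intro σ hσ; exact absurd rfl hσ
  | succ j ih =>
    obtain ⟨a, b, F, s, ha, hb, hF, sa, sb, sF, hs, hcard, hdom⟩ := ih (by omega)
    have nb := fun {i} (h1 : 3 * j ≤ i) (h2 : i < n) {x} => h.nb (x := x) h1 h2
    have hx : c (3 * j) ∉ Um U0 c (3 * j) := h.notMem le_rfl (by omega)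
    have hy : c (3 * j + 1) ∉ Um U0 c (3 * j) := h.notMem (by omega) (by omega)
    have hz : c (3 * j + 2) ∉ Um U0 c (3 * j) := h.notMem (by omega) (by omega)
    have hxy : c (3 * j) ≠ c (3 * j + 1) := fun e => by
      have := h.inj _ _ (by omega) (by omega) e; omega
    have hxz : c (3 * j) ≠ c (3 * j + 2) := fun e => by
      have := h.inj _ _ (by omega) (by omega) e; omega
    have hyz : c (3 * j + 1) ≠ c (3 * j + 2) := fun e => by
      have := h.inj _ _ (by omega) (by omega) e; omega
    have axy : G.Adj (c (3 * j)) (c (3 * j + 1)) :=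
      (h.adj _ _ (by omega) (by omega)).2 (Or.inl rfl)
    have ayz : G.Adj (c (3 * j + 1)) (c (3 * j + 2)) :=
      (h.adj _ _ (by omega) (by omega)).2 (Or.inl rfl)
    have axz : ¬ G.Adj (c (3 * j)) (c (3 * j + 2)) := fun e => by
      have := (h.adj _ _ (by omega) (by omega)).1 e; omega
    have nx : ∀ u ∈ Um U0 c (3 * j), G.Adj (c (3 * j)) u →
        u ∈ {v | ∃ i, i + 1 = 3 * j ∧ v = c i} := by
      intro u hu e
      obtain ⟨i, hi, rfl, h2⟩ := nb le_rfl (by omega) hu e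
      refine ⟨i, ?_, rfl⟩
      omega
    have ny : ∀ u ∈ Um U0 c (3 * j), ¬ G.Adj (c (3 * j + 1)) u := by
      intro u hu e
      obtain ⟨i, hi, rfl, h2⟩ := nb (by omega) (by omega) hu e
      omega
    have nz : ∀ u ∈ Um U0 c (3 * j), ¬ G.Adj (c (3 * j + 2)) u := by
      intro u hu e
      obtain ⟨i, hi, rfl, h2⟩ := nb (by omega) (by omega) hu e
      omega
    have hU : Um U0 c (3 * (j + 1)) = insert (c (3 * j)) (insert (c (3 * j + 1))
        (insert (c (3 * j + 2)) (Um U0 c (3 * j)))) := by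
      rw [show 3 * (j + 1) = 3 * j + 1 + 1 + 1 by ring, Um_succ, Um_succ, Um_succ]
      ext v; simp only [Finset.mem_insert]; tauto
    have hz1 : c (3 * j + 2) = c (3 * (j + 1) - 1) := by congr 1
    have hsU := (sa s hs).1
    rw [hU]
    set U := Um U0 c (3 * j) with hUd
    clear_value U
    set x := c (3 * j) with hxd
    set y := c (3 * j + 1) with hyd
    set z := c (3 * j + 2) with hzd
    refine ⟨op x (op z a) + op y (op z a), op x (op y b + op z b), op x (op y F + op z F) + op y a,
      insert y (insert z s), ?_, ?_, ?_, ?_, ?_, ?_, ?_, ?_, ?_⟩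
    · exact E_edge (by simp [hx, hxz]) (by simp [hy, hyz]) hxy (E_in hz ha)
    · exact E_in (by simp [hx, hxy, hxz]) (E_edge hy hz hyz hb)
    · exact E_F hx hy hz hxy hxz hyz ha hF
    · have a1 := ((sa.out y (fun u hu e => absurd e (ny u hu))).inn z
        (by simp [hz, hyz.symm])).inn x (by simp [hx, hxy, hxz])
      have a2 := ((sa.out x nx).inn z (by simp [hz, hxz.symm])).inn y (by simp [hy, hxy.symm, hyz])
      have e1 : insert x (insert z (insert y U)) = insert x (insert y (insert z U)) := by
        ext v; simp only [Finset.mem_insert]; tauto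
      have e2 : insert y (insert z (insert x U)) = insert x (insert y (insert z U)) := by
        ext v; simp only [Finset.mem_insert]; tauto
      rw [e1] at a1
      rw [e2] at a2
      have hD : {v | ∃ i, i + 1 = 3 * (j + 1) ∧ v = c i} ⊆ ({z} : Set V) := by
        rintro v ⟨i, hi, rfl⟩
        have : i = 3 * j + 2 := by omega
        subst this; rfl
      refine (a1.weak (hD.trans ?_)).add (a2.weak (hD.trans ?_))
      · rintro v rfl; simp
      · rintro v rfl; simp
    · have b1 := ((sb.out y (fun u hu e => absurd e (ny u hu))).inn z
        (by simp [hz, hyz.symm]))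
      have b2 := ((sb.out z (fun u hu e => absurd e (nz u hu))).inn y (by simp [hy, hyz]))
      rw [Finset.insert_comm] at b1
      have hD : {v | 0 < j + 1 ∧ v = c 0} ⊆ insert x {v | 0 < j ∧ v = c 0} := by
        rintro v ⟨-, rfl⟩
        rcases Nat.eq_zero_or_pos j with rfl | h0
        · left; rfl
        · right; exact ⟨h0, rfl⟩
      refine Sp.weak (Sp.inn (((b2.weak (Set.subset_insert _ _))).add
        (b1.weak (Set.subset_insert _ _))) x ?_) hD
      simp [hx, hxy, hxz]
    · have b1 := ((sF.out y (fun u hu e => absurd e (ny u hu))).inn z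
        (by simp [hz, hyz.symm])).weak (Set.empty_subset _)
      have b2 := ((sF.out z (fun u hu e => absurd e (nz u hu))).inn y (by simp [hy, hyz])).weak
        (Set.empty_subset _)
      rw [Finset.insert_comm] at b1
      have b3 := ((b2.add b1).inn x (by simp [hx, hxy, hxz])).weak (Set.empty_subset _)
      have b4 := (((sa.out x nx).out z (fun u hu e => by
        rcases Finset.mem_insert.1 hu with rfl | hu
        · exact absurd e.symm axz
        · exact absurd e (nz u hu))).inn y (by simp [hy, hxy.symm, hyz])).weak (Set.empty_subset _)
      have e2 : insert y (insert z (insert x U)) = insert x (insert y (insert z U)) := by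
        ext v; simp only [Finset.mem_insert]; tauto
      rw [e2] at b4
      exact b3.add b4
    · have hxs : x ∉ s := fun e => hx (hsU e)
      have hys : y ∉ s := fun e => hy (hsU e)
      have hzs : z ∉ s := fun e => hz (hsU e)
      rw [Pi.add_apply, op_notMem (by simp [hxy, hxz, hxs]), zero_add]
      exact op_ne (by simp [hys, hyz]) (op_ne hzs hs)
    · have hys : y ∉ s := fun e => hy (hsU e)
      have hzs : z ∉ s := fun e => hz (hsU e)
      rw [Finset.card_insert_of_notMem (by simp [hys, hyz]), Finset.card_insert_of_notMem hzs,
        Finset.card_insert_of_notMem (by simp [hx, hxy, hxz]),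
        Finset.card_insert_of_notMem (by simp [hy, hyz]), Finset.card_insert_of_notMem hz]
      omega
    · have hxs : x ∉ s := fun e => hx (hsU e)
      intro v hv
      rcases Finset.mem_insert.1 hv with rfl | hv
      · left; exact ⟨x, by simp, by simp [hxs, hxy, hxz], axy.symm⟩
      rcases Finset.mem_insert.1 hv with rfl | hv
      · right; exact ⟨3 * j + 2, by ring, rfl⟩
      rcases hdom v hv with ⟨u, hu, hus, e⟩ | ⟨i, hi, rfl⟩
      · left
        refine ⟨u, by simp [hu], ?_, e⟩
        simp only [Finset.mem_insert, not_or]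
        exact ⟨by rintro rfl; exact hy hu, by rintro rfl; exact hz hu, hus⟩
      · left
        refine ⟨x, by simp, by simp [hxs, hxy, hxz], ?_⟩
        exact (h.adj _ _ (by omega) (by omega)).2 (Or.inl hi.symm)

theorem LC.final (h : LC G U0 n c) {w : ℕ} (h0 : NV K G U0 w) (j : ℕ) (hj : 3 * j + 2 = n)
    (hj1 : 1 ≤ j) : NV K G (Um U0 c n) (w + (j + 1)) := by
  obtain ⟨a, b, F, s, ha, hb, hF, sa, sb, sF, hs, hcard, hdom⟩ := h.state h0 j hj.le
  have hp : c (3 * j) ∉ Um U0 c (3 * j) := h.notMem le_rfl (by omega)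
  have hq : c (3 * j + 1) ∉ Um U0 c (3 * j) := h.notMem (by omega) (by omega)
  have hpq : c (3 * j) ≠ c (3 * j + 1) := fun e => by
    have := h.inj _ _ (by omega) (by omega) e; omega
  have apq : G.Adj (c (3 * j)) (c (3 * j + 1)) :=
    (h.adj _ _ (by omega) (by omega)).2 (Or.inl rfl)
  have np : ∀ u ∈ Um U0 c (3 * j), G.Adj (c (3 * j)) u →
      u ∈ {v | ∃ i, i + 1 = 3 * j ∧ v = c i} := by
    intro u hu e
    obtain ⟨i, hi, rfl, h2⟩ := h.nb le_rfl (by omega) hu e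
    refine ⟨i, ?_, rfl⟩
    omega
  have nq : ∀ u ∈ Um U0 c (3 * j), G.Adj (c (3 * j + 1)) u → u ∈ {v | 0 < j ∧ v = c 0} := by
    intro u hu e
    obtain ⟨i, hi, rfl, h2⟩ := h.nb (by omega) (by omega) hu e
    have : i = 0 := by omega
    subst this
    exact ⟨hj1, rfl⟩
  have hU : Um U0 c n = insert (c (3 * j)) (insert (c (3 * j + 1)) (Um U0 c (3 * j))) := by
    rw [← hj, Um_succ, Um_succ, Finset.insert_comm]
  have hsU := (sa s hs).1
  rw [hU]
  have hps : c (3 * j) ∉ s := fun e => hp (hsU e)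
  have hqs : c (3 * j + 1) ∉ s := fun e => hq (hsU e)
  refine ⟨_, insert (c (3 * j + 1)) s, E_fin hp hq hpq ha hb hF, ?_, ?_, ?_, ?_⟩
  · have a1 := ((sF.inn _ hq).inn (c (3 * j)) (by simp [hp, hpq])).weak (Set.empty_subset _)
    have a2 := ((sa.out _ np).inn (c (3 * j + 1)) (by simp [hq, hpq.symm])).weak
      (Set.empty_subset _)
    have a3 := ((sb.out _ nq).inn (c (3 * j)) (by simp [hp, hpq])).weak (Set.empty_subset _)
    rw [Finset.insert_comm] at a2
    exact (a1.add a2).add a3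
  · rw [Pi.add_apply, Pi.add_apply, op_notMem (v := c (3 * j)) (by simp [hps, hpq]), zero_add,
      op_notMem (v := c (3 * j)) (by simp [hps, hpq]), add_zero]
    exact op_ne hqs hs
  · rw [Finset.card_insert_of_notMem hqs, Finset.card_insert_of_notMem (by simp [hp, hpq]),
      Finset.card_insert_of_notMem hq]
    omega
  · intro v hv
    rcases Finset.mem_insert.1 hv with rfl | hv
    · exact ⟨c (3 * j), by simp, by simp [hps, hpq], apq.symm⟩
    rcases hdom v hv with ⟨u, hu, hus, e⟩ | ⟨i, hi, rfl⟩
    · refine ⟨u, by simp [hu], ?_, e⟩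
      simp only [Finset.mem_insert, not_or]
      exact ⟨by rintro rfl; exact hq hu, hus⟩
    · refine ⟨c (3 * j), by simp, by simp [hps, hpq], ?_⟩
      exact (h.adj _ _ (by omega) (by omega)).2 (Or.inl hi.symm)

theorem LC.edges (h : LC G U0 n c) {w : ℕ} (h0 : NV K G U0 w) (j : ℕ) (hj : 3 * j ≤ n) :
    ∃ U, U ⊆ Um U0 c (3 * j - 1) ∧ NV K G U (w + j) := by
  induction j with
  | zero => exact ⟨U0, by simp [Um], h0⟩
  | succ j ih =>
    obtain ⟨U, hU, hN⟩ := ih (by omega)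
    have nn : ∀ i, 3 * j ≤ i → i < 3 * j + 2 → c i ∉ U ∧ ∀ x ∈ U, ¬ G.Adj (c i) x := by
      intro i hi hi2
      refine ⟨fun e => h.notMem (m := 3 * j - 1) (by omega) (by omega) (hU e), ?_⟩
      intro x hx e
      obtain ⟨k, hk, rfl, h2⟩ := h.nb (m := 3 * j - 1) (by omega) (by omega) (hU hx) e
      omega
    refine ⟨_, ?_, hN.edge (u := c (3 * j)) (v := c (3 * j + 1)) ?_ (nn _ (by omega) (by omega)).1
      (nn _ (by omega) (by omega)).1 (nn _ (by omega) (by omega)).2 (nn _ (by omega) (by omega)).2⟩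
    · have hm : Um U0 c (3 * j - 1) ⊆ Um U0 c (3 * j) := by
        unfold Um
        exact Finset.union_subset_union_right (Finset.image_subset_image
          (Finset.range_subset_range.2 (by omega)))
      rw [show 3 * (j + 1) - 1 = 3 * j + 1 + 1 by omega, Um_succ, Um_succ, Finset.insert_comm]
      exact Finset.insert_subset_insert _ (Finset.insert_subset_insert _ (hU.trans hm))
    · exact (h.adj _ _ (by omega) (by omega)).2 (Or.inl rfl)

theorem Cfg.NV {Cy X : Finset V} {w : ℕ}
    (hc : Cy = ∅ ∨ ∃ (n : ℕ) (f : ZMod n → V), ICyc G Cy n f)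
    (h : Cfg G Cy ∅ X w) : ∃ U ⊆ X, ER.NV K G U w := by
  induction h with
  | nil X => exact ⟨∅, by simp, NV_empty⟩
  | pt X u w h1 h2 _ ih => simp at h2
  | ed X u v w hu hv huv _ ih =>
    obtain ⟨U, hU, hN⟩ := ih
    have key : ∀ x ∈ U, x ∈ X ∧ x ≠ u ∧ ¬ G.Adj u x ∧ x ≠ v ∧ ¬ G.Adj v x := by
      intro x hx
      have := hU hx
      rw [mem_rm, mem_rm] at this
      tauto
    refine ⟨_, ?_, hN.edge huv (fun h => (key u h).2.1 rfl) (fun h => (key v h).2.2.2.1 rfl)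
      (fun x hx => (key x hx).2.2.1) (fun x hx => (key x hx).2.2.2.2)⟩
    intro x hx
    simp only [Finset.mem_insert] at hx
    rcases hx with rfl | rfl | hx
    · exact hu
    · exact hv
    · exact (key x hx).1
  | cy X w hX _ ih =>
    obtain ⟨U, hU, hN⟩ := ih
    rcases hc with rfl | ⟨n, f, hf⟩
    · refine ⟨U, ?_, by simpa using hN⟩
      intro x hx; exact (mem_rmC.1 (hU hx)).1
    · have hn := hf.n4
      have hlc : LC G U n (fun i => f (i : ZMod n)) := by
        refine ⟨?_, ?_, ?_, ?_⟩
        · intro i j hi hj e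
          exact (cast_inj' hi hj).1 (hf.inj e)
        · intro i j hij hj
          rw [hf.adj]
          have e1 : ((j : ZMod n) = (i : ZMod n) + 1) ↔ j = i + 1 := by
            rw [show ((i : ZMod n) + 1) = ((i + 1 : ℕ) : ZMod n) by push_cast; rfl]
            exact cast_inj' hj (by omega)
          have e2 : ((i : ZMod n) = (j : ZMod n) + 1) ↔ (i = 0 ∧ j + 1 = n) := by
            rw [show ((j : ZMod n) + 1) = ((j + 1 : ℕ) : ZMod n) by push_cast; rfl]
            by_cases hjn : j + 1 = n
            · rw [hjn, ZMod.natCast_self]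
              have := cast_inj' (n := n) (a := i) (b := 0) (by omega) (by omega)
              rw [Nat.cast_zero] at this
              rw [this]; simp
            · rw [cast_inj' (by omega) (by omega)]; omega
          rw [e1, e2]
        · intro i _ hi
          exact (mem_rmC.1 (hU hi)).2.1 ((hf.mem _).2 ⟨_, rfl⟩)
        · intro i _ x hx
          exact (mem_rmC.1 (hU hx)).2.2 _ ((hf.mem _).2 ⟨_, rfl⟩)
      have hcard : Cy.card = n := by
        have : NeZero n := ⟨by omega⟩
        have e : Cy = Finset.univ.image f := by
          ext v; rw [hf.mem]; simp
        rw [e, Finset.card_image_of_injective _ hf.inj, Finset.card_univ, ZMod.card]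
      have hsub : ∀ m, Um U (fun i : ℕ => f (i : ZMod n)) m ⊆ X := by
        intro m x hx
        unfold Um at hx
        simp only [Finset.mem_union, Finset.mem_image] at hx
        rcases hx with hx | ⟨i, _, rfl⟩
        · exact (mem_rmC.1 (hU hx)).1
        · exact hX ((hf.mem _).2 ⟨_, rfl⟩)
      rw [hcard]
      by_cases h3 : n % 3 = 2
      · have := hlc.final hN (n / 3) (by omega) (by omega)
        refine ⟨_, hsub n, ?_⟩
        rwa [show (n + 1) / 3 = n / 3 + 1 by omega]
      · obtain ⟨U', hU', hN'⟩ := hlc.edges hN (n / 3) (by omega)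
        refine ⟨U', hU'.trans (hsub _), ?_⟩
        rwa [show (n + 1) / 3 = n / 3 by omega]

theorem pair_bd {U : Finset V} (z g : Finset V → K) :
    ∑ σ ∈ U.powerset, z σ * bd U g σ = ∑ σ ∈ U.powerset, E U z σ * g σ := by
  unfold bd E
  simp only [Finset.sum_apply, Finset.mul_sum, Finset.sum_mul]
  rw [Finset.sum_comm (s := U.powerset) (t := U)]
  have e : ∑ σ ∈ U.powerset, ∑ v ∈ U \ σ, z σ * (sgn K v σ * g (insert v σ)) =
      ∑ v ∈ U, ∑ σ ∈ U.powerset.filter (fun σ => v ∉ σ), z σ * (sgn K v σ * g (insert v σ)) := by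
    apply Finset.sum_comm'
    intro x y
    simp only [Finset.mem_powerset, Finset.mem_sdiff, Finset.mem_filter]
    tauto
  rw [e]
  apply Finset.sum_congr rfl
  intro v hv
  have e2 : ∑ σ ∈ U.powerset, op v z σ * g σ =
      ∑ σ ∈ U.powerset.filter (fun σ => v ∈ σ), op v z σ * g σ := by
    rw [Finset.sum_filter]
    apply Finset.sum_congr rfl
    intro σ _
    split_ifs with h
    · rfl
    · rw [op_notMem h, zero_mul]
  rw [e2]
  refine Finset.sum_bij' (fun σ _ => insert v σ) (fun σ _ => σ.erase v) ?_ ?_ ?_ ?_ ?_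
  · intro σ hσ
    simp only [Finset.mem_filter, Finset.mem_powerset] at hσ ⊢
    exact ⟨Finset.insert_subset hv hσ.1, by simp⟩
  · intro σ hσ
    simp only [Finset.mem_filter, Finset.mem_powerset] at hσ ⊢
    exact ⟨(Finset.erase_subset _ _).trans hσ.1, by simp⟩
  · intro σ hσ
    simp only [Finset.mem_filter, Finset.mem_powerset] at hσ
    exact Finset.erase_insert hσ.2
  · intro σ hσ
    simp only [Finset.mem_filter, Finset.mem_powerset] at hσ
    exact Finset.insert_erase hσ.2
  · intro σ hσ
    simp only [Finset.mem_filter, Finset.mem_powerset] at hσ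
    unfold op
    rw [if_pos (by simp), Finset.erase_insert hσ.2]
    ring

theorem J_one_ind {X U σ : Finset V} (hσ : J G X 1 (ind U - ind σ)) :
    ∃ x ∈ U, ∃ y ∈ U, x ∉ σ ∧ y ∉ σ ∧ G.Adj x y := by
  by_contra hcon
  push Not at hcon
  have := hσ (X \ (U \ σ)) (by
    intro u hu v hv huv
    by_contra h2
    simp only [Finset.mem_sdiff, hu, hv, true_and, not_not, not_or] at h2
    exact hcon u h2.1.1 v h2.2.1 h2.1.2 h2.2.2 huv)
  rw [Finset.sum_eq_zero] at this
  · omega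
  · intro v hv
    simp only [Finset.mem_inter, Finset.mem_sdiff, not_and, not_not] at hv
    simp only [Finsupp.tsub_apply, ind_apply]
    by_cases h1 : v ∈ U
    · simp [h1, hv.2.2 h1]
    · simp [h1]

theorem nonvan {X U : Finset V} {w : ℕ} {d : ℤ} (hUX : U ⊆ X) (hN : NV K G U w) (hd : 0 ≤ d)
    (hex : ∀ j, j ≤ U.card → d + 1 + j < ((ind U).degree : ℤ) → ∀ c : Finset V → K,
      Adm (J G X 1) (ind U) j c → bd (ind U).support c = 0 →
      ∃ b, Adm (J G X 1) (ind U) (j + 1) b ∧ bd (ind U).support b = c) : (w : ℤ) ≤ d := by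
  by_contra hlt
  push Not at hlt
  obtain ⟨z, s, h1, h2, h3, h4, h5⟩ := hN
  have hsupp : (ind U).support = U := by
    ext v; simp [ind_apply]
  have hs := (h2 s h3).1
  have hne : s.Nonempty := by
    by_contra h0
    rw [Finset.not_nonempty_iff_eq_empty] at h0
    subst h0
    have hUne : U.Nonempty := by
      rw [← Finset.card_pos]
      simp at h4; omega
    obtain ⟨v, hv⟩ := hUne
    have h6 := congrFun h1 {v}
    unfold E at h6
    rw [Finset.sum_apply, Finset.sum_eq_single v] at h6
    · have := op_ne (v := v) (σ := ∅) (by simp) h3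
      simp only [insert_empty_eq] at this
      exact this h6
    · intro u _ huv
      exact op_notMem (by simpa using huv)
    · intro h; exact absurd hv h
  have hcs := hne.card_pos
  set δ : Finset V → K := fun σ => if σ = s then 1 else 0 with hδ
  have hdeg : (ind U).degree = U.card := degree_ind U
  obtain ⟨b, hb1, hb2⟩ := hex (s.card - 1) (by omega) (by rw [hdeg]; omega) (bd U δ) (by
    intro τ hτ
    obtain ⟨v, hv, hv1⟩ := Finset.exists_ne_zero_of_sum_ne_zero hτ
    have hv2 : insert v τ = s := by
      by_contra h; simp [hδ, h] at hv1
    have hvτ : v ∉ τ := (Finset.mem_sdiff.1 hv).2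
    rw [hsupp]
    refine ⟨(Finset.subset_insert v τ).trans (hv2 ▸ hs), ?_, ?_⟩
    · rw [← hv2, Finset.card_insert_of_notMem hvτ]; simp
    · obtain ⟨u, hu, hus, hvu⟩ := h5 v (by rw [← hv2]; simp)
      have hvU := (Finset.mem_sdiff.1 hv).1
      have huτ : u ∉ τ := fun h => hus (by rw [← hv2]; simp [h])
      intro p hp
      have key : ∀ x, x ∈ U → x ∉ τ → x ∈ p → 1 ≤ ∑ v ∈ X ∩ p, (ind U - ind τ) v := by
        intro x hx hxτ hxp
        refine le_trans ?_ (Finset.single_le_sum (f := fun v => (ind U - ind τ) v)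
          (fun _ _ => Nat.zero_le _) (Finset.mem_inter.2 ⟨hUX hx, hxp⟩))
        simp [ind_apply, hx, hxτ]
      rcases hp v (hUX hvU) u (hUX hu) hvu with h | h
      · exact key v hvU hvτ h
      · exact key u hu huτ h) (by rw [hsupp, bd_bd])
  rw [hsupp] at hb2
  obtain ⟨v0, hv0⟩ := hne
  have he : bd U (δ - b) = 0 := by rw [bd_sub, hb2, sub_self]
  have hg := bd_op U v0 (hs hv0) (δ - b)
  rw [he, op_zero, sub_zero] at hg
  have h7 := pair_bd (U := U) z (op v0 (δ - b))
  rw [hg, h1] at h7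
  simp only [Pi.zero_apply, zero_mul, Finset.sum_const_zero] at h7
  rw [Finset.sum_eq_single s] at h7
  · have hbs : b s = 0 := by
      by_contra h
      obtain ⟨x, hx, y, hy, hxs, hys, hxy⟩ := J_one_ind (hb1 s h).2.2
      exact (h2 s h3).2.2 x hx y hy hxs hys hxy
    simp only [Pi.sub_apply, hbs, hδ, if_true, sub_zero, mul_one] at h7
    exact h3 h7
  · intro σ _ hσ
    simp only [Pi.sub_apply, hδ, if_neg hσ, zero_sub, mul_neg, neg_eq_zero]
    by_contra h
    have hz : z σ ≠ 0 := left_ne_zero_of_mul h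
    have hbσ : b σ ≠ 0 := right_ne_zero_of_mul h
    obtain ⟨x, hx, y, hy, hxs, hys, hxy⟩ := J_one_ind (hb1 σ hbσ).2.2
    exact (h2 σ hz).2.2 x hx y hy hxs hys hxy
  · intro h; exact absurd (Finset.mem_powerset.2 hs) h

end
end ER

namespace ER
open scoped Classical
open EdgeIdealReg

section forest
variable {W : Type}

/-- Number of neighbours of `v` inside the finite set `Y`. -/
def dg (H : SimpleGraph W) (Y : Finset W) (v : W) : ℕ := ∑ w ∈ Y, if H.Adj v w then 1 else 0

theorem dg_card (H : SimpleGraph W) (Y : Finset W) (v : W) :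
    dg H Y v = (Y.filter (H.Adj v)).card := by
  rw [dg, Finset.card_filter]

theorem two_le_dg {H : SimpleGraph W} {Y : Finset W} {v : W} :
    2 ≤ dg H Y v ↔ ∃ a ∈ Y, ∃ b ∈ Y, a ≠ b ∧ H.Adj v a ∧ H.Adj v b := by
  rw [dg_card, show (2 ≤ (Y.filter (H.Adj v)).card) ↔ 1 < (Y.filter (H.Adj v)).card from Iff.rfl,
    Finset.one_lt_card]
  constructor
  · rintro ⟨a, ha, b, hb, hab⟩
    rw [Finset.mem_filter] at ha hb
    exact ⟨a, ha.1, b, hb.1, hab, ha.2, hb.2⟩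
  · rintro ⟨a, ha, b, hb, hab, h1, h2⟩
    exact ⟨a, Finset.mem_filter.2 ⟨ha, h1⟩, b, Finset.mem_filter.2 ⟨hb, h2⟩, hab⟩

theorem forest_leaf {H : SimpleGraph W} (hH : H.IsAcyclic) {Y : Finset W} (hne : Y.Nonempty) :
    ∃ v ∈ Y, dg H Y v ≤ 1 := by
  by_contra hcon
  push Not at hcon
  have key : ∀ n : ℕ, ∃ (u v : W) (p : H.Walk u v), p.IsPath ∧ p.length = n ∧
      ∀ x ∈ p.support, x ∈ Y := by
    intro n
    induction n with
    | zero =>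
      obtain ⟨v, hv⟩ := hne
      exact ⟨v, v, SimpleGraph.Walk.nil, by simp, by simp, by simpa using hv⟩
    | succ n ih =>
      obtain ⟨u, v, p, hp, hl, hs⟩ := ih
      obtain ⟨a, ha, b, hb, hab, h1, h2⟩ := two_le_dg.1 (hcon u (hs u p.start_mem_support))
      obtain ⟨w, hw, hwp, hadj⟩ : ∃ w ∈ Y, w ≠ p.snd ∧ H.Adj u w := by
        by_cases h : a = p.snd
        · exact ⟨b, hb, fun h' => hab (h.trans h'.symm), h2⟩
        · exact ⟨a, ha, h, h1⟩
      refine ⟨w, v, SimpleGraph.Walk.cons hadj.symm p, ?_, by simp [hl], ?_⟩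
      · rw [SimpleGraph.Walk.cons_isPath_iff]
        exact ⟨hp, fun h => hwp (hH.eq_snd_of_adj_start hp hadj h)⟩
      · intro x hx
        rw [SimpleGraph.Walk.support_cons, List.mem_cons] at hx
        rcases hx with rfl | hx
        · exact hw
        · exact hs x hx
  obtain ⟨u, v, p, hp, hl, hs⟩ := key Y.card
  have h1 : p.support.toFinset ⊆ Y := fun x hx => hs x (List.mem_toFinset.1 hx)
  have h2 := Finset.card_le_card h1
  rw [List.toFinset_card_of_nodup hp.support_nodup, SimpleGraph.Walk.length_support] at h2
  omega

theorem forest_sum {H : SimpleGraph W} (hH : H.IsAcyclic) : ∀ (n : ℕ) (Y : Finset W), Y.card = n →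
    Y.Nonempty → ∑ v ∈ Y, dg H Y v + 2 ≤ 2 * Y.card := by
  intro n
  induction n with
  | zero => intro Y h hne; rw [Finset.card_eq_zero] at h; simp [h] at hne
  | succ n ih =>
    intro Y hY hne
    obtain ⟨v, hv, hd⟩ := forest_leaf hH hne
    have hself : dg H Y v = dg H (Y.erase v) v := by
      rw [dg, dg, ← Finset.add_sum_erase Y _ hv]; simp
    have hsum : ∑ u ∈ Y, dg H Y u = 2 * dg H Y v + ∑ u ∈ Y.erase v, dg H (Y.erase v) u := by
      rw [← Finset.add_sum_erase Y _ hv]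
      have : ∀ u ∈ Y.erase v, dg H Y u = (if H.Adj v u then 1 else 0) + dg H (Y.erase v) u := by
        intro u _
        rw [dg, dg, ← Finset.add_sum_erase Y _ hv]
        simp only [H.adj_comm u v]
      rw [Finset.sum_congr rfl this, Finset.sum_add_distrib]
      have : ∑ u ∈ Y.erase v, (if H.Adj v u then 1 else 0) = dg H Y v := by rw [hself]; rfl
      rw [this]; ring
    have hc : (Y.erase v).card = n := by rw [Finset.card_erase_of_mem hv]; omega
    rcases Finset.eq_empty_or_nonempty (Y.erase v) with h | h
    · rw [hsum, hself, h]; simp [dg]; rw [h] at hc; simp at hc; omega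
    · have := ih _ hc h
      omega

theorem uni_sum {H H' : SimpleGraph W} (hH : H'.IsAcyclic) {x y : W} 
    (hle : ∀ u v, H.Adj u v → H'.Adj u v ∨ (u = x ∧ v = y) ∨ (u = y ∧ v = x))
    (hxy : x ≠ y) {Y : Finset W} (hne : Y.Nonempty) : ∑ v ∈ Y, dg H Y v ≤ 2 * Y.card := by
  have h1 := forest_sum hH _ Y rfl hne
  have h2 : ∑ v ∈ Y, dg H Y v ≤ ∑ v ∈ Y, dg H' Y v +
      ∑ u ∈ Y, ∑ v ∈ Y, ((if u = x ∧ v = y then 1 else 0) + (if u = y ∧ v = x then 1 else 0)) := by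
    rw [← Finset.sum_add_distrib]
    refine Finset.sum_le_sum fun u _ => ?_
    rw [dg, dg, ← Finset.sum_add_distrib]
    refine Finset.sum_le_sum fun v _ => ?_
    by_cases h : H.Adj u v
    · rcases hle u v h with h' | h' | h' <;> (rw [if_pos h]; simp [h']; try omega)
    · simp [h]
  have h3 : ∀ a b : W, ∑ u ∈ Y, ∑ v ∈ Y, (if u = a ∧ v = b then 1 else 0) ≤ 1 := by
    intro a b
    calc ∑ u ∈ Y, ∑ v ∈ Y, (if u = a ∧ v = b then 1 else 0) 
        ≤ ∑ u ∈ Y, (if u = a then 1 else 0) := by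
          refine Finset.sum_le_sum fun u _ => ?_
          by_cases h : u = a
          · simp only [h, true_and, Finset.sum_ite_eq', if_true]; split_ifs <;> simp
          · simp [h]
      _ ≤ 1 := by rw [Finset.sum_ite_eq']; split_ifs <;> simp
  simp only [Finset.sum_add_distrib] at h2
  have := h3 x y
  have := h3 y x
  omega

theorem all_two {H H' : SimpleGraph W} (hH : H'.IsAcyclic) {x y : W} 
    (hle : ∀ u v, H.Adj u v → H'.Adj u v ∨ (u = x ∧ v = y) ∨ (u = y ∧ v = x))
    (hxy : x ≠ y) {Y : Finset W} (h2 : ∀ v ∈ Y, 2 ≤ dg H Y v) : ∀ v ∈ Y, dg H Y v = 2 := by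
  intro v hv
  by_contra h
  have h3 := uni_sum hH hle hxy ⟨v, hv⟩
  have : ∑ v ∈ Y, 2 < ∑ v ∈ Y, dg H Y v := Finset.sum_lt_sum h2 ⟨v, hv, by
    have := h2 v hv; omega⟩
  rw [Finset.sum_const, smul_eq_mul] at this
  omega


theorem dg_mono {H : SimpleGraph W} {Y Y' : Finset W} (h : Y ⊆ Y') (v : W) :
    dg H Y v ≤ dg H Y' v :=
  Finset.sum_le_sum_of_subset h

theorem three_le_dg {H : SimpleGraph W} {Y : Finset W} {v a b c : W} (ha : a ∈ Y) (hb : b ∈ Y)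
    (hc : c ∈ Y) (hab : a ≠ b) (hac : a ≠ c) (hbc : b ≠ c) (h1 : H.Adj v a) (h2 : H.Adj v b)
    (h3 : H.Adj v c) : 3 ≤ dg H Y v := by
  rw [dg_card]
  have : ({a, b, c} : Finset W) ⊆ Y.filter (H.Adj v) := by
    intro x hx
    simp only [Finset.mem_insert, Finset.mem_singleton] at hx
    rcases hx with rfl | rfl | rfl <;> simp [*]
  have h4 := Finset.card_le_card this
  rw [Finset.card_eq_three.2 ⟨a, b, c, hab, hac, hbc, rfl⟩] at h4
  exact h4

theorem del_le {H : SimpleGraph W} (x y : W) : ∀ u v, H.Adj u v →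
    (H.deleteEdges {s(x, y)}).Adj u v ∨ (u = x ∧ v = y) ∨ (u = y ∧ v = x) := by
  intro u v h
  rw [SimpleGraph.deleteEdges_adj, Set.mem_singleton_iff, Sym2.eq_iff]
  tauto

/-- Combinatorial data of the unique cycle of a unicyclic graph. -/
structure UC (H : SimpleGraph W) (n : ℕ) (f : ZMod n → W) : Prop where
  n3 : 3 ≤ n
  inj : Function.Injective f
  adj : ∀ i, H.Adj (f i) (f (i + 1))
  acy : ∀ i, (H.deleteEdges {s(f i, f (i + 1))}).IsAcyclic

theorem uni_data {H : SimpleGraph W} (h : Unicyclic H) : ∃ n f, UC H n f := by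
  obtain ⟨v, c, hc, huniq⟩ := h
  have h3 := hc.three_le_length
  obtain ⟨n, hn⟩ : ∃ n, n = c.length := ⟨_, rfl⟩
  have : NeZero n := ⟨by omega⟩
  have hstep : ∀ i : ZMod n, c.getVert (i + 1).val = c.getVert (i.val + 1) := by
    intro i
    have hi := i.val_lt
    by_cases h : i.val + 1 < n
    · have hF : Fact (1 < n) := ⟨by omega⟩
      rw [ZMod.val_add_of_lt (by rw [ZMod.val_one]; omega), ZMod.val_one]
    · have e : i.val + 1 = n := by omega
      have : i + 1 = 0 := by
        have := congrArg (Nat.cast : ℕ → ZMod n) e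
        simpa using this
      rw [this, e, ZMod.val_zero, hn, SimpleGraph.Walk.getVert_length,
        SimpleGraph.Walk.getVert_zero]
  refine ⟨n, fun i => c.getVert i.val, by omega, ?_, ?_, ?_⟩
  · intro i j hij
    have hi := i.val_lt
    have hj := j.val_lt
    exact ZMod.val_injective n (hc.getVert_injOn' (by simp; omega) (by simp; omega) hij)
  · intro i
    rw [hstep]
    exact c.adj_getVert_succ (by have := i.val_lt; omega)
  · intro i w c' hc'
    have hmem : s(c.getVert i.val, c.getVert (i.val + 1)) ∈ c.edges := by
      rw [← SimpleGraph.Walk.adj_toSubgraph_iff_mem_edges]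
      exact c.toSubgraph_adj_getVert (by have := i.val_lt; omega)
    rw [← hstep] at hmem
    have h1 := huniq w (c'.mapLe (SimpleGraph.deleteEdges_le _)) (hc'.mapLe _)
    rw [SimpleGraph.Walk.edges_mapLe_eq_edges] at h1
    have h2 : s(c.getVert i.val, c.getVert (i + 1).val) ∈ {e | e ∈ c'.edges} := by
      rw [h1]; exact hmem
    have h4 := c'.edges_subset_edgeSet h2
    rw [SimpleGraph.edgeSet_deleteEdges] at h4
    exact h4.2 rfl

theorem UC.all_two {H : SimpleGraph W} {n : ℕ} {f : ZMod n → W} (h : UC H n f) {Y : Finset W}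
    (h2 : ∀ v ∈ Y, 2 ≤ dg H Y v) : ∀ v ∈ Y, dg H Y v = 2 :=
  ER.all_two (h.acy 0) (del_le _ _) (h.adj 0).ne h2

theorem UC.ne {H : SimpleGraph W} {n : ℕ} {f : ZMod n → W} (h : UC H n f) (i : ZMod n) :
    f (i + 1) ≠ f (i - 1) := by
  intro e
  have e := h.inj e
  have h3 := h.n3
  have : ((2 : ℕ) : ZMod n) = ((0 : ℕ) : ZMod n) := by
    push_cast
    linear_combination e
  rw [cast_inj' (by omega) (by omega)] at this
  omega

theorem UC.adj' {H : SimpleGraph W} {n : ℕ} {f : ZMod n → W} (h : UC H n f) (i : ZMod n) :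
    H.Adj (f i) (f (i - 1)) := by
  have := h.adj (i - 1)
  rw [sub_add_cancel] at this
  exact this.symm

theorem UC.two_le {H : SimpleGraph W} {n : ℕ} {f : ZMod n → W} (h : UC H n f) {Z : Finset W}
    (hZ : ∀ v, v ∈ Z ↔ ∃ i, f i = v)
    : ∀ v ∈ Z, 2 ≤ dg H Z v := by
  intro v hv
  obtain ⟨i, rfl⟩ := (hZ v).1 hv
  exact two_le_dg.2 ⟨_, (hZ _).2 ⟨i + 1, rfl⟩, _, (hZ _).2 ⟨i - 1, rfl⟩, h.ne i, h.adj i, h.adj' i⟩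

theorem UC.adj_iff {H : SimpleGraph W} {n : ℕ} {f : ZMod n → W} (h : UC H n f) {Z : Finset W}
    (hZ : ∀ v, v ∈ Z ↔ ∃ i, f i = v)
    (i j : ZMod n) : H.Adj (f i) (f j) ↔ (j = i + 1 ∨ i = j + 1) := by
  constructor
  · intro hij
    by_contra hcon
    push Not at hcon
    have h2 := h.all_two (h.two_le hZ) (f i) ((hZ _).2 ⟨i, rfl⟩)
    have h3 := three_le_dg (v := f i) ((hZ _).2 ⟨i + 1, rfl⟩) ((hZ _).2 ⟨i - 1, rfl⟩)
      ((hZ _).2 ⟨j, rfl⟩) (h.ne i) (fun e => hcon.1 (h.inj e).symm)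
      (fun e => hcon.2 (by rw [← h.inj e]; ring)) (h.adj i) (h.adj' i) hij
    omega
  · rintro (rfl | rfl)
    · exact h.adj i
    · exact (h.adj j).symm

theorem UC.eq_of_two_le {H : SimpleGraph W} {n : ℕ} {f : ZMod n → W} (h : UC H n f) {Z : Finset W}
    (hZ : ∀ v, v ∈ Z ↔ ∃ i, f i = v)
    {Y : Finset W} (hne : Y.Nonempty) (hY : ∀ v ∈ Y, 2 ≤ dg H Y v) :
    Y = Z := by
  have h2 := h.two_le hZ
  have hU : ∀ v ∈ Y ∪ Z, 2 ≤ dg H (Y ∪ Z) v := by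
    intro v hv
    rcases Finset.mem_union.1 hv with hv | hv
    · exact (hY v hv).trans (dg_mono Finset.subset_union_left v)
    · exact (h2 v hv).trans (dg_mono Finset.subset_union_right v)
  have hU2 := h.all_two hU
  have hno : ∀ z ∈ Z, ∀ v ∈ Y, v ∉ Z → ¬ H.Adj v z := by
    intro z hz v hv hvZ hvz
    obtain ⟨a, ha, b, hb, hab, h1, h3⟩ := two_le_dg.1 (h2 z hz)
    have := three_le_dg (Y := Y ∪ Z) (Finset.mem_union_right _ ha) (Finset.mem_union_right _ hb)
      (Finset.mem_union_left _ hv) hab (fun e => hvZ (e ▸ ha)) (fun e => hvZ (e ▸ hb)) h1 h3 hvz.symm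
    have := hU2 z (Finset.mem_union_right _ hz)
    omega
  have hsub : Y ⊆ Z := by
    by_contra hcon
    obtain ⟨w, hw, hwZ⟩ := Finset.not_subset.1 hcon
    obtain ⟨v, hv, hd⟩ := forest_leaf (h.acy 0) (Y := Y \ Z) ⟨w, Finset.mem_sdiff.2 ⟨hw, hwZ⟩⟩
    rw [Finset.mem_sdiff] at hv
    obtain ⟨a, ha, b, hb, hab, h1, h3⟩ := two_le_dg.1 (hY v hv.1)
    have : ∀ a, H.Adj v a → (H.deleteEdges {s(f 0, f (0 + 1))}).Adj v a := by
      intro a ha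
      rcases del_le (f 0) (f (0 + 1)) v a ha with h4 | h4 | h4
      · exact h4
      · exact absurd ((hZ v).2 ⟨_, h4.1.symm⟩) hv.2
      · exact absurd ((hZ v).2 ⟨_, h4.1.symm⟩) hv.2
    have := two_le_dg.2 ⟨a, Finset.mem_sdiff.2 ⟨ha, fun h5 => hno a h5 v hv.1 hv.2 h1⟩, b,
      Finset.mem_sdiff.2 ⟨hb, fun h5 => hno b h5 v hv.1 hv.2 h3⟩, hab, this a h1, this b h3⟩
    omega
  refine hsub.antisymm fun z hz => ?_
  by_contra hzY
  obtain ⟨i, rfl⟩ := (hZ z).1 hz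
  obtain ⟨v, hv, hd⟩ := forest_leaf (h.acy i) hne
  obtain ⟨a, ha, b, hb, hab, h1, h3⟩ := two_le_dg.1 (hY v hv)
  have : ∀ a ∈ Y, H.Adj v a → (H.deleteEdges {s(f i, f (i + 1))}).Adj v a := by
    intro a haY ha
    rcases del_le (f i) (f (i + 1)) v a ha with h4 | h4 | h4
    · exact h4
    · exact absurd (h4.1 ▸ hv) hzY
    · exact absurd (h4.2 ▸ haY) hzY
  have := two_le_dg.2 ⟨a, ha, b, hb, hab, this a ha h1, this b hb h3⟩
  omega

theorem UC.outside {H : SimpleGraph W} {n : ℕ} {f : ZMod n → W} (h : UC H n f) {Z : Finset W}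
    (hZ : ∀ v, v ∈ Z ↔ ∃ i, f i = v)
    {v a b : W} (hv : v ∉ Z) (ha : a ∈ Z) (hb : b ∈ Z) (h1 : H.Adj v a)
    (h3 : H.Adj v b) : a = b := by
  by_contra hab
  have h2 := h.two_le hZ
  have := h.eq_of_two_le hZ (Y := insert v Z) ⟨v, Finset.mem_insert_self _ _⟩ (by
    intro u hu
    rcases Finset.mem_insert.1 hu with rfl | hu
    · exact two_le_dg.2 ⟨a, Finset.mem_insert_of_mem ha, b, Finset.mem_insert_of_mem hb, hab, h1, h3⟩
    · exact (h2 u hu).trans (dg_mono (Finset.subset_insert _ _) u))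
  exact hv (this ▸ Finset.mem_insert_self _ _)

end forest

end ER

namespace ER
open scoped Classical
open EdgeIdealReg

theorem zmod3 : ∀ i j : ZMod 3, i ≠ j → (j = i + 1 ∨ i = j + 1) := by decide

section cls
variable {V : Type} {G : SimpleGraph V} {Hset T : Set V}

theorem att_nbr (A : CliqueAttachment G Hset T) {v : V} (hv : v ∉ Hset) :
    ∃ i, ∀ u, (u = v ∨ G.Adj v u) → u ∈ A.C i := by
  have h1 : v ∈ Hset ∪ (⋃ i, (A.C i : Set V)) := by rw [A.cover]; trivial
  rcases h1 with h1 | h1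
  · exact absurd h1 hv
  · obtain ⟨i, hi⟩ := Set.mem_iUnion.1 h1
    refine ⟨i, fun u hu => ?_⟩
    rcases hu with rfl | hu
    · exact hi
    · rcases A.edges_sub v u hu with h2 | ⟨j, hj, hu2⟩
      · exact absurd h2.1 hv
      · by_cases hij : i = j
        · subst hij; exact hu2
        · have := A.pairwise_inter i j hij ⟨hi, hj⟩
          have hT := A.T_sub (A.a_mem_T i)
          rw [Set.mem_singleton_iff] at this
          exact absurd (this ▸ hT) hv

theorem exists_cls (huni : Unicyclic (G.induce Hset)) (A : CliqueAttachment G Hset T) :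
    ∃ Cy : Finset V, (Cy = ∅ ∨ ∃ n f, ICyc G Cy n f) ∧ ∀ X0, Cls G Cy X0 := by
  obtain ⟨n, f, h⟩ := uni_data huni
  have h3 := h.n3
  have : NeZero n := ⟨by omega⟩
  obtain ⟨Z, hZ⟩ : ∃ Z : Finset Hset, ∀ v, v ∈ Z ↔ ∃ i, f i = v :=
    ⟨Finset.univ.image f, fun v => by simp⟩
  have key : ∀ Y : Finset V, Y.Nonempty → (∀ v ∈ Y, ¬ Simp G Y v) →
      Y = Z.map (Function.Embedding.subtype _) := by
    intro Y hne hY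
    have hYH : ∀ v ∈ Y, v ∈ Hset := by
      intro v hv
      by_contra hvH
      obtain ⟨i, hi⟩ := att_nbr A hvH
      refine hY v hv fun a ha b hb hab => ?_
      rw [mem_NB] at ha hb
      exact A.clique i (hi a ha.2) (hi b hb.2) hab
    have h1 := h.eq_of_two_le hZ (Y := Y.subtype (· ∈ Hset)) (by
      obtain ⟨v, hv⟩ := hne
      exact ⟨⟨v, hYH v hv⟩, by simpa using hv⟩) (by
      rintro ⟨v, hvH⟩ hv
      rw [Finset.mem_subtype] at hv
      have := hY v hv
      rw [Simp] at this
      push Not at this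
      obtain ⟨a, ha, b, hb, hab, hn⟩ := this
      rw [mem_NB] at ha hb
      have hav : a ≠ v := by
        rintro rfl
        rcases hb.2 with e | e
        · exact hab e.symm
        · exact hn e
      have hbv : b ≠ v := by
        rintro rfl
        rcases ha.2 with e | e
        · exact hab e
        · exact hn e.symm
      refine two_le_dg.2 ⟨⟨a, hYH a ha.1⟩, by simpa using ha.1, ⟨b, hYH b hb.1⟩, by simpa using hb.1,
        fun e => hab (congrArg Subtype.val e), ?_, ?_⟩
      · exact ha.2.resolve_left hav
      · exact hb.2.resolve_left hbv)
    rw [← h1]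
    exact (Finset.subtype_map_of_mem hYH).symm
  by_cases hn : n = 3
  · subst hn
    refine ⟨∅, Or.inl rfl, fun X0 => ⟨fun Y _ hne hY => ?_, by simp⟩⟩
    exfalso
    have h1 := key Y hne hY
    obtain ⟨v, hv⟩ := hne
    refine hY v hv fun a ha b hb hab => ?_
    rw [mem_NB, h1] at ha hb
    obtain ⟨a', ha', rfl⟩ := Finset.mem_map.1 ha.1
    obtain ⟨b', hb', rfl⟩ := Finset.mem_map.1 hb.1
    obtain ⟨i, rfl⟩ := (hZ _).1 ha'
    obtain ⟨j, rfl⟩ := (hZ _).1 hb'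
    have hij : i ≠ j := fun e => hab (by rw [e])
    have h2 := (h.adj_iff hZ i j).2 (zmod3 i j hij)
    exact h2
  · refine ⟨Z.map (Function.Embedding.subtype _), Or.inr ⟨n, fun i => (f i : V), ?_⟩, fun X0 =>
      ⟨fun Y _ hne hY => key Y hne hY, ?_⟩⟩
    · refine ⟨by omega, fun i j e => h.inj (Subtype.ext e), fun i j => h.adj_iff hZ i j, fun v => ?_⟩
      constructor
      · intro hv
        obtain ⟨a', ha', rfl⟩ := Finset.mem_map.1 hv
        obtain ⟨i, rfl⟩ := (hZ _).1 ha'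
        exact ⟨i, rfl⟩
      · rintro ⟨i, rfl⟩
        exact Finset.mem_map.2 ⟨f i, (hZ _).2 ⟨i, rfl⟩, rfl⟩
    · intro v _ hv a ha b hb h1 h2
      obtain ⟨a', ha', rfl⟩ := Finset.mem_map.1 ha
      obtain ⟨b', hb', rfl⟩ := Finset.mem_map.1 hb
      by_cases hvH : v ∈ Hset
      · have := h.outside hZ (v := ⟨v, hvH⟩) (fun h4 => hv (Finset.mem_map.2 ⟨_, h4, rfl⟩)) ha' hb' h1 h2
        rw [this]
      · obtain ⟨i, hi⟩ := att_nbr A hvH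
        have e1 : (a' : V) ∈ (A.C i : Set V) ∩ Hset := ⟨hi _ (Or.inr h1), a'.2⟩
        have e2 : (b' : V) ∈ (A.C i : Set V) ∩ Hset := ⟨hi _ (Or.inr h2), b'.2⟩
        rw [A.inter_H, Set.mem_singleton_iff] at e1 e2
        exact e1.trans e2.symm

end cls

end ER

namespace ER
open scoped Classical
open EdgeIdealReg

section transport
variable {W V K : Type} [Field K] {G : SimpleGraph V} (ι : W ↪ V)

theorem tr_rm (X : Finset W) (u : W) :
    (rm (G.comap ι) X u).map ι = rm G (X.map ι) (ι u) := by
  ext v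
  simp only [Finset.mem_map, mem_rm, SimpleGraph.comap_adj]
  constructor
  · rintro ⟨a, ⟨h1, h2, h3⟩, rfl⟩
    exact ⟨⟨a, h1, rfl⟩, fun e => h2 (ι.injective e), h3⟩
  · rintro ⟨⟨a, h1, rfl⟩, h2, h3⟩
    exact ⟨a, ⟨h1, fun e => h2 (by rw [e]), h3⟩, rfl⟩

theorem tr_rmC (X C : Finset W) :
    (rmC (G.comap ι) X C).map ι = rmC G (X.map ι) (C.map ι) := by
  ext v
  simp only [Finset.mem_map, mem_rmC, SimpleGraph.comap_adj]
  constructor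
  · rintro ⟨a, ⟨h1, h2, h3⟩, rfl⟩
    refine ⟨⟨a, h1, rfl⟩, ?_, ?_⟩
    · rintro ⟨b, hb, e⟩
      exact h2 (ι.injective e ▸ hb)
    · rintro _ ⟨b, hb, rfl⟩
      exact h3 b hb
  · rintro ⟨⟨a, h1, rfl⟩, h2, h3⟩
    exact ⟨a, ⟨h1, fun hb => h2 ⟨a, hb, rfl⟩, fun b hb => h3 _ ⟨b, hb, rfl⟩⟩, rfl⟩

theorem tr_Cfg {Cy A X : Finset W} {w : ℕ} (h : Cfg (G.comap ι) Cy A X w) :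
    Cfg G (Cy.map ι) (A.map ι) (X.map ι) w := by
  induction h with
  | nil X => exact Cfg.nil _
  | pt X u w h1 h2 _ ih =>
    rw [tr_rm] at ih
    exact Cfg.pt _ (ι u) _ (Finset.mem_map_of_mem _ h1) (Finset.mem_map_of_mem _ h2) ih
  | ed X u v w h1 h2 h3 _ ih =>
    rw [tr_rm, tr_rm] at ih
    exact Cfg.ed _ (ι u) (ι v) _ (Finset.mem_map_of_mem _ h1) (Finset.mem_map_of_mem _ h2) h3 ih
  | cy X w h1 _ ih =>
    rw [tr_rmC] at ih
    have := Cfg.cy _ _ (Finset.map_subset_map.2 h1) ih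
    rwa [Finset.card_map] at this

theorem Cfg.le_card {H : SimpleGraph W} {Cy A X : Finset W} {w : ℕ} (h : Cfg H Cy A X w) :
    w ≤ X.card := by
  induction h with
  | nil X => exact Nat.zero_le _
  | pt X u w h1 h2 _ ih =>
    have : rm H X u ⊂ X := Finset.ssubset_iff_subset_ne.2 ⟨fun v hv => (mem_rm.1 hv).1, fun e => by
      rw [← e, mem_rm] at h1; exact h1.2.1 rfl⟩
    have := Finset.card_lt_card this
    omega
  | ed X u v w h1 h2 h3 _ ih =>
    have h4 : rm H X u ⊂ X := Finset.ssubset_iff_subset_ne.2 ⟨fun v hv => (mem_rm.1 hv).1, fun e => by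
      rw [← e, mem_rm] at h1; exact h1.2.1 rfl⟩
    have h5 : rm H (rm H X u) v ⊆ rm H X u := fun v hv => (mem_rm.1 hv).1
    have := Finset.card_lt_card h4
    have := Finset.card_le_card h5
    omega
  | cy X w h1 _ ih =>
    have h4 : rmC H X Cy ⊆ X \ Cy := fun v hv => by
      rw [mem_rmC] at hv
      exact Finset.mem_sdiff.2 ⟨hv.1, hv.2.1⟩
    have h5 := Finset.card_le_card h4
    rw [Finset.card_sdiff_of_subset h1] at h5
    have := Finset.card_le_card h1
    omega

theorem tr_J (X : Finset W) (s : ℕ) (m : W →₀ ℕ) :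
    J G (X.map ι) s (m.mapDomain ι) ↔ J (G.comap ι) X s m := by
  constructor
  · intro h p hp
    have := h (p.map ι) (by
      intro u hu v hv huv
      obtain ⟨a, ha, rfl⟩ := Finset.mem_map.1 hu
      obtain ⟨b, hb, rfl⟩ := Finset.mem_map.1 hv
      exact (hp a ha b hb huv).imp (Finset.mem_map_of_mem _) (Finset.mem_map_of_mem _))
    rw [← Finset.map_inter, Finset.sum_map] at this
    simpa only [Finsupp.mapDomain_apply ι.injective] using this
  · intro h q hq
    have := h (X.filter (ι · ∈ q)) (by
      intro u hu v hv huv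
      have := hq _ (Finset.mem_map_of_mem _ hu) _ (Finset.mem_map_of_mem _ hv) huv
      simpa [hu, hv] using this)
    have e : X.map ι ∩ q = (X ∩ X.filter (ι · ∈ q)).map ι := by
      ext v
      simp only [Finset.mem_inter, Finset.mem_map, Finset.mem_filter]
      constructor
      · rintro ⟨⟨a, ha, rfl⟩, hq⟩
        exact ⟨a, ⟨ha, ha, hq⟩, rfl⟩
      · rintro ⟨a, ⟨ha, -, hq⟩, rfl⟩
        exact ⟨⟨a, ha, rfl⟩, hq⟩
    rw [e, Finset.sum_map]
    simpa only [Finsupp.mapDomain_apply ι.injective] using this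

theorem tr_Cls {Cy : Finset W} (h : ∀ X0, Cls G (Cy.map ι) X0) (X0 : Finset W) :
    Cls (G.comap ι) Cy X0 := by
  refine ⟨fun Y _ hne hY => ?_, ?_⟩
  · have := (h (Y.map ι)).1 (Y.map ι) subset_rfl (by simpa using hne) (by
      intro v hv hs
      obtain ⟨a, ha, rfl⟩ := Finset.mem_map.1 hv
      refine hY a ha fun x hx y hy hxy => ?_
      rw [mem_NB] at hx hy
      refine hs (ι x) ?_ (ι y) ?_ (fun e => hxy (ι.injective e))
      · rw [mem_NB]; exact ⟨Finset.mem_map_of_mem _ hx.1, hx.2.imp (fun e => by rw [e]) id⟩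
      · rw [mem_NB]; exact ⟨Finset.mem_map_of_mem _ hy.1, hy.2.imp (fun e => by rw [e]) id⟩)
    exact Finset.map_injective ι this
  · intro v hv hvC a ha b hb h1 h2
    exact ι.injective ((h (X0.map ι)).2 (ι v) (Finset.mem_map_of_mem _ hv) (by simpa using hvC) _
      (Finset.mem_map_of_mem _ ha) _ (Finset.mem_map_of_mem _ hb) h1 h2)

theorem tr_ICyc {Cy : Finset W} (h : Cy.map ι = ∅ ∨ ∃ n f, ICyc G (Cy.map ι) n f) :
    Cy = ∅ ∨ ∃ n f, ICyc (G.comap ι) Cy n f := by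
  rcases h with h | ⟨n, f, h⟩
  · left; simpa using h
  · right
    have : ∀ i, ∃ w ∈ Cy, ι w = f i := fun i => Finset.mem_map.1 ((h.mem (f i)).2 ⟨i, rfl⟩)
    choose g hg1 hg2 using this
    refine ⟨n, g, h.n4, fun i j e => h.inj (by rw [← hg2, ← hg2, e]), fun i j => ?_, fun v => ?_⟩
    · rw [SimpleGraph.comap_adj, hg2, hg2, h.adj]
    · rw [← Finset.mem_map' ι, h.mem]
      refine exists_congr fun i => ?_
      rw [← hg2, ι.injective.eq_iff]

theorem upperR {Cy : Finset W} {X : Finset W} {B : ℤ} {s : ℕ} (hs : 1 ≤ s)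
    (hi : Cy.map ι = ∅ ∨ ∃ n f, ICyc G (Cy.map ι) n f) (h : ∀ X0, Cls G (Cy.map ι) X0)
    (hB : Bd (G.comap ι) Cy X ∅ B) :
    R K (fun m : W →₀ ℕ => J G (X.map ι) s (m.mapDomain ι)) (2 * s - 1 + B) := by
  have h1 := main (K := K) (tr_Cls ι h X) (by
    intro s A B hs _ _ hne _ hA hB
    rcases tr_ICyc ι hi with h2 | ⟨n, f, h2⟩
    · simp [h2] at hne
    · exact cyc_step h2 hs hA hB) s _ X ∅ B rfl subset_rfl (by simp) hB
  have e : ind (∅ : Finset W) = 0 := by ext v; simp [ind_apply]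
  simp only [QJ, e, zero_add, Finset.card_empty, Nat.cast_zero, sub_zero] at h1
  rcases h1 with h1 | h1
  · have := h1 0 X (fun u hu v hv _ => Or.inl hu)
    simp at this; omega
  · exact h1.congr fun m => (tr_J ι X s m).symm

theorem lowerR {Cy : Finset W} {X : Finset W} {w N : ℕ} {d : ℤ} (hd : 0 ≤ d) (hN : X.card ≤ N)
    (hi : Cy.map ι = ∅ ∨ ∃ n f, ICyc G (Cy.map ι) n f) (hw : Cfg (G.comap ι) Cy ∅ X w)
    (hex : ∀ (a : W →₀ ℕ) (j : ℕ), j ≤ N → d + 1 + j < (a.degree : ℤ) → ∀ c : Finset W → K,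
      Adm (fun m => J G (X.map ι) 1 (m.mapDomain ι)) a j c → bd a.support c = 0 →
      ∃ b : Finset W → K, Adm (fun m => J G (X.map ι) 1 (m.mapDomain ι)) a (j + 1) b ∧
        bd a.support b = c) : (w : ℤ) ≤ d := by
  obtain ⟨U, hU, hNV⟩ := Cfg.NV (K := K) (tr_ICyc ι hi) hw
  have e : (fun m : W →₀ ℕ => J G (X.map ι) 1 (m.mapDomain ι)) = J (G.comap ι) X 1 := by
    funext m; exact propext (tr_J ι X 1 m)
  rw [e] at hex
  exact nonvan hU hNV hd fun j hj => hex (ind U) j (hj.trans ((Finset.card_le_card hU).trans hN))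

end transport

end ER

namespace ER
open scoped Classical
open EdgeIdealReg

section final
variable {V K : Type} [Field K] {G : SimpleGraph V}

/-- A graded free resolution only involves finitely many variables in its generators. -/
theorem res_vars {I : Ideal (MvPolynomial V K)} (F : GradedFreeResolution I) :
    ∃ U : Finset V, ∀ f ∈ I, aeval (fun w => if w ∈ U then (X w : MvPolynomial V K) else 1) f ∈ I := by
  refine ⟨Finset.univ.biUnion fun k => Finset.univ.biUnion fun j => (F.mat 0 k j).vars, ?_⟩
  generalize hU : (Finset.univ.biUnion fun k => Finset.univ.biUnion fun j => (F.mat 0 k j).vars) = U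
  intro f hf
  rw [F.range_zero] at hf ⊢
  obtain ⟨u, hu⟩ := hf
  refine ⟨fun j => aeval (fun w => if w ∈ U then (X w : MvPolynomial V K) else 1) (u j), ?_⟩
  funext k
  have h1 := congrFun hu k
  rw [Matrix.mulVecLin_apply, Matrix.mulVec, dotProduct] at h1 ⊢
  rw [← h1, map_sum]
  refine Finset.sum_congr rfl fun j _ => ?_
  rw [map_mul]
  congr 1
  have hv : ∀ w ∈ (F.mat 0 k j).vars, w ∈ U := by
    intro w hw
    rw [← hU]
    simp only [Finset.mem_biUnion, Finset.mem_univ, true_and]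
    exact ⟨k, j, hw⟩
  conv_lhs => rw [← aeval_X_left_apply (F.mat 0 k j)]
  refine eval₂Hom_congr' rfl (fun w hw _ => ?_) rfl
  simp [hv w hw]

theorem exists_prime (v : V) : ∃ P : Ideal (MvPolynomial V K), P.IsPrime ∧ edgeIdeal K G ≤ P ∧ X v ∉ P := by
  let φ : MvPolynomial V K →ₐ[K] Polynomial K := aeval fun w => if w = v then Polynomial.X else 0
  refine ⟨RingHom.ker φ, RingHom.ker_isPrime _, ?_, ?_⟩
  · rw [edgeIdeal, Ideal.span_le]
    rintro _ ⟨a, b, hab, rfl⟩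
    rw [SetLike.mem_coe, RingHom.mem_ker, map_mul]
    simp only [φ, aeval_X]
    by_cases h : a = v
    · rw [if_neg (c := b = v) (fun e => hab.ne (h.trans e.symm)), mul_zero]
    · rw [if_neg h, zero_mul]
  · rw [RingHom.mem_ker]
    simp [φ]

theorem pow_notMem_edge (v : V) (r : ℕ) : (X v ^ r : MvPolynomial V K) ∉ edgeIdeal K G := by
  obtain ⟨P, hP, h1, h2⟩ := exists_prime (K := K) (G := G) v
  exact fun h => h2 (hP.mem_of_pow_mem r (h1 h))

theorem pow_notMem_symb (v : V) {r : ℕ} (hr : 1 ≤ r) :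
    (X v ^ r : MvPolynomial V K) ∉ symbolicPower (edgeIdeal K G) r := by
  obtain ⟨P, hP, h1, h2⟩ := exists_prime (K := K) (G := G) v
  obtain ⟨p, hp, hpP⟩ := Ideal.exists_minimalPrimes_le h1
  intro h
  obtain ⟨s, hs, hsf⟩ := h p hp
  have h3 := hp.1.2 (Ideal.pow_le_self (by omega) hsf)
  rcases hp.1.1.mem_or_mem h3 with h4 | h4
  · exact hs h4
  · exact h2 (hP.mem_of_pow_mem r (hpP h4))

theorem no_res (hinf : ∀ X0 : Finset V, ∃ u v, G.Adj u v ∧ u ∉ X0) {I : Ideal (MvPolynomial V K)} {r : ℕ}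
    (hI : ∀ v, (X v ^ r : MvPolynomial V K) ∉ I) (hI2 : ∀ u v, G.Adj u v → (X u * X v) ^ r ∈ I) :
    GradedFreeResolution I → False := by
  intro F
  obtain ⟨U, hU⟩ := res_vars F
  obtain ⟨u, v, huv, hu⟩ := hinf U
  have h1 := hU _ (hI2 u v huv)
  rw [map_pow, map_mul, aeval_X, aeval_X, if_neg hu, one_mul] at h1
  split_ifs at h1 with h
  · exact hI v h1
  · rw [one_pow] at h1
    have := I.mul_mem_left (X v ^ r) h1
    rw [mul_one] at this
    exact hI v this

theorem inf_case (hinf : ∀ X0 : Finset V, ∃ u v, G.Adj u v ∧ u ∉ X0) (r : ℕ) (hr : 1 ≤ r) :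
    regQuot (symbolicPower (edgeIdeal K G) r) ≤
      ((2 * (r : ℤ) - 2 : ℤ) : WithBot ℤ) + regQuot (edgeIdeal K G) := by
  obtain ⟨v, -⟩ := hinf ∅
  have hE : ∀ u v, G.Adj u v → (X u * X v : MvPolynomial V K) ∈ edgeIdeal K G := fun u v h =>
    Ideal.subset_span ⟨u, v, h, rfl⟩
  have n1 := no_res (K := K) (I := edgeIdeal K G) hinf (fun v => pow_notMem_edge v 1)
    (fun u v h => by rw [pow_one]; exact hE u v h)
  have n2 := no_res (K := K) (I := symbolicPower (edgeIdeal K G) r) hinf (fun v => pow_notMem_symb v hr)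
    (fun u v h p hp => ⟨1, (Ideal.ne_top_iff_one p).1 hp.1.1.ne_top, by
      rw [one_mul]; exact Ideal.pow_mem_pow (hE u v h) r⟩)
  have t1 : edgeIdeal K G ≠ ⊤ := fun h => pow_notMem_edge (K := K) (G := G) v 1 (h ▸ trivial)
  have t2 : symbolicPower (edgeIdeal K G) r ≠ ⊤ := fun h =>
    pow_notMem_symb (K := K) (G := G) v hr (h ▸ trivial)
  have e1 : { d : ℤ | ∃ F : GradedFreeResolution (edgeIdeal K G),
      ∀ i (k : Fin (F.rank i)), (F.deg i k : ℤ) ≤ d + i } = ∅ :=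
    Set.eq_empty_iff_forall_notMem.2 fun d ⟨F, _⟩ => n1 F
  have e2 : { d : ℤ | ∃ F : GradedFreeResolution (symbolicPower (edgeIdeal K G) r),
      ∀ i (k : Fin (F.rank i)), (F.deg i k : ℤ) ≤ d + i } = ∅ :=
    Set.eq_empty_iff_forall_notMem.2 fun d ⟨F, _⟩ => n2 F
  rw [regQuot, regQuot, if_neg t1, if_neg t2, e1, e2, ← WithBot.coe_add, WithBot.coe_le_coe,
    Int.csInf_empty]
  omega

theorem J_comap (X0 : Finset V) (s : ℕ) (m : V →₀ ℕ) (h : J G X0 s m) :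
    J G X0 s ((m.comapDomain Subtype.val Subtype.val_injective.injOn :
      {v // v ∈ X0} →₀ ℕ).mapDomain Subtype.val) := by
  intro q hq
  refine (h q hq).trans (le_of_eq (Finset.sum_congr rfl fun v hv => ?_))
  have hv := (Finset.mem_inter.1 hv).1
  have := Finsupp.mapDomain_apply Subtype.val_injective
    (m.comapDomain Subtype.val Subtype.val_injective.injOn : {v // v ∈ X0} →₀ ℕ) ⟨v, hv⟩
  exact this.symm

theorem upper_res {I : Ideal (MvPolynomial V K)} {X0 : Finset V} {s B : ℕ} (hs : 1 ≤ s)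
    (hI : ∀ f, f ∈ I ↔ ∀ m, coeff m f ≠ 0 → J G X0 s m)
    (hR : R K (fun m : {v // v ∈ X0} →₀ ℕ => J G X0 s (m.mapDomain Subtype.val)) (2 * s - 1 + B)) :
    ∃ F : GradedFreeResolution I, ∀ i k, (F.deg i k : ℤ) ≤ 2 * s - 2 + B + i := by
  let I0 : Ideal (MvPolynomial {v // v ∈ X0} K) := I.comap
    (rename Subtype.val : MvPolynomial {v // v ∈ X0} K →ₐ[K] MvPolynomial V K)
  have h0 : ∀ f, f ∈ I0 ↔ ∀ m, coeff m f ≠ 0 → J G X0 s (m.mapDomain Subtype.val) := by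
    intro f
    rw [Ideal.mem_comap, hI]
    constructor
    · intro h m hm
      apply h
      rwa [coeff_rename_mapDomain _ Subtype.val_injective]
    · intro h m hm
      obtain ⟨μ, rfl, hμ⟩ := coeff_rename_ne_zero _ _ _ hm
      exact h μ hμ
  have e := map_mono (fun v => v ∈ X0) (J_comap X0 s) h0 hI
  have e2 : (2 * s - 1 + B : ℤ) = ((2 * s - 1 + B : ℕ) : ℤ) := by omega
  rw [e2] at hR
  obtain ⟨F, hF⟩ := exists_res h0 hR (by omega)
  rw [e]
  refine ⟨baseChange _ F, fun i k => ?_⟩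
  have := hF i k
  change (F.deg i k : ℤ) ≤ _
  omega

theorem J_ne_top {I : Ideal (MvPolynomial V K)} {X0 : Finset V} {s : ℕ} (hs : 1 ≤ s)
    (hI : ∀ f, f ∈ I ↔ ∀ m, coeff m f ≠ 0 → J G X0 s m) : I ≠ ⊤ := by
  intro h
  have h1 : (1 : MvPolynomial V K) ∈ I := by rw [h]; trivial
  have := (hI 1).1 h1 0 (by simp) X0 (fun u hu v _ _ => Or.inl hu)
  simp at this
  omega

theorem res_nonneg {I : Ideal (MvPolynomial V K)} (F : GradedFreeResolution I) {d : ℤ}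
    (h : ∀ i k, (F.deg i k : ℤ) ≤ d + i) : 0 ≤ d := by
  have := h 0 ⟨0, by rw [F.rank_zero]; norm_num⟩
  rw [F.deg_zero] at this
  simpa using this

theorem lower_res {X0 : Finset V} (hX0 : ∀ u v, G.Adj u v → u ∈ X0)
    {Cy : Finset {v // v ∈ X0}} {w : ℕ} {d : ℤ}
    (hi : Cy.map (Function.Embedding.subtype _) = ∅ ∨
      ∃ n f, ICyc G (Cy.map (Function.Embedding.subtype _)) n f)
    (hw : Cfg (G.comap (Function.Embedding.subtype (· ∈ X0))) Cy ∅ X0.attach w)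
    (F : GradedFreeResolution (edgeIdeal K G)) (h : ∀ i k, (F.deg i k : ℤ) ≤ d + i) : (w : ℤ) ≤ d := by
  obtain ⟨U, hU, hex⟩ := descent (mem_edgeIdeal hX0) F h X0.card X0
  let j : {v // v ∈ X0} ↪ {v // v ∈ U} := ⟨fun v => ⟨v, hU v.2⟩, fun a b e => Subtype.ext (congrArg (fun x : {v // v ∈ U} => x.1) e)⟩
  have hw' : Cfg (G.comap (Function.Embedding.subtype (· ∈ U))) (Cy.map j) ∅ (X0.attach.map j) w := by
    have := tr_Cfg (G := G.comap (Function.Embedding.subtype (· ∈ U))) j (A := ∅) hw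
    simpa only [Finset.map_empty] using this
  have e0 : j.trans (Function.Embedding.subtype (· ∈ U)) = Function.Embedding.subtype (· ∈ X0) := rfl
  have e1 : (X0.attach.map j).map (Function.Embedding.subtype (· ∈ U)) = X0 := by
    rw [Finset.map_map, e0, Finset.attach_map_val]
  have e2 : (Cy.map j).map (Function.Embedding.subtype (· ∈ U)) =
      Cy.map (Function.Embedding.subtype (· ∈ X0)) := by
    rw [Finset.map_map, e0]
  refine lowerR (K := K) (N := X0.card) (Function.Embedding.subtype (· ∈ U)) (res_nonneg F h) (by simp)
    (by rw [e2]; exact hi) hw' ?_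
  rw [e1]
  exact hex

theorem fin_case {X0 : Finset V} (hX0 : ∀ u v, G.Adj u v → u ∈ X0) {Cy : Finset V}
    (hi : Cy = ∅ ∨ ∃ n f, ICyc G Cy n f) (hcls : ∀ X0, Cls G Cy X0) (r : ℕ) (hr : 1 ≤ r) :
    regQuot (symbolicPower (edgeIdeal K G) r) ≤
      ((2 * (r : ℤ) - 2 : ℤ) : WithBot ℤ) + regQuot (edgeIdeal K G) := by
  have hCX : ∀ v ∈ Cy, v ∈ X0 := by
    intro v hv
    rcases hi with rfl | ⟨n, f, h⟩
    · simp at hv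
    · obtain ⟨i, rfl⟩ := (h.mem v).1 hv
      exact hX0 _ (f (i + 1)) ((h.adj _ _).2 (Or.inl rfl))
  obtain ⟨C, rfl⟩ : ∃ C : Finset {v // v ∈ X0}, C.map (Function.Embedding.subtype _) = Cy :=
    ⟨Cy.subtype (· ∈ X0), Finset.subtype_map_of_mem hCX⟩
  obtain ⟨B, hB1, hB2⟩ : ∃ B : ℕ, Cfg (G.comap (Function.Embedding.subtype (· ∈ X0))) C ∅ X0.attach B ∧
      Bd (G.comap (Function.Embedding.subtype (· ∈ X0))) C X0.attach ∅ B := by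
    have hb : BddAbove {w | Cfg (G.comap (Function.Embedding.subtype (· ∈ X0))) C ∅ X0.attach w} :=
      ⟨_, fun w hw => hw.le_card⟩
    have := Nat.sSup_mem (s := {w | Cfg (G.comap (Function.Embedding.subtype (· ∈ X0))) C ∅ X0.attach w})
      ⟨0, Cfg.nil _⟩ hb
    exact ⟨_, this, fun w hw => by exact_mod_cast le_csSup hb hw⟩
  have hR : ∀ s : ℕ, 1 ≤ s →
      R K (fun m : {v // v ∈ X0} →₀ ℕ => J G X0 s (m.mapDomain Subtype.val)) (2 * s - 1 + B) := by
    intro s hs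
    have := upperR (K := K) (Function.Embedding.subtype (· ∈ X0)) hs hi hcls hB2
    rw [Finset.attach_map_val] at this
    exact this
  have m1 : ∀ f : MvPolynomial V K, f ∈ edgeIdeal K G ↔ ∀ m, coeff m f ≠ 0 → J G X0 1 m := mem_edgeIdeal hX0
  have m2 : ∀ f : MvPolynomial V K, f ∈ symbolicPower (edgeIdeal K G) r ↔ ∀ m, coeff m f ≠ 0 → J G X0 r m :=
    mem_symb hX0 r
  obtain ⟨F1, hF1⟩ := upper_res le_rfl m1 (hR 1 le_rfl)
  obtain ⟨F2, hF2⟩ := upper_res hr m2 (hR r hr)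
  rw [regQuot, regQuot, if_neg (J_ne_top le_rfl m1), if_neg (J_ne_top hr m2), ← WithBot.coe_add,
    WithBot.coe_le_coe]
  have h1 : (B : ℤ) ≤ sInf { d : ℤ | ∃ F : GradedFreeResolution (edgeIdeal K G),
      ∀ i (k : Fin (F.rank i)), (F.deg i k : ℤ) ≤ d + i } := 
    le_csInf ⟨_, F1, hF1⟩ fun d ⟨F, hF⟩ => lower_res hX0 hi hB1 F hF
  have h2 : sInf { d : ℤ | ∃ F : GradedFreeResolution (symbolicPower (edgeIdeal K G) r),
      ∀ i (k : Fin (F.rank i)), (F.deg i k : ℤ) ≤ d + i } ≤ 2 * r - 2 + B := 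
    csInf_le ⟨0, fun d ⟨F, hF⟩ => res_nonneg F hF⟩ ⟨F2, hF2⟩
  omega

end final

end ER

open EdgeIdealReg in
/-- If `H` is unicyclic and `G = H_T` is obtained by attaching unions of complete graphs at
the vertices of `T ⊆ V(H)`, then `reg(S/I(G)^{(r)}) ≤ 2r + reg(S/I(G)) - 2` for all `r ≥ 1`. -/
theorem reg_symbolic_unicyclic_attached_bound {V K : Type} [Field K]
    (G : SimpleGraph V) (Hset T : Set V) (huni : Unicyclic (G.induce Hset))
    (hatt : Nonempty (CliqueAttachment G Hset T)) (r : ℕ) (hr : 1 ≤ r) :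
    regQuot (symbolicPower (edgeIdeal K G) r) ≤
      ((2 * (r : ℤ) - 2 : ℤ) : WithBot ℤ) + regQuot (edgeIdeal K G) := by
  obtain ⟨A⟩ := hatt
  obtain ⟨Cy, hi, hcls⟩ := ER.exists_cls huni A
  by_cases h : ∃ X0 : Finset V, ∀ u v, G.Adj u v → u ∈ X0
  · obtain ⟨X0, hX0⟩ := h
    exact ER.fin_case hX0 hi hcls r hr
  · push Not at h
    exact ER.inf_case h r hr
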